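/- arXiv:2410.12752 — 3 statements merged into one kernel-verified Lean document; each statement's English description precedes it below -/
import Mathlib

section
/- For every d ≥ 1 and every k ≥ d - 1, the dimension of the space of global holomorphic sections H⁰(ℙ¹(ℂ), ⊕_{n≥0} E^{GG}_{k,n} ⊗ O(d)) of the twisted Green-Griffiths bundle over the projective line equals 2^d. -/
namespace Jet
open PowerSeries

abbrev R := MvPolynomial ℕ ℂ

noncomputable def ev (f : PowerSeries ℂ) : R →ₐ[ℂ] ℂ := MvPolynomial.aeval fun n => coeff n f

theorem ev_X (f : PowerSeries ℂ) (n : ℕ) : ev f (MvPolynomial.X n) = coeff n f := by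
  simp [ev]

/-- sections of O(d) -/
def Sec (d : ℕ) : Submodule ℂ (R × R) where
  carrier := {s | ∀ f h : PowerSeries ℂ, f * h = 1 → ev f s.1 = (coeff 0 f) ^ d * ev h s.2}
  add_mem' := by
    intro a b ha hb f h e
    simp only [Prod.fst_add, Prod.snd_add, map_add, ha f h e, hb f h e]; ring
  zero_mem' := by intro f h e; simp
  smul_mem' := by
    intro c a ha f h e
    simp only [Prod.smul_fst, Prod.smul_snd, map_smul, ha f h e, smul_eq_mul]; ring

theorem dense (P : R) (hP : ∀ f : PowerSeries ℂ, coeff 0 f ≠ 0 → ev f P = 0) : P = 0 := by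
  have : MvPolynomial.X 0 * P = 0 := by
    apply MvPolynomial.funext
    intro x
    have := hP (PowerSeries.mk x)
    simp only [coeff_mk] at this
    by_cases h0 : x 0 = 0
    · simp [h0]
    · have := this h0
      simp only [ev, coeff_mk] at this
      have h2 : MvPolynomial.eval x P = 0 := this
      rw [map_mul, h2]; simp
  exact (mul_eq_zero.1 this).resolve_left (MvPolynomial.X_ne_zero 0)

theorem exists_inv (f : PowerSeries ℂ) (hf : coeff 0 f ≠ 0) : f * f⁻¹ = 1 :=
  PowerSeries.mul_inv_cancel f (by simpa using hf)

theorem coeff0_ne {f h : PowerSeries ℂ} (e : f * h = 1) : coeff 0 f * coeff 0 h = 1 := by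
  have := congrArg (coeff 0) e
  simpa using this

/-! Toeplitz minors -/
section toep
variable {A : Type*} [CommRing A]

def T (a : ℕ → A) (d : ℕ) : Matrix (Fin d) (Fin d) A :=
  Matrix.of fun i j => if (j : ℕ) ≤ i then a (i - j) else 0

theorem T_mul (f h : PowerSeries A) (e : f * h = 1) (d : ℕ) :
    T (fun n => coeff n f) d * T (fun n => coeff n h) d = 1 := by
  ext i j
  rw [Matrix.mul_apply]
  have h1 : ∀ l : Fin d, T (fun n => coeff n f) d i l * T (fun n => coeff n h) d l j =
      (fun l : ℕ => if j ≤ l ∧ l ≤ i then coeff (i - l) f * coeff (l - j) h else 0) l := by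
    intro l
    simp only [T, Matrix.of_apply]
    split_ifs <;> first | rfl | (exfalso; tauto) | simp
  rw [Finset.sum_congr rfl (fun l _ => h1 l), Fin.sum_univ_eq_sum_range
    (fun l : ℕ => if j ≤ l ∧ l ≤ i then coeff (i - l) f * coeff (l - j) h else 0) d,
    ← Finset.sum_filter]
  by_cases hij : (j : ℕ) ≤ i
  · have h2 : coeff ((i : ℕ) - j) (f * h) = if i = j then 1 else 0 := by
      rw [e, coeff_one]
      congr 1
      rw [Fin.ext_iff]; apply propext; omega
    rw [Matrix.one_apply, ← h2, coeff_mul]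
    symm
    apply Finset.sum_nbij' (fun p : ℕ × ℕ => p.2 + (j : ℕ)) (fun l : ℕ => ((i : ℕ) - l, l - (j : ℕ)))
    · intro p hp; simp at hp ⊢; have := i.2; omega
    · intro p hp; simp at hp ⊢; omega
    · rintro ⟨p, q⟩ hp; simp at hp ⊢; omega
    · intro p hp; simp at hp ⊢; omega
    · rintro ⟨p, q⟩ hp; simp at hp ⊢
      congr 3; omega
  · rw [Matrix.one_apply, if_neg (by rintro rfl; simp at hij)]
    apply Finset.sum_eq_zero
    intro l hl; simp at hl; omega

theorem T_det (a : ℕ → A) (d : ℕ) : (T a d).det = a 0 ^ d := by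
  rw [Matrix.det_of_lowerTriangular]
  · simp [T]
  · intro i j hij
    simp [T] at hij ⊢
    intro h; omega

def M (a : ℕ → A) (d : ℕ) (c : Fin d → Fin d ⊕ Fin d) : A :=
  ((Matrix.fromCols (T a d) 1).submatrix id c).det

theorem M_sec (f h : PowerSeries A) (e : f * h = 1) (d : ℕ) (c : Fin d → Fin d ⊕ Fin d) :
    M (fun n => coeff n f) d c = (coeff 0 f) ^ d * M (fun n => coeff n h) d (Sum.swap ∘ c) := by
  have h1 : (Matrix.fromCols (T (fun n => coeff n f) d) 1).submatrix id c =
      T (fun n => coeff n f) d *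
        (Matrix.fromCols (T (fun n => coeff n h) d) 1).submatrix id (Sum.swap ∘ c) := by
    have : Matrix.fromCols (T (fun n => coeff n f) d) 1 =
      T (fun n => coeff n f) d * Matrix.fromCols 1 (T (fun n => coeff n h) d) := by
      rw [Matrix.mul_fromCols, T_mul f h e, mul_one]
    rw [this]
    ext i j
    simp only [Matrix.submatrix_apply, Matrix.mul_apply, id]
    apply Finset.sum_congr rfl
    intro l _
    congr 1
    rcases hc : c j with x | x <;> simp [hc]
  rw [M, h1, Matrix.det_mul, T_det, M]

theorem M_map {B : Type*} [CommRing B] (φ : A →+* B) (a : ℕ → A) (b : ℕ → B) (d : ℕ)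
    (hab : ∀ n < d, φ (a n) = b n) (c) : φ (M a d c) = M b d c := by
  rw [M, RingHom.map_det, M]
  congr 1
  ext i j
  simp only [RingHom.mapMatrix_apply, Matrix.map_apply, Matrix.submatrix_apply, id]
  rcases c j with x | x
  · simp only [Matrix.fromCols_apply_inl, T, Matrix.of_apply]
    split_ifs
    · exact hab _ (by omega)
    · simp
  · simp [Matrix.one_apply, apply_ite φ]

def cT {d : ℕ} (c : Fin d → Fin d ⊕ Fin d) : Fin (d + 1) → Fin (d + 1) ⊕ Fin (d + 1) :=
  Fin.cons (Sum.inl 0) (fun m => Sum.map Fin.succ Fin.succ (c m))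

def cF {d : ℕ} (c : Fin d → Fin d ⊕ Fin d) : Fin (d + 1) → Fin (d + 1) ⊕ Fin (d + 1) :=
  Fin.cons (Sum.inr 0) (fun m => Sum.map Fin.castSucc Fin.succ (c m))

theorem M_cT (a : ℕ → A) (d : ℕ) (c : Fin d → Fin d ⊕ Fin d) :
    M a (d + 1) (cT c) = a 0 * M a d c := by
  rw [M, Matrix.det_succ_row_zero, Fin.sum_univ_succ, Finset.sum_eq_zero, add_zero]
  · simp only [Fin.val_zero, pow_zero, one_mul]
    have : (Matrix.fromCols (T a (d+1)) 1).submatrix id (cT c) 0 0 = a 0 := by simp [cT, T]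
    rw [this, M]; congr 2
    ext i j
    simp only [Matrix.submatrix_apply, id, cT, Fin.zero_succAbove, Fin.cons_succ]
    rcases c j with x | x
    · simp [T]
    · simp [Matrix.one_apply]
  · intro j _
    have : (Matrix.fromCols (T a (d+1)) 1).submatrix id (cT c) 0 j.succ = 0 := by
      simp only [Matrix.submatrix_apply, id, cT, Fin.cons_succ]
      rcases c j with x | x
      · simp [T]
      · simp [Matrix.one_apply, (Fin.succ_ne_zero x).symm]
    rw [this]; ring

theorem M_cF (a : ℕ → A) (h0 : a 0 = 0) (d : ℕ) (c : Fin d → Fin d ⊕ Fin d) :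
    M a (d + 1) (cF c) = M (fun n => a (n + 1)) d c := by
  rw [M, Matrix.det_succ_row_zero, Fin.sum_univ_succ, Finset.sum_eq_zero, add_zero]
  · simp only [Fin.val_zero, pow_zero, one_mul]
    have : (Matrix.fromCols (T a (d+1)) 1).submatrix id (cF c) 0 0 = 1 := by simp [cF]
    rw [this, one_mul]
    rw [M]; congr 1
    ext i j
    simp only [Matrix.submatrix_apply, id, cF, Fin.zero_succAbove, Fin.cons_succ]
    rcases c j with x | x
    · simp only [Sum.map_inl, Matrix.fromCols_apply_inl, T, Matrix.of_apply, Fin.val_succ,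
        Fin.val_castSucc]
      split_ifs with h1 h2 h2
      · congr 1; omega
      · have : (i : ℕ) + 1 - x = 0 := by omega
        rw [this, h0]
      · omega
      · rfl
    · simp [Matrix.one_apply]
  · intro j _
    have : (Matrix.fromCols (T a (d+1)) 1).submatrix id (cF c) 0 j.succ = 0 := by
      simp only [Matrix.submatrix_apply, id, cF, Fin.cons_succ]
      rcases c j with x | x
      · simp [T, h0]
      · simp [Matrix.one_apply, (Fin.succ_ne_zero x).symm]
    rw [this]; ring

end toep

def cw : (d : ℕ) → (Fin d → Bool) → Fin d → Fin d ⊕ Fin d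
  | 0, _ => fun i => i.elim0
  | d + 1, w => if w 0 then cT (cw d (Fin.tail w)) else cF (cw d (Fin.tail w))

noncomputable def Pw (d : ℕ) (w : Fin d → Bool) : R := M MvPolynomial.X d (cw d w)
noncomputable def Qw (d : ℕ) (w : Fin d → Bool) : R := M MvPolynomial.X d (Sum.swap ∘ cw d w)

theorem ev_M (f : PowerSeries ℂ) (d : ℕ) (c) :
    ev f (M MvPolynomial.X d c) = M (fun n => coeff n f) d c :=
  M_map (ev f : R →+* ℂ) _ _ d (fun n _ => ev_X f n) c

theorem Pw_mem (d w) : (Pw d w, Qw d w) ∈ Sec d := by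
  intro f h e
  simp only [Pw, Qw, ev_M]
  exact M_sec f h e d _

theorem Pw_true (d : ℕ) (w : Fin d → Bool) :
    Pw (d + 1) (Fin.cons true w) = MvPolynomial.X 0 * Pw d w := by
  simp [Pw, cw, M_cT]

/-- restriction to `u 0 = 0` -/
noncomputable def res : R →ₐ[ℂ] R :=
  MvPolynomial.aeval fun n => Nat.casesOn n 0 (fun m => MvPolynomial.X m)

theorem ev_res (f : PowerSeries ℂ) (P : R) : ev f (res P) = ev (X * f) P := by
  have : (ev f).comp res = ev (X * f) := by
    apply MvPolynomial.algHom_ext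
    intro n
    rcases n with _ | n
    · simp [res, ev]
    · simp [res, ev, coeff_succ_X_mul]
  exact DFunLike.congr_fun this P

theorem res_true (P : R) : res (MvPolynomial.X 0 * P) = 0 := by
  simp [res]

theorem Pw_false (d : ℕ) (w : Fin d → Bool) :
    res (Pw (d + 1) (Fin.cons false w)) = Pw d w := by
  have := M_map (res : R →+* R) MvPolynomial.X
    (fun n => Nat.casesOn n 0 (fun m => MvPolynomial.X m)) (d + 1)
      (fun n _ => by simp [res]) (cF (cw d w))
  simp only [Pw, cw, Fin.cons_zero, Fin.tail_cons]
  simp only [Bool.false_eq_true, if_false]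
  erw [this]
  rw [M_cF _ rfl]

theorem dvd_of_res (P : R) (h : res P = 0) : ∃ P', P = MvPolynomial.X 0 * P' := by
  let q := Ideal.Quotient.mkₐ ℂ (Ideal.span {(MvPolynomial.X 0 : R)})
  let sh : R →ₐ[ℂ] R := MvPolynomial.aeval fun n => MvPolynomial.X (n + 1)
  have h1 : q = (q.comp sh).comp res := by
    apply MvPolynomial.algHom_ext
    intro n
    rcases n with _ | n
    · simp only [AlgHom.comp_apply, res, MvPolynomial.aeval_X, map_zero]
      simp only [q, Ideal.Quotient.mkₐ_eq_mk]
      exact Ideal.Quotient.eq_zero_iff_mem.2 (Ideal.mem_span_singleton_self _)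
    · simp [res, sh]
  have h2 : q P = 0 := by
    rw [h1]; simp [h]
  have h3 := Ideal.Quotient.eq_zero_iff_mem.1 h2
  exact Ideal.mem_span_singleton.1 h3

theorem sum_cons {V : Type*} [AddCommMonoid V] (d : ℕ) (F : (Fin (d + 1) → Bool) → V) :
    ∑ w, F w = ∑ w : Fin d → Bool, F (Fin.cons true w) + ∑ w : Fin d → Bool, F (Fin.cons false w) := by
  rw [← (Fin.consEquiv (fun _ : Fin (d + 1) => Bool)).sum_comp, Fintype.sum_prod_type]
  simp [Fin.consEquiv]

theorem Pw_indep (d : ℕ) : LinearIndependent ℂ (Pw d) := by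
  induction d with
  | zero =>
    rw [Fintype.linearIndependent_iff]
    intro c hc w
    have : Pw 0 default = 1 := by simp [Pw, M]
    have hw : ∀ w, Pw 0 w = 1 := fun w => by rw [Subsingleton.elim w default, this]
    rw [Fintype.sum_unique, hw] at hc
    rw [Subsingleton.elim w _]
    exact (smul_eq_zero.1 hc).resolve_right one_ne_zero
  | succ d ih =>
    rw [Fintype.linearIndependent_iff] at ih ⊢
    intro c hc
    rw [sum_cons] at hc
    have h1 := congrArg res hc
    simp only [Pw_true, map_add, map_sum, map_smul, res_true, smul_zero, Finset.sum_const_zero,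
      Pw_false, zero_add, map_zero] at h1
    have h2 := ih _ h1
    simp only [h2, zero_smul, Finset.sum_const_zero, add_zero, Pw_true] at hc
    simp only [← mul_smul_comm, ← Finset.mul_sum] at hc
    have h3 := ih _ ((mul_eq_zero.1 hc).resolve_left (MvPolynomial.X_ne_zero 0))
    intro w
    rw [← Fin.cons_self_tail w]
    rcases w 0
    · exact h2 _
    · exact h3 _

/-! upper bound -/

theorem poly_aux (p κ : Polynomial ℂ) (D : ℕ)
    (h : ∀ ε : ℂ, ε ≠ 0 → p.eval ε = ε ^ D * κ.eval ε⁻¹) :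
    κ.natDegree ≤ D ∧ p.coeff 0 = κ.coeff D := by
  have h1 : Polynomial.X ^ κ.natDegree * p = Polynomial.X ^ D * κ.reverse := by
    have : Polynomial.X * (Polynomial.X ^ κ.natDegree * p) =
        Polynomial.X * (Polynomial.X ^ D * κ.reverse) := by
      apply Polynomial.funext
      intro ε
      by_cases hε : ε = 0
      · simp [hε]
      · let _ : Invertible ε⁻¹ := invertibleOfNonzero (inv_ne_zero hε)
        have := Polynomial.eval₂_reverse_mul_pow (RingHom.id ℂ) ε⁻¹ κ
        simp only [invOf_eq_inv, inv_inv, Polynomial.eval₂_id, inv_pow] at this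
        simp only [Polynomial.eval_mul, Polynomial.eval_X, Polynomial.eval_pow]
        rw [h ε hε, ← this]
        field_simp
    exact mul_left_cancel₀ Polynomial.X_ne_zero this
  have h2 : κ.natDegree ≤ D := by
    by_contra hlt
    push Not at hlt
    have h3 := congrArg (fun q => q.coeff D) h1
    simp only [Polynomial.coeff_X_pow_mul', hlt.not_ge, if_false, le_refl, if_true, Nat.sub_self,
      Polynomial.coeff_zero_reverse] at h3
    have := Polynomial.leadingCoeff_eq_zero.1 h3.symm
    simp [this] at hlt
  refine ⟨h2, ?_⟩
  have h3 := congrArg (fun q => q.coeff κ.natDegree) h1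
  simp only [Polynomial.coeff_X_pow_mul', le_refl, if_true, Nat.sub_self] at h3
  rw [h3]
  split_ifs with h4
  · have : D = κ.natDegree := le_antisymm h4 h2
    rw [this]; simp
  · rw [Polynomial.coeff_eq_zero_of_natDegree_lt (by omega)]

theorem sec_zero (P Q : R) (h : (P, Q) ∈ Sec 0) : ∃ c, P = MvPolynomial.C c := by
  refine ⟨ev 0 P, ?_⟩
  rw [← sub_eq_zero]
  apply dense
  intro f hf
  let p : Polynomial ℂ := MvPolynomial.aeval (fun n => Polynomial.C (coeff n f) * Polynomial.X) P
  let κ : Polynomial ℂ := MvPolynomial.aeval (fun n => Polynomial.C (coeff n f⁻¹) * Polynomial.X) Q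
  have hp : ∀ (g : PowerSeries ℂ) (P : R) ε, Polynomial.eval ε
      (MvPolynomial.aeval (fun n => Polynomial.C (coeff n g) * Polynomial.X) P) = ev (C ε * g) P := by
    intro g P ε
    have : (Polynomial.aeval ε).comp (MvPolynomial.aeval (fun n => Polynomial.C (coeff n g) * Polynomial.X)) = ev (C ε * g) := by
      apply MvPolynomial.algHom_ext
      intro n
      simp [ev]
      ring
    rw [← this]; simp [Polynomial.aeval_def, Polynomial.eval₂_eq_eval_map]
  have := (poly_aux κ p 0 (by
    intro ε hε
    rw [hp, hp, pow_zero, one_mul]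
    have := h (C ε⁻¹ * f) (C ε * f⁻¹) (by
      rw [mul_mul_mul_comm, exists_inv f hf, ← map_mul, inv_mul_cancel₀ hε]; simp)
    simpa using this.symm)).1
  have h1 : p.eval 1 = p.eval 0 := by
    rw [Polynomial.eq_C_of_natDegree_le_zero this]; simp
  rw [hp, hp] at h1
  simp only [map_one, one_mul, map_zero, zero_mul] at h1
  rw [map_sub, h1]
  simp [ev]

noncomputable def θ : R →ₐ[ℂ] Polynomial R :=
  MvPolynomial.aeval fun n => ∑ p ∈ Finset.HasAntidiagonal.antidiagonal n,
    Polynomial.C (MvPolynomial.X p.1) * (Polynomial.C (MvPolynomial.C ((-1) ^ p.2)) * Polynomial.X ^ (p.2 + 1))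

noncomputable def sε (τ : ℂ) : PowerSeries ℂ := PowerSeries.mk fun n => (-1) ^ n * τ ^ (n + 1)

theorem sε_mul (ε : ℂ) (h : ε ≠ 0) : (X + C ε) * sε ε⁻¹ = 1 := by
  ext n
  rw [add_mul, map_add, coeff_C_mul]
  rcases n with _ | n
  · simp [sε, h]
  · simp only [sε, coeff_succ_X_mul, coeff_mk, coeff_one]
    simp
    field_simp
    ring

noncomputable def κ (g : PowerSeries ℂ) (Q : R) : Polynomial ℂ := (θ Q).map (ev g : R →+* ℂ)

theorem κ_eval (g : PowerSeries ℂ) (Q : R) (τ : ℂ) : (κ g Q).eval τ = ev (g * sε τ) Q := by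
  have : ((Polynomial.evalRingHom τ).comp (Polynomial.mapRingHom (ev g : R →+* ℂ))).comp (θ : R →+* Polynomial R)
      = (ev (g * sε τ) : R →+* ℂ) := by
    apply MvPolynomial.ringHom_ext
    · intro r
      simp [θ, ev, Polynomial.algebraMap_apply]
    · intro n
      simp [θ, ev, coeff_mul, sε]
      rw [Polynomial.map_sum, Polynomial.eval_finsetSum]
      simp
  exact DFunLike.congr_fun this Q

theorem κ_coeff (g : PowerSeries ℂ) (Q : R) (j : ℕ) : (κ g Q).coeff j = ev g ((θ Q).coeff j) := by
  simp [κ]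

theorem key (d : ℕ) (P Q : R) (h : (P, Q) ∈ Sec d) (g : PowerSeries ℂ) (hg : coeff 0 g ≠ 0) :
    (κ g Q).natDegree ≤ d ∧ (coeff 0 g) ^ d * ev (X * g⁻¹) P = ev g ((θ Q).coeff d) := by
  let p : Polynomial ℂ := MvPolynomial.aeval
    (fun n => Polynomial.C (coeff n (X * g⁻¹)) + Polynomial.X * Polynomial.C (coeff n g⁻¹)) P
  have hp : ∀ ε, p.eval ε = ev ((X + C ε) * g⁻¹) P := by
    intro ε
    have : (Polynomial.aeval ε).comp (MvPolynomial.aeval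
      (fun n => Polynomial.C (coeff n (X * g⁻¹)) + Polynomial.X * Polynomial.C (coeff n g⁻¹)))
        = ev ((X + C ε) * g⁻¹) := by
      apply MvPolynomial.algHom_ext
      intro n
      simp [ev, add_mul]
      ring
    rw [← this]; simp [p, Polynomial.aeval_def, Polynomial.eval₂_eq_eval_map]
  have hgi := exists_inv g hg
  have h0 := coeff0_ne hgi
  have := poly_aux (Polynomial.C (coeff 0 g ^ d) * p) (κ g Q) d (by
    intro ε hε
    rw [κ_eval, Polynomial.eval_mul, hp, Polynomial.eval_C]
    have h1 := h ((X + C ε) * g⁻¹) (g * sε ε⁻¹) (by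
      rw [mul_comm g, mul_mul_mul_comm, sε_mul ε hε, mul_comm g⁻¹, hgi, one_mul])
    simp only at h1
    rw [h1]
    have h2 : coeff 0 ((X + C ε) * g⁻¹) = ε * coeff 0 g⁻¹ := by
      simp
    rw [h2, ← mul_assoc, ← mul_pow, mul_left_comm, h0, mul_one])
  refine ⟨this.1, ?_⟩
  rw [← κ_coeff, ← this.2, Polynomial.coeff_C_mul, Polynomial.coeff_zero_eq_eval_zero, hp]
  simp

theorem ev_cont (w : PowerSeries ℂ) (P : R) : Continuous fun δ : ℂ => ev ((X + C δ) * w) P := by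
  have : ∀ δ, ev ((X + C δ) * w) P =
      MvPolynomial.eval (fun n => coeff n (X * w) + δ * coeff n w) P := by
    intro δ
    simp only [ev, add_mul, map_add, coeff_C_mul]
    rfl
  simp only [this]
  exact (MvPolynomial.continuous_eval P).comp (continuous_pi fun n => by fun_prop)

theorem key2 (d : ℕ) (P Q : R) (h : (P, Q) ∈ Sec (d + 1)) :
    res ((θ Q).coeff (d + 1)) = 0 := by
  apply dense
  intro w hw
  rw [ev_res]
  have h1 : (fun δ : ℂ => ∑ j ∈ Finset.range (d + 2),
      δ ^ (d + 1 - j) * ev ((X + C δ) * w) ((θ Q).coeff j)) = fun δ => δ ^ (d + 1) * ev w Q := by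
    apply Continuous.ext_on (dense_compl_singleton (0 : ℂ))
    · exact continuous_finsetSum _ fun j _ => (continuous_pow _).mul (ev_cont _ _)
    · fun_prop
    · intro δ hδ
      have hδ : δ ≠ 0 := hδ
      have h2 := (key _ P Q h ((X + C δ) * w) (by
        simp only [coeff_zero_eq_constantCoeff] at hw
        simpa using And.intro hδ hw)).1
      have h3 := κ_eval ((X + C δ) * w) Q δ⁻¹
      rw [mul_right_comm, sε_mul δ hδ, one_mul,
        Polynomial.eval_eq_sum_range' (Nat.lt_succ_of_le h2)] at h3
      simp only [← h3, Finset.mul_sum, κ_coeff]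
      apply Finset.sum_congr rfl
      intro j hj
      have hj : j ≤ d + 1 := by simp at hj; omega
      rw [pow_sub₀ δ hδ hj, inv_pow]; ring
  have h4 := congrFun h1 0
  simp only [Finset.sum_range_succ _ (d + 1), Nat.sub_self, pow_zero, one_mul] at h4
  rw [Finset.sum_eq_zero] at h4
  · simpa using h4
  · intro j hj
    rw [zero_pow (by simp at hj; omega), zero_mul]

theorem res_sec (d : ℕ) (P Q : R) (h : (P, Q) ∈ Sec (d + 1)) : ∃ Q', (res P, Q') ∈ Sec d := by
  obtain ⟨V, hV⟩ := dvd_of_res _ (key2 d P Q h)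
  refine ⟨V, ?_⟩
  intro f g e
  have h0 := coeff0_ne e
  have hg : coeff 0 g ≠ 0 := right_ne_zero_of_mul_eq_one h0
  have h1 := (key _ P Q h g hg).2
  have h2 : g⁻¹ = f := by
    have := exists_inv g hg
    calc g⁻¹ = (f * g) * g⁻¹ := by rw [e, one_mul]
      _ = f := by rw [mul_assoc, this, mul_one]
  rw [h2, hV, map_mul, ev_X, pow_succ, mul_assoc, mul_left_comm] at h1
  have h3 := mul_left_cancel₀ hg h1
  simp only [ev_res]
  rw [← h3, ← mul_assoc, ← mul_pow, h0, one_pow, one_mul]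

theorem span_fst (d : ℕ) : ∀ P Q : R, (P, Q) ∈ Sec d → P ∈ Submodule.span ℂ (Set.range (Pw d)) := by
  induction d with
  | zero =>
    intro P Q h
    obtain ⟨c, rfl⟩ := sec_zero P Q h
    have : Pw 0 default = 1 := by simp [Pw, M]
    have h2 : (MvPolynomial.C c : R) = c • Pw 0 default := by
      rw [this, MvPolynomial.smul_eq_C_mul, mul_one]
    rw [h2]
    exact Submodule.smul_mem _ _ (Submodule.subset_span ⟨_, rfl⟩)
  | succ d ih =>
    intro P Q h
    obtain ⟨Q', hQ'⟩ := res_sec d P Q h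
    obtain ⟨c, hc⟩ := (Submodule.mem_span_range_iff_exists_fun ℂ).1 (ih _ _ hQ')
    have h1 : (P, Q) - ∑ w, c w • (Pw (d + 1) (Fin.cons false w), Qw (d + 1) (Fin.cons false w))
        ∈ Sec (d + 1) :=
      Submodule.sub_mem _ h (Submodule.sum_mem _ fun w _ => Submodule.smul_mem _ _ (Pw_mem _ _))
    generalize hs : (P, Q) - ∑ w, c w • (Pw (d + 1) (Fin.cons false w), Qw (d + 1) (Fin.cons false w)) = s at h1
    have h2 : P - ∑ w, c w • Pw (d + 1) (Fin.cons false w) = s.1 := by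
      rw [← hs]; simp [Prod.fst_sum]
    have h3 : res s.1 = 0 := by
      rw [← h2]; simp [Pw_false, hc]
    obtain ⟨P', hP'⟩ := dvd_of_res _ h3
    have h4 : (P', s.2) ∈ Sec d := by
      intro f g e
      have := h1 f g e
      rw [hP', map_mul, ev_X, pow_succ', mul_assoc] at this
      exact mul_left_cancel₀ (left_ne_zero_of_mul_eq_one (coeff0_ne e)) this
    obtain ⟨c', hc'⟩ := (Submodule.mem_span_range_iff_exists_fun ℂ).1 (ih _ _ h4)
    have h5 : P = ∑ w, c' w • Pw (d + 1) (Fin.cons true w) + ∑ w, c w • Pw (d + 1) (Fin.cons false w) := by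
      rw [← sub_eq_iff_eq_add, h2, hP', ← hc', Finset.mul_sum]
      simp [Pw_true]
    rw [h5]
    exact Submodule.add_mem _
      (Submodule.sum_mem _ fun w _ => Submodule.smul_mem _ _ (Submodule.subset_span ⟨_, rfl⟩))
      (Submodule.sum_mem _ fun w _ => Submodule.smul_mem _ _ (Submodule.subset_span ⟨_, rfl⟩))

theorem span_pair (d : ℕ) (s : R × R) (h : s ∈ Sec d) :
    ∃ c : (Fin d → Bool) → ℂ, s = ∑ w, c w • (Pw d w, Qw d w) := by
  obtain ⟨c, hc⟩ := (Submodule.mem_span_range_iff_exists_fun ℂ).1 (span_fst d s.1 s.2 h)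
  refine ⟨c, ?_⟩
  have h1 : s - ∑ w, c w • (Pw d w, Qw d w) ∈ Sec d :=
      Submodule.sub_mem _ h (Submodule.sum_mem _ fun w _ => Submodule.smul_mem _ _ (Pw_mem _ _))
  rw [← sub_eq_zero]
  generalize hs : s - ∑ w, c w • (Pw d w, Qw d w) = t at h1
  have h2 : t.1 = 0 := by
    rw [← hs]; simp [Prod.fst_sum, hc]
  have h3 : t.2 = 0 := by
    apply dense
    intro g hg
    have e := exists_inv g hg
    rw [mul_comm] at e
    have := h1 _ _ e
    rw [h2, map_zero] at this
    exact (mul_eq_zero.1 this.symm).resolve_left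
      (pow_ne_zero _ (left_ne_zero_of_mul_eq_one (coeff0_ne e)))
  exact Prod.ext h2 h3

/-! Taylor series -/

noncomputable def tay (f : ℂ → ℂ) : PowerSeries ℂ :=
  PowerSeries.mk fun n => iteratedDeriv n f 0 / (n.factorial : ℂ)

theorem tay_mul (f g : ℂ → ℂ) (hf : AnalyticAt ℂ f 0) (hg : AnalyticAt ℂ g 0) :
    tay f * tay g = tay (f * g) := by
  ext n
  rw [coeff_mul, tay, tay, tay, coeff_mk, iteratedDeriv_mul hf.contDiffAt hg.contDiffAt,
    Finset.Nat.sum_antidiagonal_eq_sum_range_succ_mk, Finset.sum_div]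
  apply Finset.sum_congr rfl
  intro i hi
  have hi : i ≤ n := by simp at hi; omega
  simp only [coeff_mk]
  rw [Nat.cast_choose ℂ hi]
  have := Nat.factorial_ne_zero
  have h1 : (n.factorial : ℂ) ≠ 0 := by exact_mod_cast this n
  have h2 : (i.factorial : ℂ) ≠ 0 := by exact_mod_cast this i
  have h3 : ((n - i).factorial : ℂ) ≠ 0 := by exact_mod_cast this (n - i)
  field_simp

theorem tay_inv (f : ℂ → ℂ) (hf : AnalyticAt ℂ f 0) (h0 : f 0 ≠ 0) :
    tay f * tay (fun z => (f z)⁻¹) = 1 := by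
  rw [tay_mul _ _ hf (hf.fun_inv h0)]
  have h1 : (f * fun z => (f z)⁻¹) =ᶠ[nhds 0] fun _ => (1 : ℂ) := by
    filter_upwards [hf.continuousAt.eventually_ne h0] with z hz
    simp [hz]
  ext n
  rw [tay, coeff_mk, h1.iteratedDeriv_eq, iteratedDeriv_const, coeff_one]
  split_ifs with h
  · simp [h]
  · simp

theorem tay_poly (p : Polynomial ℂ) : tay (fun z => p.eval z) = (p : PowerSeries ℂ) := by
  have h : ∀ n, iteratedDeriv n (fun z => p.eval z) =
      fun z => (Polynomial.derivative^[n] p).eval z := by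
    intro n
    induction n with
    | zero => simp
    | succ n ih =>
      rw [iteratedDeriv_succ, ih, Function.iterate_succ_apply']
      ext z
      exact Polynomial.deriv _
  ext n
  rw [tay, coeff_mk, h, Polynomial.coeff_coe]
  simp only [← Polynomial.coeff_zero_eq_eval_zero, Polynomial.coeff_iterate_derivative, zero_add,
    Nat.descFactorial_self, nsmul_eq_mul]
  have h1 : (n.factorial : ℂ) ≠ 0 := by exact_mod_cast Nat.factorial_ne_zero n
  field_simp

/-! finite jets -/

abbrev Rk (k : ℕ) := MvPolynomial (Fin (k + 1)) ℂ

noncomputable def inj (k : ℕ) : Rk k →ₐ[ℂ] R :=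
  MvPolynomial.aeval fun l => MvPolynomial.C ((l : ℕ).factorial : ℂ) * MvPolynomial.X (l : ℕ)

noncomputable def prj (k : ℕ) : R →ₐ[ℂ] Rk k :=
  MvPolynomial.aeval fun n => if h : n < k + 1 then
    MvPolynomial.C ((n.factorial : ℂ)⁻¹) * MvPolynomial.X ⟨n, h⟩ else 0

theorem fac_ne (n : ℕ) : (n.factorial : ℂ) ≠ 0 := by exact_mod_cast Nat.factorial_ne_zero n

theorem prj_inj (k : ℕ) (P : Rk k) : prj k (inj k P) = P := by
  have : (prj k).comp (inj k) = AlgHom.id ℂ _ := by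
    apply MvPolynomial.algHom_ext
    intro l
    simp only [AlgHom.comp_apply, inj, MvPolynomial.aeval_X, map_mul, AlgHom.id_apply]
    simp only [prj, MvPolynomial.aeval_X, l.2, dif_pos]
    rw [← mul_assoc, MvPolynomial.algHom_C, MvPolynomial.algebraMap_eq, ← map_mul,
      mul_inv_cancel₀ (fac_ne _), map_one, one_mul]
  exact DFunLike.congr_fun this P

theorem inj_prj_M (d k : ℕ) (hk : d ≤ k + 1) (c) :
    inj k (prj k (M MvPolynomial.X d c)) = M MvPolynomial.X d c := by
  refine M_map ((inj k).comp (prj k) : R →+* R) _ _ d (fun n hn => ?_) c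
  have hn : n < k + 1 := by omega
  simp only [RingHom.coe_coe, AlgHom.comp_apply, prj, MvPolynomial.aeval_X, hn, dif_pos, map_mul]
  simp only [inj, MvPolynomial.aeval_X]
  rw [← mul_assoc, MvPolynomial.algHom_C, MvPolynomial.algebraMap_eq, ← map_mul,
      inv_mul_cancel₀ (fac_ne _), map_one, one_mul]

theorem ev_inj (k : ℕ) (f : ℂ → ℂ) (F : PowerSeries ℂ) (h : ∀ l < k + 1, coeff l F = coeff l (tay f))
    (P : Rk k) : ev F (inj k P) =
      (MvPolynomial.aeval fun l : Fin (k + 1) => iteratedDeriv (l : ℕ) f 0) P := by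
  have : (ev F).comp (inj k) = MvPolynomial.aeval fun l : Fin (k + 1) => iteratedDeriv (l : ℕ) f 0 := by
    apply MvPolynomial.algHom_ext
    intro l
    simp only [AlgHom.comp_apply, inj, MvPolynomial.aeval_X, map_mul, ev_X, h l l.2]
    rw [MvPolynomial.algHom_C, tay, coeff_mk]
    have := fac_ne l
    simp
    field_simp
  exact DFunLike.congr_fun this P

theorem inv_congr (N : ℕ) (f f' h h' : PowerSeries ℂ) (e : f * h = 1) (e' : f' * h' = 1)
    (hf : ∀ l < N, coeff l f = coeff l f') : ∀ l < N, coeff l h = coeff l h' := by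
  have h1 : (X : PowerSeries ℂ) ^ N ∣ f - f' := by
    rw [X_pow_dvd_iff]; intro m hm; simp [hf m hm]
  have h2 : h - h' = (f - f') * (-(h * h')) := by
    linear_combination h' * e - h * e'
  have h3 : (X : PowerSeries ℂ) ^ N ∣ h - h' := h2 ▸ h1.mul_right _
  rw [X_pow_dvd_iff] at h3
  intro l hl
  have := h3 l hl
  rwa [map_sub, sub_eq_zero] at this

theorem coeff0_tay (f : ℂ → ℂ) : coeff 0 (tay f) = f 0 := by
  simp [tay]

end Jet

open Jet in
/-- for d ≥ 1 and k ≥ d - 1, the space of global (polynomial)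
sections of ⊕_n E^{GG}_{k,n} ⊗ O(d) on ℙ¹(ℂ) has dimension 2^d. A section is a
pair (P, Q) of polynomials in the jet variables x^{(0)}, ..., x^{(k)} (resp.
y^{(0)}, ..., y^{(k)}) on the two affine charts, satisfying the transition rule:
for every germ f of a holomorphic curve with f 0 ≠ 0 (so x = f, y = 1/f),
P(j^k f(0)) = f(0)^d · Q(j^k (1/f)(0)). The dimension statement is expressed by a
linearly independent family of 2^d sections spanning the space of sections. -/
theorem stmt_15 (d k : ℕ) (hd : 1 ≤ d) (hk : d - 1 ≤ k) :
    let S : Set (MvPolynomial (Fin (k + 1)) ℂ × MvPolynomial (Fin (k + 1)) ℂ) :=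
      {s | ∀ f : ℂ → ℂ, AnalyticAt ℂ f 0 → f 0 ≠ 0 →
        (MvPolynomial.aeval fun l : Fin (k + 1) => iteratedDeriv (l : ℕ) f 0) s.1
          = (f 0) ^ d *
            (MvPolynomial.aeval fun l : Fin (k + 1) =>
              iteratedDeriv (l : ℕ) (fun z => (f z)⁻¹) 0) s.2}
    ∃ g : Fin (2 ^ d) →
        MvPolynomial (Fin (k + 1)) ℂ × MvPolynomial (Fin (k + 1)) ℂ,
      (∀ i, g i ∈ S) ∧ LinearIndependent ℂ g ∧
      ∀ s ∈ S, s ∈ Submodule.span ℂ (Set.range g) := by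
  intro S
  have hk' : d ≤ k + 1 := by omega
  let G : (Fin d → Bool) → Rk k × Rk k := fun w => (prj k (Pw d w), prj k (Qw d w))
  have hG : ∀ w, G w ∈ S := by
    intro w f hf h0
    have e := tay_inv f hf h0
    have h1 := Pw_mem d w _ _ e
    simp only [G]
    rw [← ev_inj k f _ (fun l _ => rfl), ← ev_inj k (fun z => (f z)⁻¹) _ (fun l _ => rfl), Pw, Qw,
      inj_prj_M d k hk', inj_prj_M d k hk', ← coeff0_tay f]
    exact h1
  have hI : LinearIndependent ℂ G := by
    apply LinearIndependent.of_comp ((inj k).toLinearMap ∘ₗ LinearMap.fst ℂ (Rk k) (Rk k))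
    have h1 : ((inj k).toLinearMap ∘ₗ LinearMap.fst ℂ (Rk k) (Rk k)) ∘ G = Pw d := by
      funext w
      exact inj_prj_M d k hk' _
    rw [h1]
    exact Pw_indep d
  have hS : ∀ s ∈ S, s ∈ Submodule.span ℂ (Set.range G) := by
    intro s hs
    have h1 : (inj k s.1, inj k s.2) ∈ Sec d := by
      intro F H e
      have hF := left_ne_zero_of_mul_eq_one (coeff0_ne e)
      let p := PowerSeries.trunc (k + 1) F
      have hp : ∀ l < k + 1, PowerSeries.coeff l F = PowerSeries.coeff l (tay (fun z => p.eval z)) := by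
        intro l hl
        rw [tay_poly, Polynomial.coeff_coe, PowerSeries.coeff_trunc, if_pos hl]
      have ha : AnalyticAt ℂ (fun z => p.eval z) 0 := by
        exact (p.differentiable).analyticAt 0
      have hp0 : p.eval 0 = PowerSeries.coeff 0 F := by
        rw [hp 0 (by omega), coeff0_tay]
      have h0 : p.eval 0 ≠ 0 := by rw [hp0]; exact hF
      have e' := tay_inv _ ha h0
      simp only
      rw [ev_inj k _ F hp, ev_inj k _ H (inv_congr (k + 1) _ _ _ _ e e' hp), ← hp0]
      exact hs _ ha h0
    obtain ⟨c, hc⟩ := span_pair d _ h1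
    have h2 : s = ∑ w, c w • G w := by
      have h3 := congrArg (fun t => (prj k t.1, prj k t.2)) hc
      simp only [prj_inj] at h3
      have h4 : s = (s.1, s.2) := rfl
      rw [h4, h3]
      simp [Prod.ext_iff, Prod.fst_sum, Prod.snd_sum, G]
    rw [h2]
    exact Submodule.sum_mem _ fun w _ => Submodule.smul_mem _ _ (Submodule.subset_span ⟨_, rfl⟩)
  let e : Fin (2 ^ d) ≃ (Fin d → Bool) := (Fintype.equivFinOfCardEq (by simp)).symm
  refine ⟨G ∘ e, fun i => hG _, hI.comp _ e.injective, ?_⟩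
  rw [e.surjective.range_comp]
  exact hS
end

section
/- For every d ≥ 1, N ≥ 1 and every k ≥ d - 1, the dimension of H⁰(ℙ^N(ℂ), ⊕_{n≥1} E^{GG}_{k,n} ⊗ O(d)) equals (N+1)^d. -/
namespace GG
theorem adjoin_step (d : ℕ) (A B S : Type) [CommRing A] [CommRing B] [CommRing S] [Algebra A S]
    [Algebra A B] [Algebra B S] [IsScalarTower A B S] (x : Fin (d + 1) → S) (r : B)
    (hr : algebraMap B S r = x 0) (ht : Algebra.adjoin A (Set.range x) = ⊤) :
    Algebra.adjoin B (Set.range fun i : Fin d => x i.succ) = ⊤ := by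
  rw [eq_top_iff]
  intro s _
  have hs : s ∈ Algebra.adjoin A (Set.range x) := by rw [ht]; trivial
  have : Algebra.adjoin A (Set.range x) ≤
      (Algebra.adjoin B (Set.range fun i : Fin d => x i.succ)).restrictScalars A := by
    rw [Algebra.adjoin_le_iff]
    rintro _ ⟨i, rfl⟩
    rw [SetLike.mem_coe, Subalgebra.mem_restrictScalars]
    refine Fin.cases ?_ (fun j => ?_) i
    · rw [← hr]
      exact Subalgebra.algebraMap_mem _ r
    · exact Algebra.subset_adjoin ⟨j, rfl⟩
  exact this hs

open Polynomial in
theorem span_tower : ∀ (d : ℕ) (A S : Type) [CommRing A] [CommRing S] [Algebra A S]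
    (x : Fin d → S) (f : A[X]), f.Monic → f.natDegree = d →
    f.map (algebraMap A S) = ∏ i, (X - C (x i)) →
    Algebra.adjoin A (Set.range x) = ⊤ →
    ∃ g : Fin d.factorial → S, Submodule.span A (Set.range g) = ⊤ := by
  intro d
  induction d with
  | zero =>
    intro A S _ _ _ x f hf hd hx ht
    refine ⟨fun _ => 1, ?_⟩
    have : Set.range x = ∅ := Set.range_eq_empty x
    rw [this, Algebra.adjoin_empty] at ht
    have h2 : Set.range (fun _ : Fin (Nat.factorial 0) => (1 : S)) = {1} := by
      have : Nonempty (Fin (Nat.factorial 0)) := ⟨⟨0, Nat.factorial_pos 0⟩⟩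
      exact Set.range_const
    rw [h2, ← Submodule.one_eq_span, ← Algebra.toSubmodule_bot, ht, Algebra.top_toSubmodule]
  | succ d ih =>
    intro A S _ _ _ x f hf hd hx ht
    rcases subsingleton_or_nontrivial S with hS | hS
    · refine ⟨fun _ => 0, ?_⟩
      exact Subsingleton.elim (α := Submodule A S) _ _
    have hroot : eval₂ (algebraMap A S) (x 0) f = 0 := by
      rw [← eval_map, hx, eval_prod]
      exact Finset.prod_eq_zero (Finset.mem_univ 0) (by simp)
    let φ : AdjoinRoot f →ₐ[A] S := AdjoinRoot.liftAlgHom f (Algebra.ofId A S) (x 0) hroot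
    let _ : Algebra (AdjoinRoot f) S := φ.toRingHom.toAlgebra
    have hφ : ∀ a, algebraMap (AdjoinRoot f) S a = φ a := fun _ => rfl
    have : IsScalarTower A (AdjoinRoot f) S := by
      refine IsScalarTower.of_algebraMap_eq fun a => ?_
      rw [hφ, AlgHom.commutes]
    have hφr : φ (AdjoinRoot.root f) = x 0 := AdjoinRoot.liftAlgHom_root _ _ _ _
    have : Nontrivial (AdjoinRoot f) := φ.toRingHom.domain_nontrivial
    have : Nontrivial A := (algebraMap A S).domain_nontrivial
    set F := f.map (algebraMap A (AdjoinRoot f)) with hF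
    have hFr : IsRoot F (AdjoinRoot.root f) := by
      rw [hF, IsRoot, eval_map]
      exact AdjoinRoot.eval₂_root f
    have hFm : F.Monic := hf.map _
    set q := F /ₘ (X - C (AdjoinRoot.root f)) with hq
    have hmul : (X - C (AdjoinRoot.root f)) * q = F := mul_divByMonic_eq_iff_isRoot.2 hFr
    have hqm : q.Monic := by
      have := hFm
      rw [← hmul] at this
      exact (monic_X_sub_C _).of_mul_monic_left this
    have hqd : q.natDegree = d := by
      rw [hq, natDegree_divByMonic _ (monic_X_sub_C _), natDegree_X_sub_C, hF, hf.natDegree_map, hd]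
      simp
    have hqx : q.map (algebraMap (AdjoinRoot f) S) = ∏ i : Fin d, (X - C (x i.succ)) := by
      have h1 : F.map (algebraMap (AdjoinRoot f) S) = ∏ i, (X - C (x i)) := by
        rw [hF, Polynomial.map_map, ← IsScalarTower.algebraMap_eq, hx]
      rw [← hmul, Fin.prod_univ_succ, Polynomial.map_mul] at h1
      have h2 : (X - C (AdjoinRoot.root f)).map (algebraMap (AdjoinRoot f) S) = X - C (x 0) := by
        simp [hφ, hφr]
      rw [h2] at h1
      exact (monic_X_sub_C (x 0)).isRegular.left h1
    have htop : Algebra.adjoin (AdjoinRoot f) (Set.range fun i : Fin d => x i.succ) = ⊤ :=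
      adjoin_step d A (AdjoinRoot f) S x (AdjoinRoot.root f) hφr ht
    obtain ⟨g, hg⟩ := ih (AdjoinRoot f) S (fun i => x i.succ) q hqm hqd hqx htop
    let pb := AdjoinRoot.powerBasis' hf
    have hpb := pb.basis.span_eq
    have hdim : pb.dim = d + 1 := by rw [← hd]; rfl
    have h3 := Submodule.span_smul_of_span_eq_top hpb (Set.range g)
    rw [hg] at h3
    have e : Fin (d + 1).factorial ≃ Fin pb.dim × Fin d.factorial :=
      (finCongr (by rw [hdim, Nat.factorial_succ])).trans finProdFinEquiv.symm
    refine ⟨fun i => pb.basis (e i).1 • g (e i).2, ?_⟩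
    rw [eq_top_iff, show (⊤ : Submodule A S) = Submodule.restrictScalars A (⊤ : Submodule (AdjoinRoot f) S) from rfl, ← h3]
    apply Submodule.span_mono
    rintro _ ⟨_, ⟨i, rfl⟩, _, ⟨j, rfl⟩, rfl⟩
    exact ⟨e.symm (i, j), by simp⟩

open MvPolynomial

/-- the ideal of positive-degree power sums -/
noncomputable def I (d : ℕ) : Ideal (MvPolynomial (Fin d) ℂ) :=
  Ideal.span {q | ∃ j, 1 ≤ j ∧ q = psum (Fin d) ℂ j}

theorem psum_mem (d j : ℕ) (hj : 1 ≤ j) : psum (Fin d) ℂ j ∈ I d :=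
  Ideal.subset_span ⟨j, hj, rfl⟩

theorem esymm_mem (d j : ℕ) (hj : 1 ≤ j) : esymm (Fin d) ℂ j ∈ I d := by
  have h := mul_esymm_eq_sum (Fin d) ℂ j
  have h2 : (j : MvPolynomial (Fin d) ℂ) * esymm (Fin d) ℂ j ∈ I d := by
    rw [h]
    refine Ideal.mul_mem_left _ _ (Ideal.sum_mem _ fun a ha => Ideal.mul_mem_left _ _ ?_)
    rw [Finset.mem_filter, Finset.HasAntidiagonal.mem_antidiagonal] at ha
    exact psum_mem d _ (by omega)
  have h3 : esymm (Fin d) ℂ j = C ((j : ℂ)⁻¹) * ((j : MvPolynomial (Fin d) ℂ) * esymm (Fin d) ℂ j) := by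
    rw [← mul_assoc, ← map_natCast (C : ℂ →+* MvPolynomial (Fin d) ℂ), ← C_mul,
      inv_mul_cancel₀ (by exact_mod_cast (by omega : j ≠ 0)), C_1, one_mul]
  rw [h3]
  exact Ideal.mul_mem_left _ _ h2

theorem prod_quot (d : ℕ) :
    ∏ i : Fin d, (Polynomial.X + Polynomial.C (Ideal.Quotient.mk (I d) (X i))) = Polynomial.X ^ d := by
  have h := MvPolynomial.prod_C_add_X_eq_sum_esymm ℂ (Fin d)
  have h2 := congrArg (Polynomial.map (Ideal.Quotient.mk (I d))) h
  rw [Polynomial.map_prod] at h2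
  simp only [Polynomial.map_add, Polynomial.map_X, Polynomial.map_C, Polynomial.map_sum,
    Polynomial.map_mul, Polynomial.map_pow] at h2
  rw [h2, Finset.sum_eq_single 0]
  · simp
  · intro j _ hj
    rw [Ideal.Quotient.eq_zero_iff_mem.2 (esymm_mem d j (by omega))]
    simp
  · simp

theorem pow_of_neg_pow {R : Type} [CommRing R] (x : R) (d : ℕ) (h : (-x) ^ d = 0) : x ^ d = 0 := by
  have h4 := congrArg (fun z => (-1) ^ d * z) h
  simpa only [← mul_pow, neg_mul_neg, neg_mul, neg_neg, one_mul, mul_zero] using h4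

theorem X_pow_mem (d : ℕ) (p : Fin d) : (X p : MvPolynomial (Fin d) ℂ) ^ d ∈ I d := by
  have h := congrArg (Polynomial.eval (-(Ideal.Quotient.mk (I d) (X p)))) (prod_quot d)
  rw [Polynomial.eval_prod, Finset.prod_eq_zero (Finset.mem_univ p) (by simp)] at h
  rw [← Ideal.Quotient.eq_zero_iff_mem, map_pow]
  rw [Polynomial.eval_pow, Polynomial.eval_X] at h
  exact pow_of_neg_pow _ _ h.symm

theorem quot_span (d : ℕ) : ∃ g : Fin d.factorial → MvPolynomial (Fin d) ℂ ⧸ I d,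
    Submodule.span ℂ (Set.range g) = ⊤ := by
  refine span_tower d ℂ _ (fun i => - Ideal.Quotient.mk (I d) (X i)) (Polynomial.X ^ d)
    (Polynomial.monic_X_pow d) (by simp) ?_ ?_
  · simp [← prod_quot]
  · rw [eq_top_iff]
    intro s _
    obtain ⟨q, rfl⟩ := Ideal.Quotient.mk_surjective s
    induction q using MvPolynomial.induction_on with
    | C a => exact Subalgebra.algebraMap_mem _ a
    | add p q hp hq => rw [map_add]; exact add_mem (hp trivial) (hq trivial)
    | mul_X p i hp =>
      rw [map_mul]
      refine mul_mem (hp trivial) ?_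
      rw [← neg_neg (Ideal.Quotient.mk (I d) (X i))]
      exact neg_mem (Algebra.subset_adjoin ⟨i, rfl⟩)

/-- harmonic functionals -/
def H (d : ℕ) : Submodule ℂ ((Fin d →₀ ℕ) → ℂ) where
  carrier := {h | ∀ j, 1 ≤ j → ∀ m, ∑ p, h (m + Finsupp.single p j) = 0}
  zero_mem' := by intro j _ m; simp
  add_mem' := by
    intro a b ha hb j hj m
    simp [Finset.sum_add_distrib, ha j hj m, hb j hj m]
  smul_mem' := by
    intro c a ha j hj m
    simp [← Finset.mul_sum, ha j hj m]

/-- functional on polynomials attached to its values on monomials -/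
noncomputable def func (d : ℕ) : ((Fin d →₀ ℕ) → ℂ) →ₗ[ℂ] (MvPolynomial (Fin d) ℂ →ₗ[ℂ] ℂ) :=
  ((basisMonomials (Fin d) ℂ).constr ℂ).toLinearMap

theorem func_monomial (d : ℕ) (h : (Fin d →₀ ℕ) → ℂ) (m : Fin d →₀ ℕ) :
    func d h (monomial m 1) = h m := by
  have := (basisMonomials (Fin d) ℂ).constr_basis ℂ h m
  simpa [func] using this

theorem func_I (d : ℕ) (h : (Fin d →₀ ℕ) → ℂ) (hh : h ∈ H d) (q : MvPolynomial (Fin d) ℂ)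
    (hq : q ∈ I d) : func d h q = 0 := by
  have key : ∀ (q : MvPolynomial (Fin d) ℂ) (j : ℕ), 1 ≤ j → func d h (q * psum (Fin d) ℂ j) = 0 := by
    intro q j hj
    induction q using MvPolynomial.induction_on' with
    | monomial m a =>
      have h1 : monomial m a * psum (Fin d) ℂ j = a • ∑ p, monomial (m + Finsupp.single p j) (1 : ℂ) := by
        rw [psum, Finset.mul_sum, Finset.smul_sum]
        refine Finset.sum_congr rfl fun p _ => ?_
        rw [X_pow_eq_monomial, monomial_mul, smul_monomial]
        simp
      rw [h1, map_smul, map_sum]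
      simp only [func_monomial]
      rw [hh j hj m, smul_zero]
    | add p q hp hq => rw [add_mul, map_add, hp, hq, add_zero]
  refine Submodule.span_induction (p := fun q _ => ∀ r, func d h (r * q) = 0) ?_ ?_ ?_ ?_ hq 1 |> fun h => by simpa using h
  · rintro _ ⟨j, hj, rfl⟩ r
    exact key r j hj
  · simp
  · intro x y _ _ hx hy r
    rw [mul_add, map_add, hx, hy, add_zero]
  · intro a x _ hx r
    rw [smul_eq_mul, ← mul_assoc]
    exact hx _
end GG

namespace GG
open MvPolynomial

theorem H_eq_zero (d : ℕ) (h : (Fin d →₀ ℕ) → ℂ) (hh : h ∈ H d) (m : Fin d →₀ ℕ) (p : Fin d)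
    (hp : d ≤ m p) : h m = 0 := by
  rw [← func_monomial d h m]
  apply func_I d h hh
  have : monomial m (1 : ℂ) = monomial (m - Finsupp.single p d) 1 * X p ^ d := by
    rw [X_pow_eq_monomial, monomial_mul, tsub_add_cancel_of_le, one_mul]
    rw [Finsupp.single_le_iff]
    exact hp
  rw [this]
  exact Ideal.mul_mem_left _ _ (X_pow_mem d p)

theorem H_finrank (d : ℕ) : Module.Finite ℂ (H d) ∧ Module.finrank ℂ (H d) ≤ d.factorial := by
  obtain ⟨g, hg⟩ := quot_span d
  choose g' hg' using fun i => Ideal.Quotient.mk_surjective (g i)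
  let Λ : H d →ₗ[ℂ] (Fin d.factorial → ℂ) :=
    { toFun := fun h i => func d h.1 (g' i)
      map_add' := by intro a b; ext i; simp
      map_smul' := by intro a b; ext i; simp }
  have hinj : Function.Injective Λ := by
    rw [← LinearMap.ker_eq_bot, LinearMap.ker_eq_bot']
    intro h h0
    ext m
    have hm : Ideal.Quotient.mk (I d) (monomial m 1) ∈ Submodule.span ℂ (Set.range g) := by
      rw [hg]; trivial
    rw [Submodule.mem_span_range_iff_exists_fun] at hm
    obtain ⟨c, hc⟩ := hm
    have h1 : Ideal.Quotient.mk (I d) (∑ i, c i • g' i) = Ideal.Quotient.mk (I d) (monomial m 1) := by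
      rw [← hc, map_sum]
      refine Finset.sum_congr rfl fun i _ => ?_
      rw [← hg' i]
      rfl
    rw [Ideal.Quotient.eq] at h1
    have h2 := func_I d h.1 h.2 _ h1
    rw [map_sub, sub_eq_zero, func_monomial, map_sum] at h2
    rw [← h2]
    refine Finset.sum_eq_zero fun i _ => ?_
    have h3 : func d h.1 (g' i) = 0 := congrFun h0 i
    rw [map_smul, h3, smul_zero]
  have hf := Module.Finite.of_injective Λ hinj
  refine ⟨hf, ?_⟩
  have := LinearMap.finrank_le_finrank_of_injective hinj
  simpa using this

/-- value of a monomial -/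
def mon {d : ℕ} (m : Fin d →₀ ℕ) (x : Fin d → ℂ) : ℂ := ∏ p, x p ^ m p

/-- distinct points -/
def cc (d : ℕ) : Fin d → ℂ := fun i => ((i : ℕ) : ℂ)

theorem cc_inj (d : ℕ) : Function.Injective (cc d) := by
  intro a b h
  simp only [cc, Nat.cast_inj] at h
  exact Fin.ext h

/-- exponents bounded by d -/
noncomputable def box (d : ℕ) : Finset (Fin d →₀ ℕ) := Finset.Iic (Finsupp.equivFunOnFinite.symm fun _ => d)

theorem mem_box (d : ℕ) (m : Fin d →₀ ℕ) : m ∈ box d ↔ ∀ p, m p ≤ d := by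
  simp [box, Finsupp.le_def]

/-- evaluation of a harmonic functional, seen as a polynomial, on an orbit -/
noncomputable def Th (d : ℕ) : H d →ₗ[ℂ] (Equiv.Perm (Fin d) → ℂ) where
  toFun := fun h σ => ∑ m ∈ box d, h.1 m * mon m (cc d ∘ σ)
  map_add' := by intro a b; ext σ; simp [add_mul, Finset.sum_add_distrib]
  map_smul' := by intro a b; ext σ; simp [mul_assoc, Finset.mul_sum]

theorem Th_eq (d : ℕ) (h : H d) (σ : Equiv.Perm (Fin d)) (A : Finset (Fin d →₀ ℕ))
    (hA : ∀ m, h.1 m ≠ 0 → m ∈ A) : Th d h σ = ∑ m ∈ A, h.1 m * mon m (cc d ∘ σ) := by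
  have hB : ∀ m, h.1 m ≠ 0 → m ∈ box d := by
    intro m hm
    rw [mem_box]
    intro p
    by_contra hp
    exact hm (H_eq_zero d h.1 h.2 m p (by omega))
  classical
  show ∑ m ∈ box d, h.1 m * mon m (cc d ∘ σ) = _
  have h2 : ∑ m ∈ A, h.1 m * mon m (cc d ∘ σ) = ∑ m ∈ box d ∪ A, h.1 m * mon m (cc d ∘ σ) := by
    refine Finset.sum_subset Finset.subset_union_right ?_
    intro m _ hm
    rw [not_not.1 (mt (hA m) hm), zero_mul]
  rw [h2]
  refine Finset.sum_subset Finset.subset_union_left ?_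
  · intro m _ hm
    rw [not_not.1 (mt (hB m) hm), zero_mul]

theorem mon_add_single {d : ℕ} (m : Fin d →₀ ℕ) (p : Fin d) (j : ℕ) (x : Fin d → ℂ) :
    mon (m + Finsupp.single p j) x = mon m x * x p ^ j := by
  classical
  simp only [mon, Finsupp.add_apply, pow_add, Finset.prod_mul_distrib]
  congr 1
  rw [Finset.prod_eq_single p]
  · simp
  · intro b _ hb
    rw [Finsupp.single_eq_of_ne hb, pow_zero]
  · simp

theorem mon_mem_range (d : ℕ) : ∀ (n : ℕ) (m : Fin d →₀ ℕ), ∑ p, m p = n →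
    (fun σ : Equiv.Perm (Fin d) => mon m (cc d ∘ σ)) ∈ LinearMap.range (Th d) := by
  classical
  intro n
  induction n using Nat.strong_induction_on with
  | _ n ih =>
  intro m hm
  let A : Finset (Fin d →₀ ℕ) := Finset.finsuppAntidiag Finset.univ n
  have hA : ∀ l, l ∈ A ↔ ∑ p, l p = n := by
    intro l; simp [A, Finset.mem_finsuppAntidiag]
  let w : (Fin d →₀ ℕ) → ℕ → EuclideanSpace ℂ A := fun m' j =>
    WithLp.toLp 2 fun l => ∑ p, if l.1 = m' + Finsupp.single p j then 1 else 0
  let K : Submodule ℂ (EuclideanSpace ℂ A) :=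
    Submodule.span ℂ {v | ∃ m' j, 1 ≤ j ∧ ∑ p, m' p + j = n ∧ v = w m' j}
  let E : EuclideanSpace ℂ A →ₗ[ℂ] (Equiv.Perm (Fin d) → ℂ) :=
    { toFun := fun v σ => ∑ l : A, v l * mon l.1 (cc d ∘ σ)
      map_add' := by intro a b; ext σ; simp [add_mul, Finset.sum_add_distrib]
      map_smul' := by intro a b; ext σ; simp [mul_assoc, Finset.mul_sum] }
  have hadd : ∀ (m' : Fin d →₀ ℕ) p j, ∑ q, (m' + Finsupp.single p j : Fin d →₀ ℕ) q = ∑ q, m' q + j := by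
    intro m' p j
    simp only [Finsupp.add_apply, Finset.sum_add_distrib]
    congr 1
    rw [Finset.sum_eq_single p]
    · simp
    · intro b _ hb
      rw [Finsupp.single_eq_of_ne hb]
    · simp
  have hsum : ∀ (m' : Fin d →₀ ℕ) (j : ℕ) (G : (Fin d →₀ ℕ) → ℂ), ∑ p, m' p + j = n →
      ∑ l : A, (∑ p, if l.1 = m' + Finsupp.single p j then (1 : ℂ) else 0) * G l.1 =
      ∑ p, G (m' + Finsupp.single p j) := by
    intro m' j G hj
    simp only [Finset.sum_mul]
    rw [Finset.sum_comm]
    refine Finset.sum_congr rfl fun p _ => ?_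
    have hmem : m' + Finsupp.single p j ∈ A := by rw [hA, hadd, hj]
    rw [Finset.sum_eq_single ⟨_, hmem⟩]
    · simp
    · intro b _ hb
      rw [if_neg, zero_mul]
      intro h; exact hb (Subtype.ext h)
    · simp
  have hK : K ≤ (LinearMap.range (Th d)).comap E := by
    rw [Submodule.span_le]
    rintro _ ⟨m', j, hj, hn, rfl⟩
    have h1 : E (w m' j) = (∑ p, cc d p ^ j) • fun σ : Equiv.Perm (Fin d) => mon m' (cc d ∘ σ) := by
      ext σ
      have := hsum m' j (fun l => mon l (cc d ∘ σ)) hn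
      refine this.trans ?_
      simp only [mon_add_single, ← Finset.mul_sum, Pi.smul_apply, smul_eq_mul]
      rw [mul_comm]
      congr 1
      exact Equiv.sum_comp σ (fun p => cc d p ^ j)
    show E (w m' j) ∈ LinearMap.range (Th d)
    rw [h1]
    exact Submodule.smul_mem _ _ (ih _ (by omega) m' rfl)
  let δ : EuclideanSpace ℂ A := WithLp.toLp 2 fun l => if l.1 = m then 1 else 0
  obtain ⟨y, hy, z, hz, hδ⟩ := Submodule.exists_add_mem_mem_orthogonal (K := K) δ
  have hEδ : E δ = fun σ : Equiv.Perm (Fin d) => mon m (cc d ∘ σ) := by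
    ext σ
    show ∑ l : A, (if l.1 = m then (1 : ℂ) else 0) * mon l.1 (cc d ∘ σ) = _
    have hmem : m ∈ A := by rw [hA, hm]
    rw [Finset.sum_eq_single ⟨_, hmem⟩]
    · simp
    · intro b _ hb
      rw [if_neg, zero_mul]
      intro h; exact hb (Subtype.ext h)
    · simp
  rw [← hEδ, hδ, map_add]
  refine Submodule.add_mem _ (hK hy) ?_
  let h : (Fin d →₀ ℕ) → ℂ := fun l => if hl : l ∈ A then z ⟨l, hl⟩ else 0
  have hhz : ∀ l : A, h l.1 = z l := by
    intro l; simp [h]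
  have hH : h ∈ H d := by
    intro j hj m'
    by_cases hn : ∑ p, m' p + j = n
    · have h1 := (Submodule.mem_orthogonal _ _).1 hz (w m' j) (Submodule.subset_span ⟨m', j, hj, hn, rfl⟩)
      rw [← hsum m' j h hn]
      refine Eq.trans ?_ h1
      rw [PiLp.inner_apply]
      refine Finset.sum_congr rfl fun l _ => ?_
      rw [hhz]
      simp [w, mul_comm]
    · refine Finset.sum_eq_zero fun p _ => ?_
      simp only [h]
      rw [dif_neg]
      rw [hA, hadd]
      exact hn
  refine ⟨⟨h, hH⟩, ?_⟩
  ext σ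
  rw [Th_eq d ⟨h, hH⟩ σ A]
  · rw [← Finset.sum_coe_sort]
    refine Finset.sum_congr rfl fun l _ => ?_
    exact congrArg (fun t => t * mon l.1 (cc d ∘ σ)) (hhz l)
  · intro l hl
    by_contra hc
    exact hl (dif_neg hc)

theorem Th_surj (d : ℕ) : Function.Surjective (Th d) := by
  classical
  rw [← LinearMap.range_eq_top, eq_top_iff]
  have key : ∀ q : MvPolynomial (Fin d) ℂ,
      (fun σ : Equiv.Perm (Fin d) => eval (cc d ∘ σ) q) ∈ LinearMap.range (Th d) := by
    intro q
    induction q using MvPolynomial.induction_on' with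
    | monomial m a =>
      have h := Submodule.smul_mem _ a (mon_mem_range d _ m rfl)
      convert! h using 1
      ext σ
      rw [eval_monomial, Finsupp.prod_fintype _ _ (by simp)]
      rfl
    | add p q hp hq =>
      have h := Submodule.add_mem _ hp hq
      convert! h using 1
      ext σ
      simp
  intro y _
  let L : Equiv.Perm (Fin d) → MvPolynomial (Fin d) ℂ := fun σ =>
    ∏ p, ∏ i ∈ Finset.univ.erase (σ p), C (cc d (σ p) - cc d i)⁻¹ * (X p - C (cc d i))
  have hL : ∀ σ τ : Equiv.Perm (Fin d), eval (cc d ∘ τ) (L σ) = if τ = σ then 1 else 0 := by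
    intro σ τ
    simp only [L, map_prod, map_mul, eval_C, map_sub, eval_X, Function.comp]
    split_ifs with h
    · subst h
      refine Finset.prod_eq_one fun p _ => Finset.prod_eq_one fun i hi => ?_
      refine inv_mul_cancel₀ (sub_ne_zero.2 fun h => ?_)
      exact (Finset.mem_erase.1 hi).1 (cc_inj d h).symm
    · obtain ⟨p, hp⟩ : ∃ p, τ p ≠ σ p := by
        by_contra hc
        push Not at hc
        exact h (Equiv.ext hc)
      refine Finset.prod_eq_zero (Finset.mem_univ p) ?_
      refine Finset.prod_eq_zero (Finset.mem_erase.2 ⟨hp, Finset.mem_univ _⟩) ?_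
      simp
  have := key (∑ σ, C (y σ) * L σ)
  convert this using 1
  ext τ
  simp [hL]

theorem Th_bij (d : ℕ) : Function.Bijective (Th d) := by
  obtain ⟨hf, hle⟩ := H_finrank d
  have hs := Th_surj d
  refine ⟨?_, hs⟩
  have h1 := LinearMap.finrank_le_finrank_of_surjective hs
  have h2 : Module.finrank ℂ (Equiv.Perm (Fin d) → ℂ) = d.factorial := by
    simp [Fintype.card_perm]
  rw [h2] at h1
  exact (LinearMap.injective_iff_surjective_of_finrank_eq_finrank (by rw [h2]; omega)).2 hs

end GG

namespace GG
open MvPolynomial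

/-- shift the order of the p-th letter by j, zero if out of range -/
def sh {d n k : ℕ} (F : (Fin d → Fin n × Fin (k + 1)) → ℂ) (w : Fin d → Fin n × Fin (k + 1))
    (p : Fin d) (j : ℕ) : ℂ :=
  if h : ((w p).2 : ℕ) + j < k + 1 then F (Function.update w p ((w p).1, ⟨(w p).2 + j, h⟩)) else 0

/-- symmetric harmonic tensors -/
def FF (d n k : ℕ) : Submodule ℂ ((Fin d → Fin n × Fin (k + 1)) → ℂ) where
  carrier := {F | (∀ (σ : Equiv.Perm (Fin d)) w, F (w ∘ σ) = F w) ∧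
    ∀ j, 1 ≤ j → ∀ w, ∑ p, sh F w p j = 0}
  zero_mem' := by
    refine ⟨fun _ _ => rfl, fun j _ w => Finset.sum_eq_zero fun p _ => ?_⟩
    simp [sh]
  add_mem' := by
    rintro a b ⟨ha, ha'⟩ ⟨hb, hb'⟩
    refine ⟨fun σ w => by simp [ha, hb], fun j hj w => ?_⟩
    have : ∀ p, sh (a + b) w p j = sh a w p j + sh b w p j := by
      intro p; simp only [sh]; split_ifs <;> simp
    simp [this, Finset.sum_add_distrib, ha' j hj, hb' j hj]
  smul_mem' := by
    rintro c a ⟨ha, ha'⟩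
    refine ⟨fun σ w => by simp [ha], fun j hj w => ?_⟩
    have : ∀ p, sh (c • a) w p j = c * sh a w p j := by
      intro p; simp only [sh]; split_ifs <;> simp
    simp [this, ← Finset.mul_sum, ha' j hj]

theorem perm_mem {d : ℕ} (σ : Equiv.Perm (Fin d)) (h : (Fin d →₀ ℕ) → ℂ) (hh : h ∈ H d) :
    (fun m => h (Finsupp.equivMapDomain σ m)) ∈ H d := by
  intro j hj m
  have := hh j hj (Finsupp.equivMapDomain σ m)
  rw [← this, ← Equiv.sum_comp σ (fun p => h (Finsupp.equivMapDomain σ m + Finsupp.single p j))]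
  refine Finset.sum_congr rfl fun p _ => ?_
  refine congrArg h ?_
  ext q
  simp [Finsupp.equivMapDomain_apply, Finsupp.single_apply, Equiv.eq_symm_apply]

theorem Th_perm {d : ℕ} (σ τ : Equiv.Perm (Fin d)) (h : H d) :
    Th d ⟨_, perm_mem σ h.1 h.2⟩ τ = Th d h (τ * σ⁻¹) := by
  show ∑ m ∈ box d, h.1 (Finsupp.equivMapDomain σ m) * mon m (cc d ∘ τ) =
    ∑ m ∈ box d, h.1 m * mon m (cc d ∘ (τ * σ⁻¹ : Equiv.Perm (Fin d)))
  refine Finset.sum_nbij' (Finsupp.equivMapDomain σ) (Finsupp.equivMapDomain σ.symm) ?_ ?_ ?_ ?_ ?_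
  · intro m hm
    rw [mem_box] at *
    intro p
    exact hm _
  · intro m hm
    rw [mem_box] at *
    intro p
    exact hm _
  · intro m _; ext; simp
  · intro m _; ext; simp
  · intro m _
    congr 1
    unfold mon
    rw [← Equiv.prod_comp σ (fun p => _ ^ (Finsupp.equivMapDomain σ m) p)]
    refine Finset.prod_congr rfl fun p _ => ?_
    simp

/-- zero extension -/
noncomputable def ext0 {d n k : ℕ} (F : (Fin d → Fin n × Fin (k + 1)) → ℂ) (t : Fin d → Fin n)
    (m : Fin d →₀ ℕ) : ℂ :=
  open Classical in
  if h : ∀ p, m p < k + 1 then F (fun p => (t p, ⟨m p, h p⟩)) else 0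

theorem ext0_mem {d n k : ℕ} (F : FF d n k) (t : Fin d → Fin n) : ext0 F.1 t ∈ H d := by
  classical
  intro j hj m
  by_cases h : ∀ p, m p < k + 1
  · have := F.2.2 j hj (fun p => (t p, ⟨m p, h p⟩))
    rw [← this]
    refine Finset.sum_congr rfl fun p _ => ?_
    unfold ext0 sh
    by_cases hp : m p + j < k + 1
    · have h2 : ∀ q, (m + Finsupp.single p j : Fin d →₀ ℕ) q < k + 1 := by
        intro q
        by_cases hq : q = p
        · subst hq; simpa using hp
        · simpa [Finsupp.single_eq_of_ne hq] using h q
      rw [dif_pos h2, dif_pos hp]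
      refine congrArg F.1 ?_
      ext1 q
      by_cases hq : q = p
      · subst hq; simp
      · simp [Function.update_of_ne hq, Finsupp.single_eq_of_ne hq]
    · rw [dif_neg, dif_neg hp]
      intro h2
      exact hp (by simpa using h2 p)
  · refine Finset.sum_eq_zero fun p _ => ?_
    unfold ext0
    rw [dif_neg]
    intro h2
    refine h fun q => lt_of_le_of_lt ?_ (h2 q)
    simp

theorem ext0_perm {d n k : ℕ} (F : FF d n k) (t : Fin d → Fin n) (σ : Equiv.Perm (Fin d))
    (m : Fin d →₀ ℕ) : ext0 F.1 (t ∘ σ.symm) (Finsupp.equivMapDomain σ m) = ext0 F.1 t m := by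
  unfold ext0
  by_cases h : ∀ p, m p < k + 1
  · have h2 : ∀ p, (Finsupp.equivMapDomain σ m) p < k + 1 := fun p => h _
    rw [dif_pos h, dif_pos h2, ← F.2.1 σ.symm (fun p => (t p, ⟨m p, h p⟩))]
    rfl
  · rw [dif_neg h, dif_neg]
    intro h2
    refine h fun p => ?_
    simpa using h2 (σ p)

/-- the comparison map -/
noncomputable def Lam (d n k : ℕ) : FF d n k →ₗ[ℂ] ((Fin d → Fin n) → ℂ) where
  toFun := fun F t => Th d ⟨ext0 F.1 t, ext0_mem F t⟩ 1
  map_add' := by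
    intro a b; ext t
    rw [Pi.add_apply, ← Pi.add_apply (Th d _) (Th d _) 1, ← map_add]
    refine congrFun (congrArg (Th d) (Subtype.ext ?_)) 1
    ext m
    simp only [ext0, Submodule.coe_add, Pi.add_apply]
    split_ifs <;> simp
  map_smul' := by
    intro c a; ext t
    rw [RingHom.id_apply, Pi.smul_apply, ← Pi.smul_apply c (Th d _) 1, ← map_smul]
    refine congrFun (congrArg (Th d) (Subtype.ext ?_)) 1
    ext m
    simp only [ext0, Submodule.coe_smul, Pi.smul_apply]
    split_ifs <;> simp

theorem Lam_perm {d n k : ℕ} (F : FF d n k) (t : Fin d → Fin n) (σ : Equiv.Perm (Fin d)) :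
    Th d ⟨ext0 F.1 t, ext0_mem F t⟩ σ = Lam d n k F (t ∘ σ.symm) := by
  have h := Th_perm σ σ ⟨ext0 F.1 (t ∘ σ.symm), ext0_mem F (t ∘ σ.symm)⟩
  rw [mul_inv_cancel] at h
  refine Eq.trans ?_ h
  refine congrFun (congrArg (Th d) (Subtype.ext ?_)) σ
  ext m
  exact (ext0_perm F t σ m).symm

theorem Lam_inj (d n k : ℕ) : Function.Injective (Lam d n k) := by
  rw [← LinearMap.ker_eq_bot, LinearMap.ker_eq_bot']
  intro F hF
  ext w
  have h1 : (⟨ext0 F.1 (fun p => (w p).1), ext0_mem F _⟩ : H d) = 0 := by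
    apply (Th_bij d).1
    rw [map_zero]
    ext σ
    rw [Lam_perm, hF]
    rfl
  have h2 := congrFun (congrArg Subtype.val h1) (Finsupp.equivFunOnFinite.symm fun p => ((w p).2 : ℕ))
  have h3 : ∀ p, (Finsupp.equivFunOnFinite.symm fun p => ((w p).2 : ℕ)) p < k + 1 := fun p => (w p).2.2
  simp only [ext0] at h2
  rw [dif_pos h3] at h2
  exact h2

theorem Lam_surj (d n k : ℕ) (hk : d ≤ k + 1) : Function.Surjective (Lam d n k) := by
  intro y
  choose h hh using fun t : Fin d → Fin n => (Th_bij d).2 (fun σ => y (t ∘ σ.symm))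
  have hperm : ∀ t (σ : Equiv.Perm (Fin d)) m,
      (h (t ∘ σ.symm)).1 (Finsupp.equivMapDomain σ m) = (h t).1 m := by
    intro t σ m
    have : (⟨_, perm_mem σ (h (t ∘ σ.symm)).1 (h (t ∘ σ.symm)).2⟩ : H d) = h t := by
      apply (Th_bij d).1
      ext τ
      rw [Th_perm, hh, hh]
      refine congrArg y ?_
      ext p
      simp [← Equiv.Perm.inv_def]
      rw [Equiv.symm_apply_apply]
    exact congrFun (congrArg Subtype.val this) m
  let lw : (Fin d → Fin n × Fin (k + 1)) → (Fin d →₀ ℕ) := fun w =>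
    Finsupp.equivFunOnFinite.symm fun p => ((w p).2 : ℕ)
  let F : (Fin d → Fin n × Fin (k + 1)) → ℂ := fun w => (h fun p => (w p).1).1 (lw w)
  have hF : F ∈ FF d n k := by
    constructor
    · intro σ w
      have := hperm (fun p => (w p).1) σ.symm (lw w)
      refine Eq.trans ?_ this
      show (h _).1 _ = (h _).1 _
      refine congrArg (h _).1 ?_
      ext q
      simp [lw]
    · intro j hj w
      rw [← (h fun p => (w p).1).2 j hj (lw w)]
      refine Finset.sum_congr rfl fun p _ => ?_
      unfold sh
      split_ifs with hp
      · show (h _).1 _ = (h _).1 _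
        have e1 : (fun q => (Function.update w p ((w p).1, ⟨(w p).2 + j, hp⟩) q).1) =
            fun q => (w q).1 := by
          ext1 q
          by_cases hq : q = p
          · subst hq; simp
          · simp [Function.update_of_ne hq]
        rw [e1]
        refine congrArg (h _).1 ?_
        ext q
        by_cases hq : q = p
        · subst hq; simp [lw]
        · simp [lw, Function.update_of_ne hq, Finsupp.single_eq_of_ne hq]
      · symm
        refine H_eq_zero d _ (h _).2 _ p ?_
        simp [lw]
        omega
  refine ⟨⟨F, hF⟩, ?_⟩
  ext t
  have h1 : (⟨ext0 F t, ext0_mem ⟨F, hF⟩ t⟩ : H d) = h t := by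
    ext m
    show ext0 F t m = _
    unfold ext0
    split_ifs with hm
    · show (h t).1 _ = _
      refine congrArg (h t).1 ?_
      ext q
      simp [lw]
    · push Not at hm
      obtain ⟨p, hp⟩ := hm
      exact (H_eq_zero d _ (h _).2 _ p (by omega)).symm
  show Th d ⟨ext0 F t, ext0_mem ⟨F, hF⟩ t⟩ 1 = _
  rw [h1, hh]
  rfl

theorem FF_finrank (d n k : ℕ) (hk : d ≤ k + 1) : Module.finrank ℂ (FF d n k) = n ^ d := by
  rw [(LinearEquiv.ofBijective _ ⟨Lam_inj d n k, Lam_surj d n k hk⟩).finrank_eq]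
  simp

end GG

namespace GG
open MvPolynomial

/-- exponent of the monomial of a word -/
noncomputable def ex {d : ℕ} {V : Type} (w : Fin d → V) : V →₀ ℕ := ∑ p, Finsupp.single (w p) 1

theorem ex_apply {d : ℕ} {V : Type} [DecidableEq V] (w : Fin d → V) (a : V) :
    ex w a = Fintype.card {p // w p = a} := by
  rw [ex, Finsupp.finsetSum_apply, Fintype.card_subtype, Finset.card_filter]
  refine Finset.sum_congr rfl fun p _ => ?_
  rw [Finsupp.single_apply]

theorem ex_eq {d : ℕ} {V : Type} (w v : Fin d → V) (h : ex w = ex v) :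
    ∃ σ : Equiv.Perm (Fin d), w = v ∘ σ := by
  classical
  have e : ∀ a, {p // w p = a} ≃ {p // v p = a} := fun a =>
    Fintype.equivOfCardEq (by
      have := (ex_apply w a).symm.trans ((DFunLike.congr_fun h a).trans (ex_apply v a))
      convert this)
  refine ⟨Equiv.ofFiberEquiv e, ?_⟩
  ext p
  exact (Equiv.ofFiberEquiv_map e p).symm

theorem ex_perm {d : ℕ} {V : Type} (w : Fin d → V) (σ : Equiv.Perm (Fin d)) : ex (w ∘ σ) = ex w :=
  Equiv.sum_comp σ (fun p => Finsupp.single (w p) 1)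

theorem ex_surj {d : ℕ} {V : Type} (m : V →₀ ℕ) (hm : m.degree = d) :
    ∃ w : Fin d → V, ex w = m := by
  classical
  have hc : Multiset.card (Finsupp.toMultiset m) = d := by
    rw [Finsupp.card_toMultiset, ← hm]; rfl
  obtain ⟨l, hl⟩ := Quot.exists_rep (Finsupp.toMultiset m)
  change (l : Multiset V) = _ at hl
  have hlen : l.length = d := by rw [← hc, ← hl]; rfl
  subst hlen
  refine ⟨l.get, ?_⟩
  apply Multiset.toFinsupp.symm.injective
  change Finsupp.toMultiset _ = Finsupp.toMultiset _
  rw [← hl, ex, map_sum]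
  simp only [Finsupp.toMultiset_single, one_smul]
  have h1 : ∑ p : Fin l.length, ({l.get p} : Multiset V) = Finset.univ.val.map l.get := by
    rw [← Multiset.sum_map_singleton (Finset.univ.val.map l.get), Multiset.map_map]
    rfl
  rw [h1, Fin.univ_val_map, List.ofFn_get]

theorem prod_X_eq {d : ℕ} {V : Type} (w : Fin d → V) :
    ∏ p, (X (w p) : MvPolynomial V ℂ) = monomial (ex w) 1 := by
  rw [ex, monomial_sum_one]
  rfl

/-- polynomial attached to a tensor -/
noncomputable def Psi (d : ℕ) (V : Type) [Fintype V] : ((Fin d → V) → ℂ) →ₗ[ℂ] MvPolynomial V ℂ where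
  toFun := by classical exact fun F => ∑ w, F w • ∏ p, X (w p)
  map_add' := by intro a b; simp [add_smul, Finset.sum_add_distrib]
  map_smul' := by intro a b; simp [mul_smul, Finset.smul_sum]

theorem Psi_apply (d : ℕ) (V : Type) [Fintype V] [DecidableEq V] (F : (Fin d → V) → ℂ) :
    Psi d V F = ∑ w, F w • ∏ p, X (w p) := by
  show (∑ w, F w • ∏ p, X (w p) : MvPolynomial V ℂ) = _
  congr!

theorem coeff_Psi (d : ℕ) (V : Type) [Fintype V] [DecidableEq V] (F : (Fin d → V) → ℂ) (m : V →₀ ℕ) :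
    coeff m (Psi d V F) = ∑ w with ex w = m, F w := by
  rw [Psi_apply, coeff_sum, Finset.sum_filter]
  refine Finset.sum_congr rfl fun w _ => ?_
  rw [prod_X_eq, coeff_smul, coeff_monomial]
  simp

theorem Psi_hom (d : ℕ) (V : Type) [Fintype V] (F : (Fin d → V) → ℂ) :
    (Psi d V F).IsHomogeneous d := by
  classical
  rw [Psi_apply]
  refine IsHomogeneous.sum _ _ _ fun w _ => ?_
  have := IsHomogeneous.prod Finset.univ (fun p => (X (w p) : MvPolynomial V ℂ)) (fun _ => 1)
    (fun p _ => isHomogeneous_X ℂ (w p))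
  have h2 := (isHomogeneous_C V (F w)).mul this
  rw [smul_eq_C_mul]
  simpa using h2

theorem Psi_inj (d : ℕ) (V : Type) [Fintype V] (F : (Fin d → V) → ℂ)
    (hF : ∀ (σ : Equiv.Perm (Fin d)) w, F (w ∘ σ) = F w) (h0 : Psi d V F = 0) : F = 0 := by
  classical
  ext v
  have h := coeff_Psi d V F (ex v)
  rw [h0, coeff_zero] at h
  have h2 : ∑ w with ex w = ex v, F w = ∑ w : (Fin d → V) with ex w = ex v, F v := by
    refine Finset.sum_congr rfl fun w hw => ?_
    obtain ⟨σ, rfl⟩ := ex_eq w v (Finset.mem_filter.1 hw).2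
    exact hF σ v
  rw [h2, Finset.sum_const, nsmul_eq_mul] at h
  rcases mul_eq_zero.1 h.symm with h | h
  · exfalso
    rw [Nat.cast_eq_zero, Finset.card_eq_zero] at h
    have : v ∈ (∅ : Finset (Fin d → V)) := by rw [← h]; simp
    simp at this
  · exact h

theorem Psi_surj (d : ℕ) (V : Type) [Fintype V] (P : MvPolynomial V ℂ) (hP : P.IsHomogeneous d) :
    ∃ F : (Fin d → V) → ℂ, (∀ (σ : Equiv.Perm (Fin d)) w, F (w ∘ σ) = F w) ∧ Psi d V F = P := by
  classical
  refine ⟨fun w => coeff (ex w) P / (Finset.card {v : Fin d → V | ex v = ex w} : ℂ), ?_, ?_⟩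
  · intro σ w
    simp only [ex_perm]
  · ext m
    rw [coeff_Psi]
    have h2 : ∑ w : (Fin d → V) with ex w = m, coeff (ex w) P / (Finset.card {v : Fin d → V | ex v = ex w} : ℂ) =
        ∑ w : (Fin d → V) with ex w = m, coeff m P / (Finset.card {v : Fin d → V | ex v = m} : ℂ) := by
      refine Finset.sum_congr rfl fun w hw => ?_
      rw [(Finset.mem_filter.1 hw).2]
    rw [h2, Finset.sum_const, nsmul_eq_mul]
    by_cases hm : coeff m P = 0
    · simp [hm]
    · obtain ⟨w, hw⟩ := ex_surj (d := d) m (by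
        have := hP hm
        rw [Finsupp.degree_eq_weight_one]
        exact this)
      rw [mul_div_cancel₀]
      rw [Nat.cast_ne_zero]
      refine (Finset.card_pos.2 ⟨w, ?_⟩).ne'
      simpa using hw

/-- infinitesimal action of multiplication by z^j -/
noncomputable def DD (n k j : ℕ) : Derivation ℂ (MvPolynomial (Fin n × Fin (k + 1)) ℂ)
    (MvPolynomial (Fin n × Fin (k + 1)) ℂ) :=
  mkDerivation ℂ fun a => if j ≤ (a.2 : ℕ) then
    X (a.1, ⟨a.2 - j, lt_of_le_of_lt (Nat.sub_le _ _) a.2.2⟩) else 0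

theorem der_prod {R ι : Type} [CommRing R] [Algebra ℂ R] [DecidableEq ι] (D : Derivation ℂ R R)
    (s : Finset ι) (x : ι → R) : D (∏ p ∈ s, x p) = ∑ p ∈ s, D (x p) * ∏ q ∈ s \ {p}, x q := by
  induction s using Finset.induction_on with
  | empty => simp
  | insert a s ha ih =>
    rw [Finset.prod_insert ha, Derivation.leibniz, ih, Finset.sum_insert ha, smul_eq_mul, smul_eq_mul]
    have h1 : insert a s \ {a} = s := by
      ext q; simp only [Finset.mem_sdiff, Finset.mem_insert, Finset.mem_singleton]
      constructor
      · tauto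
      · intro h; exact ⟨Or.inr h, fun e => ha (e ▸ h)⟩
    rw [h1, add_comm, mul_comm, Finset.mul_sum]
    congr 1
    refine Finset.sum_congr rfl fun p hp => ?_
    have h2 : insert a s \ {p} = insert a (s \ {p}) := by
      rw [Finset.insert_sdiff_of_notMem]
      intro h
      rw [Finset.mem_singleton] at h
      exact ha (h ▸ hp)
    rw [h2, Finset.prod_insert (fun h => ha (Finset.mem_sdiff.1 h).1)]
    ring

theorem DD_Psi (d n k j : ℕ) (F : (Fin d → Fin n × Fin (k + 1)) → ℂ) :
    DD n k j (Psi d _ F) = Psi d _ (fun w => ∑ p, sh F w p j) := by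
  rw [Psi_apply, Psi_apply, map_sum]
  simp only [Finset.sum_smul, Derivation.map_smul, der_prod, Finset.smul_sum]
  rw [Finset.sum_comm, Finset.sum_comm (γ := Fin d → Fin n × Fin (k + 1))]
  refine Finset.sum_congr rfl fun p _ => ?_
  have hL : ∀ w : Fin d → Fin n × Fin (k + 1),
      F w • (DD n k j (X (w p)) * ∏ q ∈ Finset.univ \ {p}, X (w q)) =
      if j ≤ ((w p).2 : ℕ) then F w • ∏ q, X (Function.update w p
        ((w p).1, ⟨(w p).2 - j, lt_of_le_of_lt (Nat.sub_le _ _) (w p).2.2⟩) q) else 0 := by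
    intro w
    rw [DD, mkDerivation_X]
    split_ifs with h
    · congr 1
      have := Finset.prod_update_of_mem (Finset.mem_univ p)
        (fun q => (X (w q) : MvPolynomial (Fin n × Fin (k + 1)) ℂ))
        (X ((w p).1, ⟨(w p).2 - j, lt_of_le_of_lt (Nat.sub_le _ _) (w p).2.2⟩))
      rw [← this]
      refine Finset.prod_congr rfl fun q _ => ?_
      by_cases hq : q = p
      · subst hq; simp
      · simp [Function.update_of_ne hq]
    · simp
  have hR : ∀ w : Fin d → Fin n × Fin (k + 1),
      sh F w p j • ∏ q, (X (w q) : MvPolynomial (Fin n × Fin (k + 1)) ℂ) =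
      if ((w p).2 : ℕ) + j < k + 1 then sh F w p j • ∏ q, X (w q) else 0 := by
    intro w
    split_ifs with h
    · rfl
    · rw [sh, dif_neg h, zero_smul]
  rw [Finset.sum_congr rfl (fun w _ => hL w), Finset.sum_congr rfl (fun w _ => hR w)]
  rw [← Finset.sum_filter, ← Finset.sum_filter]
  refine Finset.sum_bij' (fun w _ => Function.update w p
        ((w p).1, ⟨(w p).2 - j, lt_of_le_of_lt (Nat.sub_le _ _) (w p).2.2⟩))
    (fun w hw => Function.update w p
        ((w p).1, ⟨(w p).2 + j, (Finset.mem_filter.1 hw).2⟩)) ?_ ?_ ?_ ?_ ?_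
  · intro w hw
    have := (Finset.mem_filter.1 hw).2
    have := (w p).2.2
    simp
    omega
  · intro w hw
    simp
  · intro w hw
    have := (Finset.mem_filter.1 hw).2
    ext1 q
    by_cases hq : q = p
    · subst hq; simp [this]
    · simp [Function.update_of_ne hq]
  · intro w hw
    ext1 q
    by_cases hq : q = p
    · subst hq; simp
    · simp [Function.update_of_ne hq]
  · intro w hw
    have := (Finset.mem_filter.1 hw).2
    have h2 := (w p).2.2
    congr 1
    unfold sh
    rw [dif_pos (by simp; omega)]
    refine congrArg F ?_
    ext1 q
    by_cases hq : q = p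
    · subst hq; simp [this]
    · simp [Function.update_of_ne hq]

/-- polynomials homogeneous of degree d and killed by the positive derivations -/
noncomputable def PP (d n k : ℕ) : Submodule ℂ (MvPolynomial (Fin n × Fin (k + 1)) ℂ) where
  carrier := {P | P.IsHomogeneous d ∧ ∀ j, 1 ≤ j → DD n k j P = 0}
  zero_mem' := ⟨isHomogeneous_zero _ _ _, fun j _ => map_zero _⟩
  add_mem' := by
    rintro a b ⟨ha, ha'⟩ ⟨hb, hb'⟩
    exact ⟨ha.add hb, fun j hj => by rw [map_add, ha' j hj, hb' j hj, add_zero]⟩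
  smul_mem' := by
    rintro c a ⟨ha, ha'⟩
    refine ⟨?_, fun j hj => by rw [Derivation.map_smul, ha' j hj, smul_zero]⟩
    exact (homogeneousSubmodule _ ℂ d).smul_mem c ha

theorem sh_perm {d n k : ℕ} (F : (Fin d → Fin n × Fin (k + 1)) → ℂ)
    (hF : ∀ (σ : Equiv.Perm (Fin d)) w, F (w ∘ σ) = F w) (σ : Equiv.Perm (Fin d)) (w) (p j) :
    sh F (w ∘ σ) p j = sh F w (σ p) j := by
  unfold sh
  simp only [Function.comp_apply]
  split_ifs with h
  · rw [← hF σ (Function.update w (σ p) _)]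
    rw [Function.update_comp_equiv]
    simp
  · rfl

theorem PP_finrank (d n k : ℕ) (hk : d ≤ k + 1) : Module.finrank ℂ (PP d n k) = n ^ d := by
  rw [← FF_finrank d n k hk]
  symm
  let f : FF d n k →ₗ[ℂ] PP d n k := LinearMap.codRestrict _
    ((Psi d (Fin n × Fin (k + 1))).comp (FF d n k).subtype) (by
      intro F
      refine ⟨Psi_hom _ _ _, fun j hj => ?_⟩
      show DD n k j (Psi d _ F.1) = 0
      rw [DD_Psi]
      have : (fun w => ∑ p, sh F.1 w p j) = 0 := by
        ext w; exact F.2.2 j hj w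
      rw [this, map_zero])
  refine (LinearEquiv.ofBijective f ⟨?_, ?_⟩).finrank_eq
  · rw [← LinearMap.ker_eq_bot, LinearMap.ker_eq_bot']
    intro F hF
    apply Subtype.ext
    exact Psi_inj d _ F.1 F.2.1 (congrArg Subtype.val hF)
  · intro P
    obtain ⟨F, hF, hP⟩ := Psi_surj d _ P.1 P.2.1
    refine ⟨⟨F, hF, fun j hj w => ?_⟩, Subtype.ext hP⟩
    have h1 : Psi d _ (fun w => ∑ p, sh F w p j) = 0 := by
      rw [← DD_Psi, hP]; exact P.2.2 j hj
    refine congrFun (Psi_inj d _ _ ?_ h1) w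
    intro σ w
    simp only [sh_perm F hF]
    exact Equiv.sum_comp σ (fun p => sh F w p j)

end GG

namespace GG
open MvPolynomial

/-- evaluation of a polynomial on the Taylor coefficients of a tuple of power series -/
noncomputable def pt {n : ℕ} (k : ℕ) (a : Fin n → PowerSeries ℂ) : Fin n × Fin (k + 1) → ℂ :=
  fun v => PowerSeries.coeff (v.2 : ℕ) (a v.1)

/-- power series tuple with given coefficients -/
noncomputable def ofx {n k : ℕ} (x : Fin n × Fin (k + 1) → ℂ) : Fin n → PowerSeries ℂ :=
  fun t => PowerSeries.mk fun l => if h : l < k + 1 then x (t, ⟨l, h⟩) else 0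

theorem pt_ofx {n k : ℕ} (x : Fin n × Fin (k + 1) → ℂ) : pt k (ofx x) = x := by
  ext v
  have h : (v.2 : ℕ) < k + 1 := v.2.2
  simp only [pt, ofx, PowerSeries.coeff_mk, dif_pos h]

theorem ofx_const {n k : ℕ} (x : Fin n × Fin (k + 1) → ℂ) (t : Fin n) :
    PowerSeries.constantCoeff (ofx x t) = x (t, 0) := by
  rw [← PowerSeries.coeff_zero_eq_constantCoeff_apply]
  simp [ofx]

theorem der_sum_apply {σ : Type} (s : Finset ℕ) (P : MvPolynomial σ ℂ)
    (D : ℕ → Derivation ℂ (MvPolynomial σ ℂ) (MvPolynomial σ ℂ)) :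
    (∑ j ∈ s, D j) P = ∑ j ∈ s, D j P := by
  induction s using Finset.induction_on with
  | empty => simp
  | insert a s ha ih => rw [Finset.sum_insert ha, Finset.sum_insert ha, Derivation.add_apply, ih]

theorem eval_aeval {σ τ : Type} (x : τ → ℂ) (q : σ → MvPolynomial τ ℂ) (P : MvPolynomial σ ℂ) :
    eval x (aeval q P) = eval (fun v => eval x (q v)) P := by
  induction P using MvPolynomial.induction_on with
  | C r => simp
  | add p q hp hq => simp only [map_add, hp, hq]
  | mul_X p v hp => simp only [map_mul, hp, aeval_X, eval_X]

theorem funext_nz {σ : Type} (p q : MvPolynomial σ ℂ)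
    (h : ∀ x : σ → ℂ, (∀ v, x v ≠ 0) → eval x p = eval x q) : p = q := by
  refine MvPolynomial.funext_set (fun _ => ({0}ᶜ : Set ℂ)) (fun _ => ?_) ?_
  · exact Set.Finite.infinite_compl (Set.finite_singleton _)
  · intro x hx
    exact h x fun v => hx v (Set.mem_univ v)

theorem hd_eval {σ : Type} (D : Derivation ℂ (MvPolynomial σ ℂ) (MvPolynomial σ ℂ))
    (c : ℂ → σ → ℂ) (z : ℂ) (hc : ∀ v, HasDerivAt (fun w => c w v) (eval (c z) (D (X v))) z)
    (P : MvPolynomial σ ℂ) : HasDerivAt (fun w => eval (c w) P) (eval (c z) (D P)) z := by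
  induction P using MvPolynomial.induction_on with
  | C r =>
    have : D (C r) = 0 := D.map_algebraMap r
    rw [this, map_zero]
    simpa using hasDerivAt_const z r
  | add p q hp hq =>
    simp only [map_add]
    exact hp.add hq
  | mul_X p v hp =>
    simp only [map_mul, eval_X, Derivation.leibniz, smul_eq_mul, map_add]
    refine (hp.mul (hc v)).congr_deriv ?_
    ring

theorem DD_X_eval {n k : ℕ} (j : ℕ) (a : Fin n → PowerSeries ℂ) (v : Fin n × Fin (k + 1)) :
    eval (pt k a) (DD n k j (X v)) = PowerSeries.coeff (v.2 : ℕ) (PowerSeries.X ^ j * a v.1) := by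
  rw [DD, mkDerivation_X, PowerSeries.coeff_X_pow_mul']
  split_ifs with h
  · simp [pt]
  · simp

theorem mul_eval {n k : ℕ} (u : PowerSeries ℂ) (a : Fin n → PowerSeries ℂ) (v : Fin n × Fin (k + 1)) :
    PowerSeries.coeff (v.2 : ℕ) (u * a v.1) =
     eval (pt k a) ((∑ j ∈ Finset.range (k + 1), PowerSeries.coeff j u • DD n k j) (X v)) := by
  rw [der_sum_apply, map_sum]
  simp only [Derivation.coe_smul, Pi.smul_apply, smul_eval, DD_X_eval, PowerSeries.coeff_X_pow_mul']
  rw [PowerSeries.coeff_mul, Finset.Nat.sum_antidiagonal_eq_sum_range_succ_mk]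
  have : ∀ j ∈ Finset.range (k + 1), j ∉ Finset.range ((v.2 : ℕ) + 1) →
    PowerSeries.coeff j u * (if j ≤ (v.2 : ℕ) then PowerSeries.coeff ((v.2 : ℕ) - j) (a v.1) else 0) = 0 := by
    intro j _ hj
    rw [if_neg, mul_zero]
    simpa using hj
  rw [← Finset.sum_subset _ this]
  · refine Finset.sum_congr rfl fun j hj => ?_
    rw [if_pos (by simpa [Nat.lt_succ_iff] using hj)]
  · intro j hj
    have := v.2.2
    simp only [Finset.mem_range] at hj ⊢
    omega

/-- invariance under multiplication of tuples by a unit power series -/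
def Inv (d n k : ℕ) (P : MvPolynomial (Fin n × Fin (k + 1)) ℂ) : Prop :=
  ∀ (a : Fin n → PowerSeries ℂ) (g : PowerSeries ℂ), (∀ t, PowerSeries.constantCoeff (a t) ≠ 0) →
    PowerSeries.constantCoeff g ≠ 0 →
    eval (pt k fun t => g * a t) P = PowerSeries.constantCoeff g ^ d * eval (pt k a) P

theorem inv_one (d n k : ℕ) (P : MvPolynomial (Fin n × Fin (k + 1)) ℂ) (hP : P ∈ PP d n k)
    (a : Fin n → PowerSeries ℂ) (g : PowerSeries ℂ) (hg : PowerSeries.constantCoeff g = 1) :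
    eval (pt k fun t => g * a t) P = eval (pt k a) P := by
  let G : ℂ → PowerSeries ℂ := fun η => 1 + PowerSeries.C η * (g - 1)
  have hG : ∀ η, PowerSeries.constantCoeff (G η) = 1 := by
    intro η; simp [G, hg]
  let c : ℂ → Fin n × Fin (k + 1) → ℂ := fun η => pt k fun t => G η * a t
  have hd : ∀ η, HasDerivAt (fun w => eval (c w) P) 0 η := by
    intro η
    let u := (g - 1) * (G η)⁻¹
    let D := ∑ j ∈ Finset.range (k + 1), PowerSeries.coeff j u • DD n k j
    have hD : D P = 0 := by
      simp only [D]
      rw [der_sum_apply]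
      refine Finset.sum_eq_zero fun j _ => ?_
      rw [Derivation.coe_smul, Pi.smul_apply]
      rcases Nat.eq_zero_or_pos j with rfl | hj
      · have : PowerSeries.coeff 0 u = 0 := by
          rw [PowerSeries.coeff_zero_eq_constantCoeff_apply]
          simp [u, hg]
        rw [this, zero_smul]
      · rw [hP.2 j hj, smul_zero]
    have := hd_eval D c η (fun v => ?_) P
    · rw [hD, map_zero] at this
      exact this
    · have h1 := mul_eval (k := k) u (fun t => G η * a t) v
      change _ = eval (c η) (D (X v)) at h1
      rw [← h1]
      have h2 : u * (G η * a v.1) = (g - 1) * a v.1 := by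
        have := PowerSeries.inv_mul_cancel (G η) (by rw [hG]; exact one_ne_zero)
        calc u * (G η * a v.1) = (g - 1) * ((G η)⁻¹ * G η) * a v.1 := by simp only [u]; ring
          _ = _ := by rw [this, mul_one]
      rw [h2]
      have h3 : (fun w => c w v) = fun w => PowerSeries.coeff (v.2 : ℕ) (a v.1) +
          w * PowerSeries.coeff (v.2 : ℕ) ((g - 1) * a v.1) := by
        ext w
        simp only [c, pt, G]
        rw [add_mul, one_mul, map_add, mul_assoc, PowerSeries.coeff_C_mul]
      rw [h3]
      simpa using ((hasDerivAt_id η).mul_const (PowerSeries.coeff (v.2 : ℕ) ((g - 1) * a v.1))).const_add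
        (PowerSeries.coeff (v.2 : ℕ) (a v.1))
  have := is_const_of_deriv_eq_zero (fun η => (hd η).differentiableAt) (fun η => (hd η).deriv) 1 0
  simpa [c, G] using this

theorem eval_scale {σ : Type} (d : ℕ) (P : MvPolynomial σ ℂ) (hP : P.IsHomogeneous d) (c : ℂ) (x : σ → ℂ) :
    eval (fun v => c * x v) P = c ^ d * eval x P := by
  rw [eval_eq, eval_eq, Finset.mul_sum]
  refine Finset.sum_congr rfl fun m hm => ?_
  have h := hP (mem_support_iff.1 hm)
  have h' : m.degree = d := by rw [Finsupp.degree_eq_weight_one]; exact h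
  simp only [mul_pow, Finset.prod_mul_distrib]
  rw [Finset.prod_pow_eq_pow_sum, ← h', Finsupp.degree]
  change coeff m P * (c ^ (∑ i ∈ m.support, m i) * _) = c ^ (∑ i ∈ m.support, m i) * _
  ring

theorem inv_of_mem (d n k : ℕ) (P : MvPolynomial (Fin n × Fin (k + 1)) ℂ) (hP : P ∈ PP d n k)
    (a : Fin n → PowerSeries ℂ) (g : PowerSeries ℂ) (hg : PowerSeries.constantCoeff g ≠ 0) :
    eval (pt k fun t => g * a t) P = PowerSeries.constantCoeff g ^ d * eval (pt k a) P := by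
  set r := PowerSeries.constantCoeff g with hr
  have h1 := inv_one d n k P hP a (PowerSeries.C r⁻¹ * g) (by simp [← hr, hg])
  rw [← h1, ← eval_scale d P hP.1]
  congr 2
  ext v
  simp only [pt]
  rw [← PowerSeries.coeff_C_mul, mul_assoc, ← mul_assoc, ← map_mul, mul_inv_cancel₀ hg, map_one, one_mul]

theorem mem_of_inv (d n k : ℕ) (P : MvPolynomial (Fin n × Fin (k + 1)) ℂ) (hP : Inv d n k P) :
    P ∈ PP d n k := by
  constructor
  · intro m hm
    have h1 : aeval (fun v => C (2 : ℂ) * X v) P = C ((2 : ℂ) ^ d) * P := by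
      apply funext_nz
      intro x hx
      have := hP (ofx x) (PowerSeries.C 2) (fun t => by rw [ofx_const]; exact hx _) (by simp)
      rw [pt_ofx] at this
      simp only [map_mul, eval_C]
      rw [PowerSeries.constantCoeff_C] at this
      rw [← this, eval_aeval]
      congr 2
      ext v
      rw [map_mul, eval_C, eval_X]
      simp only [pt]
      rw [PowerSeries.coeff_C_mul]
      exact congrArg (2 * ·) (congrFun (pt_ofx x) v).symm
    have h2 : ∀ Q : MvPolynomial (Fin n × Fin (k + 1)) ℂ,
        coeff m (aeval (fun v => C (2 : ℂ) * X v) Q) = 2 ^ m.degree * coeff m Q := by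
      intro Q
      induction Q using MvPolynomial.induction_on' with
      | monomial u c =>
        have h3 : aeval (fun v => C (2 : ℂ) * X v) (monomial u c) = monomial u (2 ^ u.degree * c) := by
          rw [aeval_monomial, Finsupp.prod]
          simp only [mul_pow, Finset.prod_mul_distrib]
          rw [Finset.prod_pow_eq_pow_sum, monomial_eq, map_mul, algebraMap_eq, map_pow]
          change C c * (C 2 ^ (∑ i ∈ u.support, u i) * _) = C 2 ^ (∑ i ∈ u.support, u i) * _ * _
          rw [Finsupp.prod]
          ring
        rw [h3, coeff_monomial, coeff_monomial]
        split_ifs with h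
        · rw [h]
        · simp
      | add p q hp hq => rw [map_add, coeff_add, coeff_add, hp, hq, mul_add]
    have h3 := h2 P
    rw [h1, coeff_C_mul] at h3
    have h4 := mul_right_cancel₀ hm h3
    have h5 : (2 : ℕ) ^ d = 2 ^ m.degree := by exact_mod_cast h4
    have h6 : m.degree = d := (Nat.pow_right_injective le_rfl h5).symm
    rw [Finsupp.degree_eq_weight_one] at h6
    exact h6
  · intro j hj
    apply funext_nz
    intro x hx
    rw [map_zero]
    let c : ℂ → Fin n × Fin (k + 1) → ℂ := fun η => pt k fun t => (1 + PowerSeries.C η * PowerSeries.X ^ j) * ofx x t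
    have hc0 : c 0 = x := by
      simp only [c, map_zero, zero_mul, add_zero, one_mul]
      exact pt_ofx x
    have h1 := hd_eval (DD n k j) c 0 (fun v => ?_) P
    · have h2 : (fun w => eval (c w) P) = fun w => eval x P := by
        ext w
        have := hP (ofx x) (1 + PowerSeries.C w * PowerSeries.X ^ j)
          (fun t => by rw [ofx_const]; exact hx _) (by simp [show j ≠ 0 by omega])
        rw [pt_ofx] at this
        simpa [show j ≠ 0 by omega] using this
      rw [h2, hc0] at h1
      exact h1.unique (hasDerivAt_const _ _)
    · rw [hc0, ← pt_ofx x, DD_X_eval]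
      have h3 : (fun w => c w v) = fun w => PowerSeries.coeff (v.2 : ℕ) (ofx x v.1) +
          w * PowerSeries.coeff (v.2 : ℕ) (PowerSeries.X ^ j * ofx x v.1) := by
        ext w
        simp only [c, pt]
        rw [add_mul, one_mul, map_add, mul_assoc, PowerSeries.coeff_C_mul]
      rw [h3]
      simpa using ((hasDerivAt_id (0 : ℂ)).mul_const (PowerSeries.coeff (v.2 : ℕ) (PowerSeries.X ^ j * ofx x v.1))).const_add
        (PowerSeries.coeff (v.2 : ℕ) (ofx x v.1))

end GG

namespace GG
open MvPolynomial

/-- Taylor series at zero -/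
noncomputable def tau (f : ℂ → ℂ) : PowerSeries ℂ :=
  PowerSeries.mk fun l => iteratedDeriv l f 0 / (l.factorial : ℂ)

theorem tau_const_coeff (f : ℂ → ℂ) : PowerSeries.constantCoeff (tau f) = f 0 := by
  rw [← PowerSeries.coeff_zero_eq_constantCoeff_apply]
  simp [tau]

theorem tau_congr {f g : ℂ → ℂ} (h : f =ᶠ[nhds 0] g) : tau f = tau g := by
  ext l
  simp only [tau, PowerSeries.coeff_mk]
  rw [h.iteratedDeriv_eq]

theorem tau_mul {f g : ℂ → ℂ} (hf : AnalyticAt ℂ f 0) (hg : AnalyticAt ℂ g 0) :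
    tau (f * g) = tau f * tau g := by
  ext l
  simp only [tau, PowerSeries.coeff_mk, PowerSeries.coeff_mul,
    iteratedDeriv_mul hf.contDiffAt hg.contDiffAt, Finset.sum_div,
    Finset.Nat.sum_antidiagonal_eq_sum_range_succ_mk, Nat.succ_eq_add_one]
  refine Finset.sum_congr rfl fun i hi => ?_
  rw [Nat.cast_choose _ (by grind)]
  field_simp [Nat.factorial_ne_zero]

theorem tau_add {f g : ℂ → ℂ} (hf : AnalyticAt ℂ f 0) (hg : AnalyticAt ℂ g 0) :
    tau (f + g) = tau f + tau g := by
  ext l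
  simp only [tau, PowerSeries.coeff_mk, map_add]
  rw [iteratedDeriv_add hf.contDiffAt hg.contDiffAt, add_div]

theorem tau_const (c : ℂ) : tau (fun _ => c) = PowerSeries.C c := by
  ext l
  simp only [tau, PowerSeries.coeff_mk, PowerSeries.coeff_C, iteratedDeriv_const]
  split_ifs with h
  · simp [h]
  · simp

theorem tau_id : tau (fun z => z) = PowerSeries.X := by
  ext l
  simp only [tau, PowerSeries.coeff_mk, PowerSeries.coeff_X]
  rcases l with _ | _ | l
  · simp
  · simp [iteratedDeriv_succ]
  · rw [iteratedDeriv_succ']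
    simp [iteratedDeriv_const]

theorem poly_an (p : Polynomial ℂ) : AnalyticAt ℂ (fun z => p.eval z) 0 := by
  have := (Polynomial.differentiable p).analyticAt (0 : ℂ)
  exact this

theorem tau_poly (p : Polynomial ℂ) : tau (fun z => p.eval z) = (p : PowerSeries ℂ) := by
  induction p using Polynomial.induction_on with
  | C a => simpa using tau_const a
  | add p q hp hq =>
    rw [Polynomial.coe_add, ← hp, ← hq, ← tau_add (poly_an p) (poly_an q)]
    congr 1
    ext z
    simp
  | monomial n a h =>
    have h1 : (fun z => (Polynomial.C a * Polynomial.X ^ (n + 1)).eval z) =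
      (fun z => (Polynomial.C a * Polynomial.X ^ n).eval z) * (fun z => z) := by
      ext z
      simp [pow_succ, mul_assoc]
    rw [h1, tau_mul (poly_an _) (g := fun z => z) analyticAt_id, h, tau_id, pow_succ, ← mul_assoc,
      Polynomial.coe_mul _ Polynomial.X, Polynomial.coe_X]

theorem tau_div {f g : ℂ → ℂ} (hf : AnalyticAt ℂ f 0) (hg : AnalyticAt ℂ g 0) (h0 : g 0 ≠ 0) :
    tau (fun z => f z / g z) = tau f * (tau g)⁻¹ := by
  rw [PowerSeries.eq_mul_inv_iff_mul_eq (by rwa [tau_const_coeff])]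
  have := hf.div hg h0
  change AnalyticAt ℂ (fun z => f z / g z) 0 at this
  rw [← tau_mul this hg]
  apply tau_congr
  filter_upwards [hg.continuousAt.eventually_ne h0] with z hz
  simp [hz]

/-- jet in chart i of a tuple of power series -/
noncomputable def jet {n : ℕ} (k : ℕ) (i : Fin n) (a : Fin n → PowerSeries ℂ) :
    {t : Fin n // t ≠ i} × Fin (k + 1) → ℂ :=
  fun p => ((p.2 : ℕ).factorial : ℂ) * PowerSeries.coeff (p.2 : ℕ) (a p.1 * (a i)⁻¹)

theorem jet_tau {n : ℕ} (k : ℕ) (i : Fin n) (f : Fin n → ℂ → ℂ) (hf : ∀ i, AnalyticAt ℂ (f i) 0)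
    (h0 : ∀ i, f i 0 ≠ 0) :
    (fun p : {t : Fin n // t ≠ i} × Fin (k + 1) =>
            iteratedDeriv (p.2 : ℕ) (fun z => f (p.1 : Fin n) z / f i z) 0) =
      jet k i (fun t => tau (f t)) := by
  ext p
  simp only [jet]
  rw [← tau_div (hf _) (hf _) (h0 _)]
  simp only [tau, PowerSeries.coeff_mk]
  rw [mul_div_cancel₀]
  exact_mod_cast Nat.factorial_ne_zero _

/-- polynomial with given coefficients -/
noncomputable def polx {n k : ℕ} (x : Fin n × Fin (k + 1) → ℂ) (t : Fin n) : Polynomial ℂ :=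
  PowerSeries.trunc (k + 1) (ofx x t)

theorem polx_coe {n k : ℕ} (x : Fin n × Fin (k + 1) → ℂ) (t : Fin n) :
    (polx x t : PowerSeries ℂ) = ofx x t := by
  ext l
  rw [Polynomial.coeff_coe, polx, PowerSeries.coeff_trunc]
  simp only [ofx, PowerSeries.coeff_mk]
  split_ifs <;> rfl

/-- functions which are polynomial up to a power of the constant term -/
def RF {n : ℕ} (k : ℕ) (i : Fin n) (φ : (Fin n → PowerSeries ℂ) → ℂ) : Prop :=
  ∃ (M : ℕ) (P : MvPolynomial (Fin n × Fin (k + 1)) ℂ), ∀ a : Fin n → PowerSeries ℂ,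
    PowerSeries.constantCoeff (a i) ≠ 0 →
    eval (pt k a) P = PowerSeries.constantCoeff (a i) ^ M * φ a

theorem pt_zero {n k : ℕ} (a : Fin n → PowerSeries ℂ) (i : Fin n) :
    pt k a (i, 0) = PowerSeries.constantCoeff (a i) := by
  simp [pt]

theorem RF.const {n k : ℕ} {i : Fin n} (c : ℂ) : RF k i (fun _ => c) :=
  ⟨0, C c, fun a _ => by simp⟩

theorem RF.coord {n k : ℕ} {i : Fin n} (t : Fin n) (l : ℕ) (hl : l < k + 1) :
    RF k i (fun a => PowerSeries.coeff l (a t)) :=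
  ⟨0, X (t, ⟨l, hl⟩), fun a _ => by simp [pt]⟩

theorem RF.add {n k : ℕ} {i : Fin n} {φ ψ : (Fin n → PowerSeries ℂ) → ℂ} (h : RF k i φ)
    (h' : RF k i ψ) : RF k i (fun a => φ a + ψ a) := by
  obtain ⟨M, P, hP⟩ := h
  obtain ⟨M', P', hP'⟩ := h'
  refine ⟨M + M', X (i, 0) ^ M' * P + X (i, 0) ^ M * P', fun a ha => ?_⟩
  simp only [map_add, map_mul, map_pow, eval_X, hP a ha, hP' a ha, pt_zero]
  ring

theorem RF.mul {n k : ℕ} {i : Fin n} {φ ψ : (Fin n → PowerSeries ℂ) → ℂ} (h : RF k i φ)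
    (h' : RF k i ψ) : RF k i (fun a => φ a * ψ a) := by
  obtain ⟨M, P, hP⟩ := h
  obtain ⟨M', P', hP'⟩ := h'
  refine ⟨M + M', P * P', fun a ha => ?_⟩
  simp only [map_mul, hP a ha, hP' a ha]
  ring

theorem RF.sum {n k : ℕ} {i : Fin n} {ι : Type} (s : Finset ι)
    (φ : ι → (Fin n → PowerSeries ℂ) → ℂ) (h : ∀ x ∈ s, RF k i (φ x)) :
    RF k i (fun a => ∑ x ∈ s, φ x a) := by
  classical
  induction s using Finset.induction_on with
  | empty => simpa using RF.const 0
  | insert x s hx ih =>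
    simp only [Finset.sum_insert hx]
    exact (h x (Finset.mem_insert_self _ _)).add (ih fun y hy => h y (Finset.mem_insert_of_mem hy))

theorem RF.inv0 {n k : ℕ} {i : Fin n} :
    RF k i (fun a => (PowerSeries.constantCoeff (a i))⁻¹) :=
  ⟨1, 1, fun a ha => by rw [pow_one, mul_inv_cancel₀ ha, map_one]⟩

theorem RF.inv {n k : ℕ} {i : Fin n} (l : ℕ) (hl : l < k + 1) :
    RF k i (fun a => PowerSeries.coeff l (a i)⁻¹) := by
  induction l using Nat.strong_induction_on with
  | _ l ih =>
    by_cases h : l = 0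
    · have e : (fun a : Fin n → PowerSeries ℂ => PowerSeries.coeff l (a i)⁻¹) =
          fun a => (PowerSeries.constantCoeff (a i))⁻¹ := by
        ext a
        rw [PowerSeries.coeff_inv, if_pos h]
      rw [e]
      exact RF.inv0
    · have e : (fun a : Fin n → PowerSeries ℂ => PowerSeries.coeff l (a i)⁻¹) =
          fun a => (-1 : ℂ) * (PowerSeries.constantCoeff (a i))⁻¹ *
        ∑ x ∈ Finset.HasAntidiagonal.antidiagonal l, if x.2 < l then
          PowerSeries.coeff x.1 (a i) * PowerSeries.coeff x.2 (a i)⁻¹ else 0 := by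
        ext a
        rw [PowerSeries.coeff_inv, if_neg h, neg_one_mul]
      have h1 : RF k i (fun a => (-1 : ℂ) * (PowerSeries.constantCoeff (a i))⁻¹ *
        ∑ x ∈ Finset.HasAntidiagonal.antidiagonal l, if x.2 < l then
          PowerSeries.coeff x.1 (a i) * PowerSeries.coeff x.2 (a i)⁻¹ else 0) := by
        refine ((RF.const _).mul RF.inv0).mul (RF.sum _ _ fun x hx => ?_)
        have := Finset.HasAntidiagonal.mem_antidiagonal.1 hx
        split_ifs with h2
        · exact (RF.coord _ _ (by omega)).mul (ih _ h2 (by omega))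
        · exact RF.const 0
      rw [e]
      exact h1

theorem RF.quot {n k : ℕ} {i : Fin n} (t : Fin n) (l : ℕ) (hl : l < k + 1) :
    RF k i (fun a => PowerSeries.coeff l (a t * (a i)⁻¹)) := by
  simp only [PowerSeries.coeff_mul]
  refine RF.sum _ _ fun x hx => ?_
  have := Finset.HasAntidiagonal.mem_antidiagonal.1 hx
  exact (RF.coord _ _ (by omega)).mul (RF.inv _ (by omega))

theorem RF.jet {n k : ℕ} {i : Fin n} (s : MvPolynomial ({t : Fin n // t ≠ i} × Fin (k + 1)) ℂ) :
    RF k i (fun a => eval (GG.jet k i a) s) := by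
  induction s using MvPolynomial.induction_on with
  | C r => simpa using RF.const r
  | add p q hp hq => simpa using hp.add hq
  | mul_X p v hp =>
    simp only [map_mul, eval_X]
    exact hp.mul ((RF.const _).mul (RF.quot _ _ v.2.2))

theorem RF.dep {n k : ℕ} {i : Fin n} {φ : (Fin n → PowerSeries ℂ) → ℂ} (h : RF k i φ)
    (a : Fin n → PowerSeries ℂ) (ha : PowerSeries.constantCoeff (a i) ≠ 0) :
    φ (ofx (pt k a)) = φ a := by
  obtain ⟨M, P, hP⟩ := h
  have h1 := hP a ha
  have hc : PowerSeries.constantCoeff (ofx (pt k a) i) = PowerSeries.constantCoeff (a i) := by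
    rw [ofx_const, pt_zero]
  have h2 := hP (ofx (pt k a)) (by rwa [hc])
  rw [pt_ofx, hc, h1] at h2
  exact (mul_left_cancel₀ (pow_ne_zero _ ha) h2).symm

theorem jet_surj {n k : ℕ} (i : Fin n) (y : {t : Fin n // t ≠ i} × Fin (k + 1) → ℂ)
    (hy : ∀ v, y v ≠ 0) : ∃ x : Fin n × Fin (k + 1) → ℂ, (∀ t, x (t, 0) ≠ 0) ∧ jet k i (ofx x) = y := by
  classical
  let x : Fin n × Fin (k + 1) → ℂ := fun v => if h : v.1 ≠ i then
    y (⟨v.1, h⟩, v.2) / ((v.2 : ℕ).factorial : ℂ) else if v.2 = 0 then 1 else 0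
  refine ⟨x, ?_, ?_⟩
  · intro t
    simp only [x]
    split_ifs with h
    · simpa using hy _
    · simp
  · have h1 : ofx x i = 1 := by
      ext l
      simp only [ofx, x, PowerSeries.coeff_mk, PowerSeries.coeff_one, ne_eq, not_true_eq_false, dite_false]
      by_cases h : l < k + 1
      · rw [dif_pos h]
        congr 1
        simp [Fin.ext_iff]
      · rw [dif_neg h, if_neg (by omega)]
    ext v
    have hp : (1 : PowerSeries ℂ)⁻¹ = 1 := by
      rw [PowerSeries.inv_eq_iff_mul_eq_one] <;> simp
    have h2 := congrFun (pt_ofx x) (v.1.1, v.2)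
    simp only [pt] at h2
    rw [jet, h1, hp, mul_one, h2]
    simp only [x]
    rw [dif_pos v.1.2, mul_div_cancel₀]
    exact_mod_cast Nat.factorial_ne_zero _

/-- dehomogenization in chart i -/
noncomputable def phi {n k : ℕ} (i : Fin n) :
    MvPolynomial (Fin n × Fin (k + 1)) ℂ →ₐ[ℂ] MvPolynomial ({t : Fin n // t ≠ i} × Fin (k + 1)) ℂ :=
  aeval fun v => if h : v.1 ≠ i then
    C ((1 : ℂ) / ((v.2 : ℕ).factorial : ℂ)) * X (⟨v.1, h⟩, v.2) else if v.2 = 0 then 1 else 0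

theorem eval_phi {n k : ℕ} (i : Fin n) (a : Fin n → PowerSeries ℂ)
    (ha : PowerSeries.constantCoeff (a i) ≠ 0) (P : MvPolynomial (Fin n × Fin (k + 1)) ℂ) :
    eval (jet k i a) (phi i P) = eval (pt k fun t => (a i)⁻¹ * a t) P := by
  classical
  rw [phi, eval_aeval]
  congr 2
  ext v
  simp only [pt]
  split_ifs with h h'
  · simp only [map_mul, eval_C, eval_X, jet]
    rw [mul_comm (a v.1), ← mul_assoc, one_div, inv_mul_cancel₀, one_mul]
    exact_mod_cast Nat.factorial_ne_zero _
  · rw [not_not] at h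
    rw [h, PowerSeries.inv_mul_cancel _ ha, h']
    simp
  · rw [not_not] at h
    rw [h, PowerSeries.inv_mul_cancel _ ha, PowerSeries.coeff_one, if_neg, map_zero]
    exact fun e => h' (Fin.ext e)

theorem eval_phi_PP {n k d : ℕ} (i : Fin n) (a : Fin n → PowerSeries ℂ)
    (ha : PowerSeries.constantCoeff (a i) ≠ 0) (P : MvPolynomial (Fin n × Fin (k + 1)) ℂ)
    (hP : P ∈ PP d n k) :
    PowerSeries.constantCoeff (a i) ^ d * eval (jet k i a) (phi i P) = eval (pt k a) P := by
  rw [eval_phi i a ha, inv_of_mem d n k P hP a _ (by simpa using ha), ← mul_assoc, ← mul_pow,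
    PowerSeries.constantCoeff_inv, mul_inv_cancel₀ ha, one_pow, one_mul]

theorem jet_inv {n k : ℕ} (i : Fin n) (a : Fin n → PowerSeries ℂ) (g : PowerSeries ℂ)
    (hg : PowerSeries.constantCoeff g ≠ 0) : jet k i (fun t => g * a t) = jet k i a := by
  ext p
  simp only [jet]
  rw [PowerSeries.mul_inv_rev]
  have := PowerSeries.mul_inv_cancel g hg
  congr 2
  calc g * a p.1 * ((a i)⁻¹ * g⁻¹) = a p.1 * (a i)⁻¹ * (g * g⁻¹) := by ring
    _ = _ := by rw [this, mul_one]

theorem surj_main {n k d : ℕ} (i j : Fin n) (hij : i ≠ j)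
    (s : (i : Fin n) → MvPolynomial ({t : Fin n // t ≠ i} × Fin (k + 1)) ℂ)
    (hs : ∀ x : Fin n × Fin (k + 1) → ℂ, (∀ t, x (t, 0) ≠ 0) → ∀ i j,
      eval (jet k i (ofx x)) (s i) = (x (j, 0) / x (i, 0)) ^ d * eval (jet k j (ofx x)) (s j)) :
    ∃ P ∈ PP d n k, ∀ i, phi i P = s i := by
  obtain ⟨M, P0, h0⟩ := RF.jet (s i)
  obtain ⟨M', P1, h1⟩ := RF.jet (s j)
  beta_reduce at h0 h1
  have hx : X (i, 0) ^ d * (X (j, 0) ^ M' * P0) = X (i, 0) ^ M * (X (j, 0) ^ d * P1) := by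
    apply funext_nz
    intro x hx
    have e0 := h0 (ofx x) (by rw [ofx_const]; exact hx _)
    have e1 := h1 (ofx x) (by rw [ofx_const]; exact hx _)
    have e2 := hs x (fun t => hx _) i j
    rw [pt_ofx, ofx_const] at e0 e1
    simp only [map_mul, map_pow, eval_X]
    rw [e0, e1, e2, div_pow]
    have := hx (i, 0)
    field_simp
  have hdvd : (X (i, 0) : MvPolynomial (Fin n × Fin (k + 1)) ℂ) ^ M ∣ X (i, 0) ^ d * P0 := by
    refine Prime.pow_dvd_of_dvd_mul_left (X_prime (i := (i, 0))) M (a := X (j, 0) ^ M') ?_ ?_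
    · intro h
      have := (X_prime (i := (i, 0))).dvd_of_dvd_pow h
      rw [X_dvd_X] at this
      exact hij (Prod.ext_iff.1 this).1
    · exact ⟨_, by rw [← hx]; ring⟩
  obtain ⟨P, hP⟩ := hdvd
  have key : ∀ a : Fin n → PowerSeries ℂ, PowerSeries.constantCoeff (a i) ≠ 0 →
      eval (pt k a) P = PowerSeries.constantCoeff (a i) ^ d * eval (jet k i a) (s i) := by
    intro a ha
    have e := congrArg (eval (pt k a)) hP
    simp only [map_mul, map_pow, eval_X, pt_zero, h0 a ha] at e
    apply mul_left_cancel₀ (pow_ne_zero M ha)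
    rw [← e]
    ring
  have hPP : P ∈ PP d n k := by
    apply mem_of_inv
    intro a g ha hg
    rw [key a (ha i), key _ (by simp [ha i, hg]), jet_inv i a g hg, map_mul, mul_pow, mul_assoc]
  refine ⟨P, hPP, fun r => ?_⟩
  apply funext_nz
  intro y hy
  obtain ⟨x, hx0, rfl⟩ := jet_surj r y hy
  have e1 := eval_phi_PP r (ofx x) (by rw [ofx_const]; exact hx0 _) P hPP
  have e2 := key (ofx x) (by rw [ofx_const]; exact hx0 _)
  have e3 := hs x hx0 i r
  rw [e2, e3, ofx_const, ofx_const] at e1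
  apply mul_left_cancel₀ (pow_ne_zero d (hx0 r))
  rw [e1, div_pow]
  have := hx0 i
  field_simp

theorem phi_inj {n k d : ℕ} (i : Fin n) (P : MvPolynomial (Fin n × Fin (k + 1)) ℂ)
    (hP : P ∈ PP d n k) (h : phi i P = 0) : P = 0 := by
  apply funext_nz
  intro x hx
  have := eval_phi_PP i (ofx x) (by rw [ofx_const]; exact hx _) P hP
  rw [h, map_zero, mul_zero, pt_ofx] at this
  rw [← this, map_zero]

end GG


/-- for d ≥ 1, N ≥ 1, k ≥ d - 1, the space of global (polynomial)
sections of ⊕_n E^{GG}_{k,n} ⊗ O(d) over ℙ^N(ℂ) has dimension (N+1)^d. A section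
is a tuple (s_i)_{i=0..N}, where s_i is a polynomial in the jet variables
(X_t/X_i)^{(l)}, t ≠ i, 0 ≤ l ≤ k, of the affine chart U_i, subject to the
transition rules: for every holomorphic curve [f_0 : ... : f_N] avoiding the
coordinate hyperplanes at 0, the value of s_i on the k-jet of the chart-i
coordinates equals (f_j(0)/f_i(0))^d times the value of s_j on the k-jet of the
chart-j coordinates. The dimension is expressed by a linearly independent family
of (N+1)^d sections spanning the space of sections. -/
theorem stmt_16 (N d k : ℕ) (hN : 1 ≤ N) (hd : 1 ≤ d) (hk : d - 1 ≤ k) :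
    let Sec := (i : Fin (N + 1)) →
      MvPolynomial ({t : Fin (N + 1) // t ≠ i} × Fin (k + 1)) ℂ
    let S : Set Sec :=
      {s | ∀ f : Fin (N + 1) → ℂ → ℂ,
        (∀ i, AnalyticAt ℂ (f i) 0) → (∀ i, f i 0 ≠ 0) →
        ∀ i j : Fin (N + 1),
          (MvPolynomial.aeval fun p : {t : Fin (N + 1) // t ≠ i} × Fin (k + 1) =>
            iteratedDeriv (p.2 : ℕ) (fun z => f (p.1 : Fin (N + 1)) z / f i z) 0) (s i)
          = (f j 0 / f i 0) ^ d *
            (MvPolynomial.aeval fun p : {t : Fin (N + 1) // t ≠ j} × Fin (k + 1) =>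
              iteratedDeriv (p.2 : ℕ) (fun z => f (p.1 : Fin (N + 1)) z / f j z) 0) (s j)}
    ∃ g : Fin ((N + 1) ^ d) → Sec,
      (∀ i, g i ∈ S) ∧ LinearIndependent ℂ g ∧
      ∀ s ∈ S, s ∈ Submodule.span ℂ (Set.range g) := by
  intro Sec S
  have hk' : d ≤ k + 1 := by omega
  have hfr := GG.PP_finrank d (N + 1) k hk'
  have : Module.Finite ℂ (GG.PP d (N + 1) k) :=
    Module.finite_of_finrank_pos (by rw [hfr]; positivity)
  let b := Module.finBasisOfFinrankEq ℂ (GG.PP d (N + 1) k) hfr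
  let Φ : GG.PP d (N + 1) k →ₗ[ℂ] Sec :=
    LinearMap.pi fun i => (GG.phi i).toLinearMap.comp (GG.PP d (N + 1) k).subtype
  have hΦ : ∀ P i, Φ P i = GG.phi i P.1 := fun P i => rfl
  have hS : ∀ (s : Sec), s ∈ S ↔ ∀ f : Fin (N + 1) → ℂ → ℂ,
        (∀ i, AnalyticAt ℂ (f i) 0) → (∀ i, f i 0 ≠ 0) → ∀ i j : Fin (N + 1),
        MvPolynomial.eval (GG.jet k i (fun t => GG.tau (f t))) (s i) =
        (f j 0 / f i 0) ^ d * MvPolynomial.eval (GG.jet k j (fun t => GG.tau (f t))) (s j) := by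
    intro s
    refine forall_congr' fun f => forall_congr' fun hf => forall_congr' fun h0 =>
      forall_congr' fun i => forall_congr' fun j => ?_
    rw [GG.jet_tau k i f hf h0, GG.jet_tau k j f hf h0, MvPolynomial.aeval_eq_eval, MvPolynomial.aeval_eq_eval]
  have hker : LinearMap.ker Φ = ⊥ := by
    rw [LinearMap.ker_eq_bot']
    intro P hP
    exact Subtype.ext (GG.phi_inj 0 P.1 P.2 (congrFun hP 0))
  refine ⟨fun r => Φ (b r), ?_, ?_, ?_⟩
  · intro r
    rw [hS]
    intro f hf h0 i j
    have e1 := GG.eval_phi_PP i (fun t => GG.tau (f t)) (by rw [GG.tau_const_coeff]; exact h0 i) (b r).1 (b r).2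
    have e2 := GG.eval_phi_PP j (fun t => GG.tau (f t)) (by rw [GG.tau_const_coeff]; exact h0 j) (b r).1 (b r).2
    rw [← e2, GG.tau_const_coeff, GG.tau_const_coeff] at e1
    simp only [hΦ]
    apply mul_left_cancel₀ (pow_ne_zero d (h0 i))
    rw [e1, div_pow]
    have := h0 i
    field_simp
  · exact b.linearIndependent.map' Φ hker
  · intro s hs
    rw [hS] at hs
    have h01 : (0 : Fin (N + 1)) ≠ ⟨1, by omega⟩ := by
      intro h
      simpa using congrArg Fin.val h
    obtain ⟨P, hP, hPs⟩ := GG.surj_main (d := d) 0 ⟨1, by omega⟩ h01 s (by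
      intro x hx i j
      have hx' : ∀ t, (GG.polx x t).eval 0 = x (t, 0) := by
        intro t
        rw [← GG.ofx_const x t, ← GG.polx_coe, ← GG.tau_poly, GG.tau_const_coeff]
      have := hs (fun t z => (GG.polx x t).eval z) (fun t => GG.poly_an _)
        (fun t => by rw [hx']; exact hx t) i j
      simp only [GG.tau_poly, GG.polx_coe, hx'] at this
      exact this)
    have hs' : s = Φ ⟨P, hP⟩ := by
      funext i
      exact (hPs i).symm
    have hr : Set.range (fun r => Φ (b r)) = Φ '' Set.range b := by
      rw [← Set.range_comp]; rfl
    rw [hs', hr, Submodule.span_image, b.span_eq]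
    exact Submodule.mem_map_of_mem trivial
end

section
/- The space V_d^{diff} of differentially homogeneous polynomials of degree d in the jet variables X_0^{(l)}, ..., X_N^{(l)} has dimension (N+1)^d (Schmidt–Kolchin–Reinhart conjecture). -/
open scoped Pointwise in
theorem sk_span_aux (R : Type) [CommRing R] (d : ℕ) :
    ∀ (K : Type) [CommRing K] [Algebra K R] (x : Fin d → R) (g : Polynomial K),
      g.Monic → g.natDegree = d →
      g.map (algebraMap K R) = ∏ j, (Polynomial.X - Polynomial.C (x j)) →
      Algebra.adjoin K (Set.range x) = ⊤ →
      ∃ (ι : Type) (_ : Fintype ι) (s : ι → R), Fintype.card ι = d.factorial ∧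
        Submodule.span K (Set.range s) = ⊤ := by
  induction d with
  | zero =>
    intro K _ _ x g _ _ _ hadj
    refine ⟨Unit, inferInstance, fun _ => 1, by simp, ?_⟩
    have h1 : Set.range x = ∅ := by simp
    rw [h1, Algebra.adjoin_empty] at hadj
    have h2 : Set.range (fun _ : Unit => (1 : R)) = {1} := by simp
    rw [h2, ← Submodule.one_eq_span, ← Algebra.toSubmodule_bot, hadj, Algebra.top_toSubmodule]
  | succ d ih =>
    intro K _ _ x g hg hdeg hmap hadj
    let K' := Algebra.adjoin K ({x 0} : Set R)
    have hx0 : x 0 ∈ K' := Algebra.subset_adjoin (by simp)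
    let y : K' := ⟨x 0, hx0⟩
    have hinj : Function.Injective (algebraMap K' R) := Subtype.val_injective
    have hroot : Polynomial.aeval (x 0) g = 0 := by
      rw [← Polynomial.eval_map_algebraMap, hmap, Fin.prod_univ_succ]
      simp
    have hroot' : (g.map (algebraMap K K')).IsRoot y := by
      apply hinj
      rw [map_zero, ← Polynomial.eval_map_apply, Polynomial.map_map, ← IsScalarTower.algebraMap_eq]
      rw [Polynomial.eval_map_algebraMap]
      exact hroot
    obtain ⟨g', hg'⟩ := Polynomial.dvd_iff_isRoot.2 hroot'
    have hg'map : g'.map (algebraMap K' R) = ∏ j : Fin d, (Polynomial.X - Polynomial.C (x j.succ)) := by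
      have h1 := congrArg (Polynomial.map (algebraMap K' R)) hg'
      rw [Polynomial.map_map, ← IsScalarTower.algebraMap_eq, hmap, Fin.prod_univ_succ,
        Polynomial.map_mul, Polynomial.map_sub, Polynomial.map_X, Polynomial.map_C] at h1
      exact ((Polynomial.monic_X_sub_C (x 0)).isRegular.left h1).symm
    have hg'mon : g'.Monic := by
      apply Polynomial.monic_of_injective hinj
      rw [hg'map]
      exact Polynomial.monic_prod_of_monic _ _ fun j _ => Polynomial.monic_X_sub_C _
    cases subsingleton_or_nontrivial R with
    | inl hs =>
      refine ⟨Fin (d+1).factorial, inferInstance, fun _ => 0, by simp, ?_⟩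
      exact Subsingleton.elim _ _
    | inr hn =>
    have hg'deg : g'.natDegree = d := by
      rw [← Polynomial.natDegree_map_eq_of_injective hinj, hg'map,
        Polynomial.natDegree_prod_of_monic _ _ fun j _ => Polynomial.monic_X_sub_C _]
      simp
    have hadj' : Algebra.adjoin K' (Set.range fun j : Fin d => x j.succ) = ⊤ := by
      have h1 : Set.range x = {x 0} ∪ Set.range (fun j : Fin d => x j.succ) := by
        rw [← Set.insert_eq, ← Fin.range_cons (x 0)]
        congr 1
        exact (Fin.cons_self_tail x).symm
      rw [h1, Algebra.adjoin_union_eq_adjoin_adjoin] at hadj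
      rw [eq_top_iff]
      intro r _
      have : r ∈ (⊤ : Subalgebra K R) := trivial
      rw [← hadj] at this
      exact this
    obtain ⟨ι, hι, s, hcard, hs⟩ := ih K' _ g' hg'mon hg'deg hg'map hadj'
    have hpow : Submodule.span K (Set.range fun i : Fin (d+1) => y ^ (i : ℕ)) = ⊤ := by
      rw [eq_top_iff]
      rintro ⟨r, hr⟩ -
      have hr2 := hr
      change r ∈ Algebra.adjoin K ({x 0} : Set R) at hr2
      rw [Algebra.adjoin_singleton_eq_range_aeval] at hr2
      obtain ⟨p, hp⟩ := hr2
      have hp2 : Polynomial.aeval y (p %ₘ g) = ⟨r, hr⟩ := by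
        apply hinj
        rw [← Polynomial.aeval_algebraMap_apply]
        change Polynomial.aeval (x 0) (p %ₘ g) = r
        rw [Polynomial.aeval_modByMonic_eq_self_of_root hroot]
        exact hp
      rw [← hp2]
      have hlt : (p %ₘ g).natDegree < d + 1 := by
        rw [← hdeg]
        apply Polynomial.natDegree_modByMonic_lt _ hg
        rintro rfl
        simp at hdeg
      rw [Polynomial.aeval_eq_sum_range' hlt]
      refine Submodule.sum_mem _ fun i hi => Submodule.smul_mem _ _ (Submodule.subset_span ?_)
      exact ⟨⟨i, Finset.mem_range.1 hi⟩, rfl⟩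
    refine ⟨Fin (d+1) × ι, inferInstance, fun q => y ^ (q.1 : ℕ) • s q.2, ?_, ?_⟩
    · simp [hcard, Nat.factorial_succ]
    · have h3 := Submodule.span_smul_of_span_eq_top hpow (Set.range s)
      rw [hs] at h3
      have h4 : (Set.range fun i : Fin (d+1) => y ^ (i : ℕ)) • Set.range s
          = Set.range (fun q : Fin (d+1) × ι => y ^ (q.1 : ℕ) • s q.2) := by
        ext r
        simp [Set.mem_smul]
      rw [h4] at h3
      rw [h3]
      rfl

theorem sk_orbit (K : Type) [CommRing K] [IsDomain K] (d : ℕ) (b : Fin d → K)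
    (hb : Function.Injective b) (p : MvPolynomial (Fin d) K)
    (hp : ∀ σ : Equiv.Perm (Fin d), MvPolynomial.eval (b ∘ σ) p = 0) :
    p ∈ Ideal.span (Set.range fun k : ℕ => MvPolynomial.esymm (Fin d) K (k+1)
      - MvPolynomial.C (MvPolynomial.eval b (MvPolynomial.esymm (Fin d) K (k+1)))) := by
  classical
  set J := Ideal.span (Set.range fun k : ℕ => MvPolynomial.esymm (Fin d) K (k+1)
      - MvPolynomial.C (MvPolynomial.eval b (MvPolynomial.esymm (Fin d) K (k+1)))) with hJ
  have hJev : ∀ (σ : Equiv.Perm (Fin d)) (r), r ∈ J → MvPolynomial.eval (b ∘ σ) r = 0 := by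
    intro σ r hr
    have : J ≤ RingHom.ker (MvPolynomial.eval (b ∘ σ)) := by
      rw [hJ, Ideal.span_le]
      rintro _ ⟨k, rfl⟩
      simp only [SetLike.mem_coe, RingHom.mem_ker, map_sub, MvPolynomial.eval_C]
      rw [← MvPolynomial.eval_rename, MvPolynomial.rename_esymm, sub_self]
    exact this hr
  let R := MvPolynomial (Fin d) K ⧸ J
  let mk : MvPolynomial (Fin d) K →ₐ[K] R := Ideal.Quotient.mkₐ K J
  have hmks : Function.Surjective mk := Ideal.Quotient.mkₐ_surjective K J
  have hmk0 : ∀ r, mk r = 0 ↔ r ∈ J := fun r => Ideal.Quotient.eq_zero_iff_mem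
  have hes : ∀ k, mk (MvPolynomial.esymm (Fin d) K k)
      = algebraMap K R (MvPolynomial.eval b (MvPolynomial.esymm (Fin d) K k)) := by
    intro k
    have h1 : algebraMap K R (MvPolynomial.eval b (MvPolynomial.esymm (Fin d) K k))
        = mk (MvPolynomial.C (MvPolynomial.eval b (MvPolynomial.esymm (Fin d) K k))) := by
      rw [← MvPolynomial.algebraMap_eq, AlgHom.commutes]
    rw [h1, ← sub_eq_zero, ← map_sub, hmk0]
    cases k with
    | zero => simp [MvPolynomial.esymm_zero]
    | succ k => exact Ideal.subset_span ⟨k, rfl⟩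
  obtain ⟨ι, hι, s, hcard, hs⟩ := sk_span_aux R d K (fun j => - mk (MvPolynomial.X j))
    (∏ j, (Polynomial.X + Polynomial.C (b j)))
    (Polynomial.monic_prod_of_monic _ _ fun j _ => Polynomial.monic_X_add_C _)
    (by
      rw [Polynomial.natDegree_prod_of_monic _ _ fun j _ => Polynomial.monic_X_add_C _]
      simp)
    (by
      have h1 := MvPolynomial.prod_C_add_X_eq_sum_esymm K (Fin d)
      have h2 := congrArg (Polynomial.map (mk : MvPolynomial (Fin d) K →+* R)) h1
      have h3 := congrArg (Polynomial.map (algebraMap K R))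
        (congrArg (Polynomial.map (MvPolynomial.eval b)) h1)
      simp only [Polynomial.map_prod, Polynomial.map_add, Polynomial.map_X, Polynomial.map_C,
        Polynomial.map_sum, Polynomial.map_mul, Polynomial.map_pow, RingHom.coe_coe, hes,
        MvPolynomial.eval_X] at h2 h3
      simp only [Polynomial.map_prod, Polynomial.map_add, Polynomial.map_X, Polynomial.map_C,
        map_neg, sub_neg_eq_add]
      rw [h2, h3])
    (by
      rw [eq_top_iff]
      rintro r -
      obtain ⟨q, rfl⟩ := hmks r
      induction q using MvPolynomial.induction_on with
      | C c =>
        rw [← MvPolynomial.algebraMap_eq, AlgHom.commutes]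
        exact Subalgebra.algebraMap_mem _ _
      | add p q hp hq => rw [map_add]; exact Subalgebra.add_mem _ hp hq
      | mul_X p j hp =>
        rw [map_mul]
        refine Subalgebra.mul_mem _ hp ?_
        rw [← neg_neg (mk (MvPolynomial.X j))]
        exact Subalgebra.neg_mem _ (Algebra.subset_adjoin ⟨j, rfl⟩))
  have e : Equiv.Perm (Fin d) ≃ ι := Fintype.equivOfCardEq (by
    rw [hcard, Fintype.card_perm, Fintype.card_fin])
  choose s' hs' using fun i => hmks (s (e i))
  have hspan : ∀ q : MvPolynomial (Fin d) K, ∃ c : Equiv.Perm (Fin d) → K,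
      q - ∑ i, MvPolynomial.C (c i) * s' i ∈ J := by
    intro q
    have h1 : mk q ∈ Submodule.span K (Set.range s) := by rw [hs]; trivial
    obtain ⟨c, hc⟩ := (Submodule.mem_span_range_iff_exists_fun K).1 h1
    refine ⟨fun i => c (e i), ?_⟩
    rw [← hmk0, map_sub, map_sum, sub_eq_zero, ← hc, ← Equiv.sum_comp e]
    refine Finset.sum_congr rfl fun i _ => ?_
    rw [← MvPolynomial.smul_eq_C_mul, map_smul, hs']
  let v : Equiv.Perm (Fin d) → MvPolynomial (Fin d) K := fun σ =>
    ∏ j, ∏ i ∈ Finset.univ.erase (σ j), (MvPolynomial.X j - MvPolynomial.C (b i))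
  choose N hN using fun σ => hspan (v σ)
  let M : Matrix (Equiv.Perm (Fin d)) (Equiv.Perm (Fin d)) K :=
    fun τ i => MvPolynomial.eval (b ∘ τ) (s' i)
  have hMN : M * (Matrix.of N).transpose
      = Matrix.diagonal fun σ : Equiv.Perm (Fin d) => MvPolynomial.eval (b ∘ σ) (v σ) := by
    ext τ σ
    have h1 := hJev τ _ (hN σ)
    rw [map_sub, sub_eq_zero] at h1
    rw [Matrix.mul_apply]
    have h2 : ∑ j, M τ j * (Matrix.of N).transpose j σ = MvPolynomial.eval (b ∘ τ) (v σ) := by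
      rw [h1, map_sum]
      refine Finset.sum_congr rfl fun i _ => ?_
      simp [M, mul_comm]
    rw [h2]
    by_cases hτ : τ = σ
    · subst hτ; simp
    · rw [Matrix.diagonal_apply_ne _ hτ]
      obtain ⟨j, hj⟩ : ∃ j, τ j ≠ σ j := by
        by_contra hcon
        push Not at hcon
        exact hτ (Equiv.ext hcon)
      rw [map_prod]
      apply Finset.prod_eq_zero (Finset.mem_univ j)
      rw [map_prod]
      apply Finset.prod_eq_zero (i := τ j) (by simp [hj])
      simp
  have hdet : M.det ≠ 0 := by
    intro h0
    have h1 := congrArg Matrix.det hMN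
    rw [Matrix.det_mul, h0, zero_mul, Matrix.det_diagonal] at h1
    refine Finset.prod_ne_zero_iff.2 (fun σ _ => ?_) h1.symm
    simp only [v, map_prod]
    refine Finset.prod_ne_zero_iff.2 fun j _ => Finset.prod_ne_zero_iff.2 fun i hi => ?_
    simp only [map_sub, MvPolynomial.eval_X, MvPolynomial.eval_C, Function.comp]
    rw [sub_ne_zero]
    intro h
    have := hb h
    simp [this] at hi
  obtain ⟨c, hc⟩ := hspan p
  have hMc : M.mulVec c = 0 := by
    ext τ
    have h1 := hJev τ _ hc
    rw [map_sub, hp, zero_sub, neg_eq_zero] at h1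
    rw [Pi.zero_apply, ← h1, map_sum, Matrix.mulVec, dotProduct]
    refine Finset.sum_congr rfl fun i _ => ?_
    simp [M, mul_comm]
  have hc0 := Matrix.eq_zero_of_mulVec_eq_zero hdet hMc
  simpa [hc0] using hc

theorem sk_homog_eval (d k : ℕ) (a : Fin d → ℂ) (φ : MvPolynomial (Fin d) ℂ)
    (h : φ.IsHomogeneous k) :
    MvPolynomial.eval (fun j => Polynomial.C (a j) * Polynomial.X)
      (MvPolynomial.map (Polynomial.C : ℂ →+* Polynomial ℂ) φ)
      = Polynomial.C (MvPolynomial.eval a φ) * Polynomial.X ^ k := by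
  rw [MvPolynomial.eval_map, MvPolynomial.eval₂_eq', MvPolynomial.eval_eq', map_sum,
    Finset.sum_mul]
  refine Finset.sum_congr rfl fun l hl => ?_
  have h1 : ∑ j, l j = k := by
    rw [← Finsupp.degree_eq_sum]
    rw [Finsupp.degree_eq_weight_one]
    exact h (MvPolynomial.mem_support_iff.1 hl)
  simp only [mul_pow, Finset.prod_mul_distrib, Finset.prod_pow_eq_pow_sum, h1, map_mul, map_prod,
    map_pow]
  ring

theorem sk_top (d : ℕ) (a : Fin d → ℂ) (ha : Function.Injective a) (m : ℕ)
    (q : MvPolynomial (Fin d) ℂ) (hq : q.totalDegree ≤ m)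
    (hv : ∀ σ : Equiv.Perm (Fin d), MvPolynomial.eval (a ∘ σ) q = 0) :
    MvPolynomial.homogeneousComponent m q ∈
      Ideal.span (Set.range fun k : ℕ => MvPolynomial.esymm (Fin d) ℂ (k+1)) := by
  let b : Fin d → Polynomial ℂ := fun j => Polynomial.C (a j) * Polynomial.X
  have hb : Function.Injective b := by
    intro i j hij
    have := congrArg (Polynomial.eval 1) hij
    simp only [b, Polynomial.eval_mul, Polynomial.eval_C, Polynomial.eval_X, mul_one] at this
    exact ha this
  let p : MvPolynomial (Fin d) (Polynomial ℂ) := ∑ k ∈ Finset.range (m+1),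
    MvPolynomial.C (Polynomial.X ^ (m - k)) * MvPolynomial.map (Polynomial.C : ℂ →+* Polynomial ℂ)
      (MvPolynomial.homogeneousComponent k q)
  have hsum : ∑ k ∈ Finset.range (m+1), MvPolynomial.homogeneousComponent k q = q := by
    have h0 := MvPolynomial.sum_homogeneousComponent q
    rw [← Finset.sum_subset (Finset.range_mono (Nat.succ_le_succ hq))]
    · exact h0
    · intro k _ hk
      apply MvPolynomial.homogeneousComponent_eq_zero
      simpa [Nat.lt_succ_iff] using hk
  have hp : ∀ σ : Equiv.Perm (Fin d), MvPolynomial.eval (b ∘ σ) p = 0 := by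
    intro σ
    have h1 : MvPolynomial.eval (b ∘ σ) p
        = Polynomial.C (MvPolynomial.eval (a ∘ σ) q) * Polynomial.X ^ m := by
      conv_rhs => rw [← hsum]
      simp only [p, map_sum, Finset.sum_mul]
      refine Finset.sum_congr rfl fun k hk => ?_
      have h2 := sk_homog_eval d k (a ∘ σ) _ (MvPolynomial.homogeneousComponent_isHomogeneous k q)
      have h3 : b ∘ σ = fun j => Polynomial.C ((a ∘ σ) j) * Polynomial.X := rfl
      rw [map_mul, MvPolynomial.eval_C, h3, h2]
      have h4 : m = (m - k) + k := by
        have := Finset.mem_range.1 hk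
        omega
      conv_rhs => rw [h4, pow_add]
      ring
    rw [h1, hv]
    simp
  have h1 := sk_orbit (Polynomial ℂ) d b hb p hp
  have h2 := Ideal.mem_map_of_mem (MvPolynomial.map (Polynomial.evalRingHom (0:ℂ))) h1
  have h3 : MvPolynomial.map (Polynomial.evalRingHom (0:ℂ)) p
      = MvPolynomial.homogeneousComponent m q := by
    simp only [p, map_sum, map_mul, MvPolynomial.map_map, MvPolynomial.map_C, map_pow]
    rw [Finset.sum_range_succ, Finset.sum_eq_zero]
    · have : (Polynomial.evalRingHom (0:ℂ)).comp Polynomial.C = RingHom.id ℂ := by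
        ext x; simp
      rw [this, MvPolynomial.map_id]
      simp
    · intro k hk
      have : m - k ≠ 0 := by
        have := Finset.mem_range.1 hk
        omega
      simp [this]
  rw [h3, Ideal.map_span] at h2
  refine (Ideal.span_le.2 ?_) h2
  rintro _ ⟨_, ⟨k, rfl⟩, rfl⟩
  have h5 : Polynomial.evalRingHom (0:ℂ) (MvPolynomial.eval b
      (MvPolynomial.esymm (Fin d) (Polynomial ℂ) (k+1))) = 0 := by
    rw [MvPolynomial.esymm]
    simp only [map_sum, map_prod, MvPolynomial.eval_X, b]
    refine Finset.sum_eq_zero fun t ht => ?_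
    obtain ⟨j, hj⟩ : t.Nonempty := by
      rw [← Finset.card_pos, (Finset.mem_powersetCard.1 ht).2]; omega
    exact Finset.prod_eq_zero hj (by simp)
  simp only [map_sub, MvPolynomial.map_C, h5, map_zero, sub_zero, MvPolynomial.map_esymm]
  exact Ideal.subset_span ⟨k, rfl⟩

theorem sk_functional (d : ℕ) (a : Fin d → ℂ) (ha : Function.Injective a) (m : ℕ)
    (lam : MvPolynomial (Fin d) ℂ →ₗ[ℂ] ℂ)
    (hl : ∀ p k, lam (p * MvPolynomial.esymm (Fin d) ℂ (k+1)) = 0) :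
    ∃ c : Equiv.Perm (Fin d) → ℂ, ∀ l : Fin d →₀ ℕ,
      (l.degree = m → lam (MvPolynomial.monomial l 1) = ∑ σ, c σ * ∏ j, a (σ j) ^ l j) ∧
      (l.degree < m → ∑ σ, c σ * ∏ j, a (σ j) ^ l j = 0) := by
  let E := MvPolynomial.restrictTotalDegree (Fin d) ℂ m
  let L : Equiv.Perm (Fin d) → E →ₗ[ℂ] ℂ := fun σ =>
    ((MvPolynomial.aeval (a ∘ σ) : MvPolynomial (Fin d) ℂ →ₐ[ℂ] ℂ).toLinearMap).domRestrict E
  let Kf : E →ₗ[ℂ] ℂ := (lam ∘ₗ MvPolynomial.homogeneousComponent m).domRestrict E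
  have hker : ⨅ i, (L i).ker ≤ Kf.ker := by
    rintro ⟨q, hq⟩ hq2
    rw [MvPolynomial.mem_restrictTotalDegree] at hq
    simp only [Submodule.mem_iInf, LinearMap.mem_ker] at hq2
    have h1 := sk_top d a ha m q hq (fun σ => by
      have := hq2 σ
      simpa [L, MvPolynomial.aeval_eq_eval] using this)
    rw [LinearMap.mem_ker]
    change lam (MvPolynomial.homogeneousComponent m q) = 0
    generalize MvPolynomial.homogeneousComponent m q = r at h1
    have h2 : ∀ p, lam (p * r) = 0 := by
      induction h1 using Submodule.span_induction with
      | mem x hx =>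
        obtain ⟨k, rfl⟩ := hx
        intro p
        exact hl p k
      | zero => simp
      | add x y _ _ hx hy => intro p; rw [mul_add, map_add, hx, hy, add_zero]
      | smul q x _ hx => intro p; rw [smul_eq_mul, ← mul_assoc]; exact hx _
    simpa using h2 1
  obtain ⟨c, hc⟩ := (Submodule.mem_span_range_iff_exists_fun ℂ).1 (mem_span_of_iInf_ker_le_ker hker)
  have key : ∀ l : Fin d →₀ ℕ, l.degree ≤ m →
      lam (MvPolynomial.homogeneousComponent m (MvPolynomial.monomial l 1))
        = ∑ σ, c σ * ∏ j, a (σ j) ^ l j := by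
    intro l hlm
    have hmem : MvPolynomial.monomial l (1:ℂ) ∈ E := by
      rw [MvPolynomial.mem_restrictTotalDegree]
      rw [MvPolynomial.totalDegree_monomial _ one_ne_zero]
      exact hlm
    have h1 := congrArg (fun f : E →ₗ[ℂ] ℂ => f ⟨_, hmem⟩) hc
    simp only [LinearMap.sum_apply, LinearMap.smul_apply] at h1
    change _ = lam (MvPolynomial.homogeneousComponent m (MvPolynomial.monomial l 1)) at h1
    rw [← h1]
    refine Finset.sum_congr rfl fun σ _ => ?_
    simp [L, MvPolynomial.aeval_monomial, Finsupp.prod_fintype]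
  refine ⟨c, fun l => ⟨fun h => ?_, fun h => ?_⟩⟩
  · rw [← key l h.le, MvPolynomial.homogeneousComponent_of_mem
      (MvPolynomial.isHomogeneous_monomial _ h), if_pos rfl]
  · rw [← key l h.le, MvPolynomial.homogeneousComponent_of_mem
      (MvPolynomial.isHomogeneous_monomial _ rfl), if_neg h.ne', map_zero]

theorem sk_linalg {U V : Type} [AddCommGroup U] [Module ℂ U] [FiniteDimensional ℂ U]
    [AddCommGroup V] [Module ℂ V] (φ : ℕ → U →ₗ[ℂ] V) (ρ : ℕ → V →ₗ[ℂ] V)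
    (h1 : ∀ m u, ρ m (φ m u) = φ m u) (h2 : ∀ m k u, k ≠ m → ρ m (φ k u) = 0)
    (h3 : ∀ u, (∀ k, φ k u = 0) → u = 0)
    (F : ℕ → Submodule ℂ U) (hF : ∀ m u, u ∈ F m ↔ ∀ k < m, φ k u = 0) :
    FiniteDimensional ℂ (⨆ m, (F m).map (φ m) : Submodule ℂ V) ∧
      Module.finrank ℂ (⨆ m, (F m).map (φ m) : Submodule ℂ V) = Module.finrank ℂ U := by
  have hanti : Antitone F := by
    intro i j hij u hu
    rw [hF] at hu ⊢
    exact fun k hk => hu k (lt_of_lt_of_le hk hij)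
  obtain ⟨M, hM⟩ := monotone_stabilizes_iff_artinian.2 (inferInstance : IsArtinian ℂ U)
    ⟨F, hanti⟩
  have hFM : ∀ k, M ≤ k → F k = ⊥ := by
    intro k hk
    have e1 : F M = F k := hM k hk
    rw [← e1, eq_bot_iff]
    intro u hu
    rw [Submodule.mem_bot]
    apply h3
    intro j
    have e2 : F M = F (M + j + 1) := hM (M + j + 1) (by omega)
    rw [e2, hF] at hu
    exact hu j (by omega)
  let W : ℕ → Submodule ℂ V := fun m => ⨆ k ∈ Finset.range m, (F k).map (φ k)
  have hW : ∀ m, W (m+1) = W m ⊔ (F m).map (φ m) := by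
    intro m
    simp only [W, Finset.range_add_one, Finset.iSup_insert]
    rw [sup_comm]
  have hρ : ∀ m, ∀ v ∈ W m, ρ m v = 0 := by
    intro m v hv
    have : W m ≤ LinearMap.ker (ρ m) := by
      refine iSup₂_le fun k hk => ?_
      rintro _ ⟨u, hu, rfl⟩
      exact h2 m k u (Finset.mem_range.1 hk).ne
    exact this hv
  have main : ∀ m, FiniteDimensional ℂ (W m) ∧
      Module.finrank ℂ (W m) + Module.finrank ℂ (F m) = Module.finrank ℂ U := by
    intro m
    induction m with
    | zero =>
      have hw : W 0 = ⊥ := by simp [W]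
      have hf : F 0 = ⊤ := by
        rw [eq_top_iff]
        intro u _
        rw [hF]
        intro k hk
        omega
      rw [hw, hf]
      refine ⟨inferInstance, ?_⟩
      simp
    | succ m ih =>
      obtain ⟨ih1, ih2⟩ := ih
      have hdisj : W m ⊓ (F m).map (φ m) = ⊥ := by
        rw [eq_bot_iff]
        rintro v ⟨hv1, ⟨u, hu, rfl⟩⟩
        rw [Submodule.mem_bot, ← h1]
        exact hρ m _ hv1
      have hfd : FiniteDimensional ℂ ((F m).map (φ m)) := inferInstance
      refine ⟨by rw [hW]; infer_instance, ?_⟩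
      have e1 := Submodule.finrank_sup_add_finrank_inf_eq (W m) ((F m).map (φ m))
      rw [hdisj, finrank_bot, ← hW] at e1
      have e2 := LinearMap.finrank_range_add_finrank_ker ((φ m).domRestrict (F m))
      rw [LinearMap.range_domRestrict] at e2
      have e3 : Module.finrank ℂ (LinearMap.ker ((φ m).domRestrict (F m)))
          = Module.finrank ℂ (F (m+1)) := by
        have : F (m+1) = (LinearMap.ker ((φ m).domRestrict (F m))).map (F m).subtype := by
          ext u
          rw [hF]
          simp only [Submodule.mem_map, LinearMap.mem_ker, Submodule.subtype_apply]
          constructor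
          · intro h
            exact ⟨⟨u, (hF m u).2 fun k hk => h k (by omega)⟩, h m (by omega), rfl⟩
          · rintro ⟨⟨u', hu'⟩, hz, rfl⟩ k hk
            rcases Nat.lt_succ_iff_lt_or_eq.1 hk with h | rfl
            · exact (hF m u').1 hu' k h
            · exact hz
        rw [this]
        exact (LinearEquiv.finrank_eq (Submodule.equivMapOfInjective _
          (Submodule.subtype_injective _) _))
      omega
  have hfin : (⨆ m, (F m).map (φ m) : Submodule ℂ V) = W M := by
    apply le_antisymm
    · refine iSup_le fun k => ?_
      by_cases hk : k < M
      · exact le_iSup₂_of_le k (Finset.mem_range.2 hk) le_rfl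
      · rw [hFM k (not_lt.1 hk), Submodule.map_bot]
        exact bot_le
    · exact iSup₂_le fun k _ => le_iSup (fun m => (F m).map (φ m)) k
  rw [hfin]
  refine ⟨(main M).1, ?_⟩
  have := (main M).2
  rw [hFM M le_rfl, finrank_bot] at this
  simpa using this

noncomputable def skG (N d : ℕ) (a : Fin d → ℂ) (w : Fin d → Fin (N+1)) :
    PowerSeries (MvPolynomial (Fin (N+1) × ℕ) ℂ) :=
  ∏ j, PowerSeries.mk fun l =>
    MvPolynomial.C (a j ^ l / (l.factorial : ℂ)) * MvPolynomial.X (w j, l)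

noncomputable def skPhi (N d : ℕ) (a : Fin d → ℂ) (m : ℕ) :
    ((Fin d → Fin (N+1)) → ℂ) →ₗ[ℂ] MvPolynomial (Fin (N+1) × ℕ) ℂ :=
  Fintype.linearCombination ℂ (fun w => PowerSeries.coeff m (skG N d a w))

theorem skPhi_apply (N d : ℕ) (a : Fin d → ℂ) (m : ℕ) (c : (Fin d → Fin (N+1)) → ℂ) :
    skPhi N d a m c = PowerSeries.coeff m (∑ w, PowerSeries.C (MvPolynomial.C (c w)) * skG N d a w) := by
  simp [skPhi, Fintype.linearCombination_apply, MvPolynomial.smul_eq_C_mul]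

theorem skG_coeff (N d : ℕ) (a : Fin d → ℂ) (w : Fin d → Fin (N+1)) (m : ℕ) :
    PowerSeries.coeff m (skG N d a w) = ∑ l ∈ (Finset.univ : Finset (Fin d)).finsuppAntidiag m,
      MvPolynomial.C (∏ j, a j ^ l j) *
      ∏ j, (MvPolynomial.C (1 / ((l j).factorial : ℂ)) * MvPolynomial.X (w j, l j)) := by
  rw [skG, PowerSeries.coeff_prod]
  refine Finset.sum_congr rfl fun l _ => ?_
  rw [map_prod, ← Finset.prod_mul_distrib]
  refine Finset.prod_congr rfl fun j _ => ?_
  rw [PowerSeries.coeff_mk, ← mul_assoc, ← MvPolynomial.C_mul]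
  congr 2
  ring

theorem skPhi_homog (N d : ℕ) (a : Fin d → ℂ) (m : ℕ) (c : (Fin d → Fin (N+1)) → ℂ) :
    (skPhi N d a m c).IsHomogeneous d := by
  rw [skPhi, Fintype.linearCombination_apply]
  refine MvPolynomial.IsHomogeneous.sum _ _ _ fun w _ => ?_
  rw [skG_coeff, MvPolynomial.smul_eq_C_mul]
  refine MvPolynomial.IsHomogeneous.C_mul ?_ _
  refine MvPolynomial.IsHomogeneous.sum _ _ _ fun l _ => ?_
  refine MvPolynomial.IsHomogeneous.C_mul ?_ _
  have := MvPolynomial.IsHomogeneous.prod Finset.univ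
    (fun j => MvPolynomial.C (1 / ((l j).factorial : ℂ)) * MvPolynomial.X (w j, l j))
    (fun _ => 1) (fun j _ => MvPolynomial.IsHomogeneous.C_mul (MvPolynomial.isHomogeneous_X _ _) _)
  simpa using this

theorem skPhi_weight (N d : ℕ) (a : Fin d → ℂ) (m : ℕ) (c : (Fin d → Fin (N+1)) → ℂ) :
    MvPolynomial.IsWeightedHomogeneous (fun v : Fin (N+1) × ℕ => v.2) (skPhi N d a m c) m := by
  rw [← MvPolynomial.mem_weightedHomogeneousSubmodule]
  rw [skPhi, Fintype.linearCombination_apply]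
  refine Submodule.sum_mem _ fun w _ => Submodule.smul_mem _ _ ?_
  rw [skG_coeff]
  refine Submodule.sum_mem _ fun l hl => ?_
  rw [← MvPolynomial.smul_eq_C_mul]
  refine Submodule.smul_mem _ _ ?_
  rw [MvPolynomial.mem_weightedHomogeneousSubmodule]
  have := MvPolynomial.IsWeightedHomogeneous.prod (w := (fun v : Fin (N+1) × ℕ => v.2)) Finset.univ
    (fun j => MvPolynomial.C (1 / ((l j).factorial : ℂ)) * MvPolynomial.X (w j, l j))
    (fun j => l j) (fun j _ => by
      have := (MvPolynomial.isWeightedHomogeneous_C (R := ℂ) (fun v : Fin (N+1) × ℕ => v.2)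
        (1 / ((l j).factorial : ℂ))).mul
        (MvPolynomial.isWeightedHomogeneous_X ℂ (fun v : Fin (N+1) × ℕ => v.2) (w j, l j))
      simpa using this)
  rwa [(Finset.mem_finsuppAntidiag.1 hl).1] at this

theorem skPhi_inj (N d : ℕ) (a : Fin d → ℂ) (ha : Function.Injective a)
    (c : (Fin d → Fin (N+1)) → ℂ) (h : ∀ m, skPhi N d a m c = 0) : c = 0 := by
  classical
  funext w0
  let f : Fin (N+1) → Polynomial ℂ := fun i =>
    Lagrange.interpolate Finset.univ a (fun j => if w0 j = i then 1 else 0)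
  have hf : ∀ i j, (f i).eval (a j) = if w0 j = i then 1 else 0 := by
    intro i j
    exact Lagrange.eval_interpolate_at_node _ ha.injOn (Finset.mem_univ j)
  have h0 : ∑ w, PowerSeries.C (MvPolynomial.C (c w)) * skG N d a w = 0 := by
    ext1 m
    rw [← skPhi_apply, h, map_zero]
  let θ : MvPolynomial (Fin (N+1) × ℕ) ℂ →ₐ[ℂ] ℂ :=
    MvPolynomial.aeval fun v => (v.2.factorial : ℂ) * (f v.1).coeff v.2
  have h1 := congrArg (PowerSeries.map (θ : MvPolynomial (Fin (N+1) × ℕ) ℂ →+* ℂ)) h0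
  have h2 : ∀ w, PowerSeries.map (θ : MvPolynomial (Fin (N+1) × ℕ) ℂ →+* ℂ) (skG N d a w)
      = ((∏ j, (f (w j)).comp (Polynomial.C (a j) * Polynomial.X) : Polynomial ℂ) : PowerSeries ℂ) := by
    intro w
    rw [skG, map_prod, ← Polynomial.coeToPowerSeries.ringHom_apply, map_prod]
    refine Finset.prod_congr rfl fun j _ => ?_
    ext l
    rw [Polynomial.coeToPowerSeries.ringHom_apply, Polynomial.coeff_coe,
      Polynomial.comp_C_mul_X_coeff]
    have : (l.factorial : ℂ) ≠ 0 := by exact_mod_cast l.factorial_ne_zero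
    simp [θ]
    field_simp
  simp only [map_sum, map_mul, PowerSeries.map_C, h2, map_zero] at h1
  have h3 : (∑ w, Polynomial.C (c w) *
      ∏ j, (f (w j)).comp (Polynomial.C (a j) * Polynomial.X) : Polynomial ℂ) = 0 := by
    apply Polynomial.coe_injective
    rw [← Polynomial.coeToPowerSeries.ringHom_apply, map_sum, Polynomial.coe_zero, ← h1]
    refine Finset.sum_congr rfl fun w _ => ?_
    rw [map_mul, Polynomial.coeToPowerSeries.ringHom_apply,
      Polynomial.coeToPowerSeries.ringHom_apply, Polynomial.coe_C]
    congr 2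
    simp [θ]
  have h4 := congrArg (Polynomial.eval 1) h3
  simp only [Polynomial.eval_finsetSum, Polynomial.eval_mul, Polynomial.eval_C,
    Polynomial.eval_prod, Polynomial.eval_comp, Polynomial.eval_X, mul_one, hf,
    Polynomial.eval_zero] at h4
  rw [Finset.sum_eq_single w0] at h4
  · simpa using h4
  · intro w _ hw
    obtain ⟨j, hj⟩ : ∃ j, w j ≠ w0 j := by
      by_contra hcon
      push Not at hcon
      exact hw (funext hcon)
    rw [Finset.prod_eq_zero (Finset.mem_univ j) (by simp [hj.symm]), mul_zero]
  · simp

noncomputable def skAct (N : ℕ) (Q : Polynomial ℂ) : MvPolynomial (Fin (N + 1) × ℕ) ℂ →ₐ[ℂ]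
    MvPolynomial (Fin (N + 1) × ℕ) (Polynomial ℂ) :=
  MvPolynomial.aeval fun p : Fin (N + 1) × ℕ =>
          (∑ s ∈ Finset.range (p.2 + 1),
            MvPolynomial.C (Polynomial.C ((p.2.choose s : ℂ))
                * (Polynomial.derivative^[s] Q))
              * MvPolynomial.X (p.1, p.2 - s)
            : MvPolynomial (Fin (N + 1) × ℕ) (Polynomial ℂ))

theorem skPhi_mem (N d : ℕ) (a : Fin d → ℂ) (m : ℕ) (c : (Fin d → Fin (N+1)) → ℂ)
    (hc : ∀ k < m, skPhi N d a k c = 0) (Q : Polynomial ℂ) :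
    skAct N Q (skPhi N d a m c) = MvPolynomial.C (Q ^ d)
          * MvPolynomial.map (Polynomial.C : ℂ →+* Polynomial ℂ) (skPhi N d a m c) := by
  let D : PowerSeries (MvPolynomial (Fin (N + 1) × ℕ) (Polynomial ℂ)) :=
    ∏ j, PowerSeries.mk fun s => MvPolynomial.C
      (Polynomial.C (a j ^ s / (s.factorial : ℂ)) * (Polynomial.derivative^[s] Q))
  have hG : ∀ w, PowerSeries.map (skAct N Q : MvPolynomial (Fin (N + 1) × ℕ) ℂ →+*
      MvPolynomial (Fin (N + 1) × ℕ) (Polynomial ℂ)) (skG N d a w) =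
      D * PowerSeries.map (MvPolynomial.map (Polynomial.C : ℂ →+* Polynomial ℂ)) (skG N d a w) := by
    intro w
    simp only [skG, D, map_prod, ← Finset.prod_mul_distrib]
    refine Finset.prod_congr rfl fun j _ => ?_
    ext1 l
    rw [PowerSeries.coeff_mul, Finset.Nat.sum_antidiagonal_eq_sum_range_succ_mk]
    simp only [PowerSeries.coeff_map, PowerSeries.coeff_mk, map_mul, MvPolynomial.map_C,
      MvPolynomial.map_X, RingHom.coe_coe]
    have e1 : skAct N Q (MvPolynomial.X (w j, l)) = ∑ s ∈ Finset.range (l + 1),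
            MvPolynomial.C (Polynomial.C ((l.choose s : ℂ))
                * (Polynomial.derivative^[s] Q))
              * MvPolynomial.X (w j, l - s) := by
      simp [skAct]
    have e2 : ∀ z : ℂ, skAct N Q (MvPolynomial.C z) = MvPolynomial.C (Polynomial.C z) := by
      intro z
      rw [← MvPolynomial.algebraMap_eq, AlgHom.commutes]
      rfl
    rw [e1, e2, Finset.mul_sum]
    refine Finset.sum_congr rfl fun s hs => ?_
    have hsl : s ≤ l := Nat.lt_succ_iff.1 (Finset.mem_range.1 hs)
    have e3 : a j ^ l / (l.factorial : ℂ) * (l.choose s : ℂ)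
        = a j ^ s / (s.factorial : ℂ) * (a j ^ (l - s) / ((l-s).factorial : ℂ)) := by
      rw [Nat.cast_choose ℂ hsl]
      have f1 : (l.factorial : ℂ) ≠ 0 := by exact_mod_cast l.factorial_ne_zero
      have f2 : (s.factorial : ℂ) ≠ 0 := by exact_mod_cast s.factorial_ne_zero
      have f3 : ((l-s).factorial : ℂ) ≠ 0 := by exact_mod_cast (l-s).factorial_ne_zero
      have f4 : a j ^ l = a j ^ s * a j ^ (l - s) := by rw [← pow_add, Nat.add_sub_cancel' hsl]
      rw [f4]
      field_simp
    have e4 := congrArg (fun z : ℂ =>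
      (MvPolynomial.C (Polynomial.C z) : MvPolynomial (Fin (N + 1) × ℕ) (Polynomial ℂ))) e3
    simp only [map_mul] at e4 ⊢
    linear_combination (MvPolynomial.C (Polynomial.derivative^[s] Q) * MvPolynomial.X (w j, l - s)) * e4
  set H := ∑ w, PowerSeries.C (MvPolynomial.C (c w)) * skG N d a w with hH
  have hA : PowerSeries.map (skAct N Q : MvPolynomial (Fin (N + 1) × ℕ) ℂ →+*
      MvPolynomial (Fin (N + 1) × ℕ) (Polynomial ℂ)) H =
      D * PowerSeries.map (MvPolynomial.map (Polynomial.C : ℂ →+* Polynomial ℂ)) H := by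
    simp only [hH, map_sum, map_mul, Finset.mul_sum, hG, PowerSeries.map_C, MvPolynomial.map_C]
    refine Finset.sum_congr rfl fun w _ => ?_
    have e2 : ∀ z : ℂ, skAct N Q (MvPolynomial.C z) = MvPolynomial.C (Polynomial.C z) := by
      intro z
      rw [← MvPolynomial.algebraMap_eq, AlgHom.commutes]
      rfl
    rw [RingHom.coe_coe, e2]
    ring
  have hB := congrArg (PowerSeries.coeff m) hA
  rw [PowerSeries.coeff_map, PowerSeries.coeff_mul, ← skPhi_apply] at hB
  rw [RingHom.coe_coe] at hB
  rw [hB, Finset.sum_eq_single (0, m)]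
  · rw [PowerSeries.coeff_map, ← skPhi_apply]
    congr 1
    simp [D]
  · rintro ⟨s, r⟩ hsr hne
    rw [Finset.HasAntidiagonal.mem_antidiagonal] at hsr
    have hr : r < m := by
      rcases Nat.eq_zero_or_pos s with h | h
      · exfalso; apply hne; simp at hsr; simp [h] at hsr ⊢; exact hsr
      · simp at hsr; omega
    rw [PowerSeries.coeff_map, ← skPhi_apply, hc r hr, map_zero, mul_zero]
  · intro h
    simp at h

noncomputable def skD (σ : Type) : (σ → ℂ) →ₗ[ℂ] Module.End ℂ (MvPolynomial σ ℂ) where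
  toFun u := (MvPolynomial.mkDerivation ℂ (fun v => (MvPolynomial.C (u v) : MvPolynomial σ ℂ))).toLinearMap
  map_add' u u' := by
    have h : (fun v => (MvPolynomial.C ((u + u') v) : MvPolynomial σ ℂ))
      = (fun v => MvPolynomial.C (u v)) + (fun v => MvPolynomial.C (u' v)) := by
      funext v; simp
    rw [h]
    have h2 := (MvPolynomial.mkDerivationEquiv (A := MvPolynomial σ ℂ) ℂ).map_add
      (fun v => MvPolynomial.C (u v)) (fun v => MvPolynomial.C (u' v))
    exact congrArg Derivation.toLinearMap h2
  map_smul' c u := by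
    have h : (fun v => (MvPolynomial.C ((c • u) v) : MvPolynomial σ ℂ))
      = c • (fun v => (MvPolynomial.C (u v) : MvPolynomial σ ℂ)) := by
      funext v; simp [MvPolynomial.smul_eq_C_mul]
    rw [h]
    have h2 := (MvPolynomial.mkDerivationEquiv (A := MvPolynomial σ ℂ) ℂ).map_smul c
      (fun v => MvPolynomial.C (u v))
    exact congrArg Derivation.toLinearMap h2

theorem skD_apply (σ : Type) (u : σ → ℂ) (P : MvPolynomial σ ℂ) :
    skD σ u P = MvPolynomial.mkDerivation ℂ (fun v => (MvPolynomial.C (u v) : MvPolynomial σ ℂ)) P :=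
  rfl

theorem skD_single (σ : Type) [DecidableEq σ] (v : σ) (P : MvPolynomial σ ℂ) :
    skD σ (Pi.single v 1) P = MvPolynomial.pderiv v P := by
  rw [skD_apply, MvPolynomial.pderiv]
  congr 2
  funext u
  by_cases h : u = v
  · subst h; simp
  · simp [h]

noncomputable def skDelta (σ : Type) (d : ℕ) (P : MvPolynomial σ ℂ) :
    MultilinearMap ℂ (fun _ : Fin d => σ → ℂ) ℂ :=
  (MvPolynomial.lcoeff ℂ 0 ∘ₗ LinearMap.applyₗ P).compMultilinearMap
    ((MultilinearMap.mkPiAlgebraFin ℂ d (Module.End ℂ (MvPolynomial σ ℂ))).compLinearMap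
      (fun _ => skD σ))

theorem skDelta_apply (σ : Type) (d : ℕ) (P : MvPolynomial σ ℂ) (u : Fin d → σ → ℂ) :
    skDelta σ d P u = MvPolynomial.coeff 0 ((List.ofFn fun j => skD σ (u j)).prod P) := by
  simp [skDelta, MvPolynomial.lcoeff]

theorem skDelta_succ (σ : Type) (d : ℕ) (P : MvPolynomial σ ℂ) (u : Fin (d+1) → σ → ℂ) :
    skDelta σ (d+1) P u
      = skDelta σ d (skD σ (u (Fin.last d)) P) (fun j => u j.castSucc) := by
  rw [skDelta_apply, skDelta_apply, List.ofFn_succ', List.concat_eq_append, List.prod_append]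
  simp

theorem sk_euler (σ : Type) (d : ℕ) (B : Finset σ) (P : MvPolynomial σ ℂ)
    (hP : P.IsHomogeneous d) (hB : P ∈ MvPolynomial.supported ℂ (B : Set σ)) :
    ∑ v ∈ B, MvPolynomial.X v * MvPolynomial.pderiv v P = (d : ℂ) • P := by
  conv_lhs => rw [P.as_sum]
  conv_rhs => rw [P.as_sum]
  simp only [map_sum, Finset.mul_sum, Finset.smul_sum]
  rw [Finset.sum_comm]
  refine Finset.sum_congr rfl fun l hl => ?_
  simp only [MvPolynomial.X_mul_pderiv_monomial]
  rw [← Finset.sum_smul, ← Nat.cast_smul_eq_nsmul ℂ]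
  congr 2
  have h1 : l.degree = d := by
    rw [Finsupp.degree_eq_weight_one]
    exact hP (MvPolynomial.mem_support_iff.1 hl)
  rw [← h1, Finsupp.degree_apply]
  symm
  apply Finset.sum_subset
  · intro v hv
    rw [MvPolynomial.mem_supported] at hB
    exact_mod_cast hB (MvPolynomial.mem_vars v |>.2 ⟨l, hl, hv⟩)
  · intro v _ hv
    simpa using hv

theorem sk_supported_pderiv (σ : Type) (B : Set σ) (P : MvPolynomial σ ℂ) (v : σ)
    (hB : P ∈ MvPolynomial.supported ℂ B) :
    MvPolynomial.pderiv v P ∈ MvPolynomial.supported ℂ B := by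
  classical
  rw [MvPolynomial.supported] at hB
  induction hB using Algebra.adjoin_induction with
  | mem x hx =>
    obtain ⟨u, hu, rfl⟩ := hx
    rw [MvPolynomial.pderiv_X]
    by_cases h : u = v
    · subst h; simpa using Subalgebra.one_mem _
    · simp [Pi.single_apply, Ne.symm h, Subalgebra.zero_mem]
  | algebraMap r =>
    rw [MvPolynomial.algebraMap_eq, MvPolynomial.pderiv_C]
    exact Subalgebra.zero_mem _
  | add x y _ _ hx hy => rw [map_add]; exact Subalgebra.add_mem _ hx hy
  | mul x y hx' hy' hx hy =>
    rw [MvPolynomial.pderiv_mul]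
    exact Subalgebra.add_mem _ (Subalgebra.mul_mem _ hx hy') (Subalgebra.mul_mem _ hx' hy)

theorem sk_reconstruct (σ : Type) [DecidableEq σ] (B : Finset σ) (d : ℕ) :
    ∀ (P : MvPolynomial σ ℂ), P.IsHomogeneous d → P ∈ MvPolynomial.supported ℂ (B : Set σ) →
    (d.factorial : ℂ) • P = ∑ z ∈ Fintype.piFinset (fun _ : Fin d => B),
      MvPolynomial.C (skDelta σ d P (fun j => Pi.single (z j) 1)) * ∏ j, MvPolynomial.X (z j) := by
  induction d with
  | zero =>
    intro P hP _
    rw [← MvPolynomial.totalDegree_zero_iff_isHomogeneous,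
      MvPolynomial.totalDegree_eq_zero_iff_eq_C] at hP
    simp [skDelta_apply]
    exact hP
  | succ d ih =>
    intro P hP hB
    have h1 : ((d+1).factorial : ℂ) • P
        = ∑ v ∈ B, MvPolynomial.X v * ((d.factorial : ℂ) • MvPolynomial.pderiv v P) := by
      simp only [mul_smul_comm, ← Finset.smul_sum]
      rw [sk_euler σ (d+1) B P hP hB, smul_smul, Nat.factorial_succ]
      push_cast
      rw [mul_comm]
    rw [h1]
    have h2 : ∀ v ∈ B, MvPolynomial.X v * ((d.factorial : ℂ) • MvPolynomial.pderiv v P)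
        = ∑ z ∈ Fintype.piFinset (fun _ : Fin d => B), MvPolynomial.X v *
          (MvPolynomial.C (skDelta σ d (MvPolynomial.pderiv v P) (fun j => Pi.single (z j) 1))
          * ∏ j, MvPolynomial.X (z j)) := by
      intro v _
      rw [ih _ (by simpa using hP.pderiv (i := v)) (sk_supported_pderiv σ B P v hB), Finset.mul_sum]
    rw [Finset.sum_congr rfl h2, ← Finset.sum_product']
    refine Finset.sum_nbij' (fun q => Fin.snoc (α := fun _ => σ) q.2 q.1)
      (fun z => (z (Fin.last d), fun j => z j.castSucc)) ?_ ?_ ?_ ?_ ?_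
    · rintro ⟨v, z⟩ h
      simp only [Finset.mem_product, Fintype.mem_piFinset] at h ⊢
      intro j
      refine Fin.lastCases ?_ (fun i => ?_) j
      · simpa using h.1
      · simpa using h.2 i
    · intro z h
      simp only [Finset.mem_product, Fintype.mem_piFinset] at h ⊢
      exact ⟨h _, fun j => h _⟩
    · rintro ⟨v, z⟩ _
      simp
    · intro z _
      exact Fin.snoc_init_self (α := fun _ => σ) z
    · rintro ⟨v, z⟩ _
      rw [skDelta_succ, Fin.prod_univ_castSucc]
      simp only [Fin.snoc_last, Fin.snoc_castSucc, skD_single]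
      ring

noncomputable def skA (N : ℕ) (τ : ℂ) :
    MvPolynomial (Fin (N+1) × ℕ) ℂ →ₐ[ℂ] MvPolynomial (Fin (N+1) × ℕ) ℂ :=
  MvPolynomial.aeval fun v => MvPolynomial.X v +
    MvPolynomial.C (τ * (v.2 : ℂ)) * MvPolynomial.X (v.1, v.2 - 1)

noncomputable def skAv (N : ℕ) (τ : ℂ) (u : Fin (N+1) × ℕ → ℂ) : Fin (N+1) × ℕ → ℂ :=
  fun v => u v + τ * (v.2 : ℂ) * u (v.1, v.2 - 1)

theorem skD_A (N : ℕ) (τ : ℂ) (u : Fin (N+1) × ℕ → ℂ) (P : MvPolynomial (Fin (N+1) × ℕ) ℂ) :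
    skD _ u (skA N τ P) = skA N τ (skD _ (skAv N τ u) P) := by
  simp only [skD_apply]
  induction P using MvPolynomial.induction_on with
  | C c =>
    rw [← MvPolynomial.algebraMap_eq, AlgHom.commutes]
    simp
  | add p q hp hq => simp only [map_add, hp, hq]
  | mul_X p v hp =>
    simp only [map_mul, Derivation.leibniz, hp, map_add, smul_eq_mul, MvPolynomial.mkDerivation_X]
    congr 1
    · congr 1
      have e2 : ∀ z : ℂ, skA N τ (MvPolynomial.C z) = MvPolynomial.C z := by
        intro z
        rw [← MvPolynomial.algebraMap_eq, AlgHom.commutes]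
      rw [e2]
      simp [skA, skAv, MvPolynomial.mkDerivation_X]

theorem sk_coeff_zero_A (N : ℕ) (τ : ℂ) (P : MvPolynomial (Fin (N+1) × ℕ) ℂ) :
    MvPolynomial.coeff 0 (skA N τ P) = MvPolynomial.coeff 0 P := by
  rw [← MvPolynomial.constantCoeff_eq]
  induction P using MvPolynomial.induction_on with
  | C c => rw [← MvPolynomial.algebraMap_eq, AlgHom.commutes]
  | add p q hp hq => simp only [map_add, hp, hq]
  | mul_X p v hp => simp [skA]

theorem skDelta_A (N : ℕ) (τ : ℂ) (d : ℕ) :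
    ∀ (P : MvPolynomial (Fin (N+1) × ℕ) ℂ) (u : Fin d → Fin (N+1) × ℕ → ℂ),
    skDelta _ d (skA N τ P) u = skDelta _ d P (fun j => skAv N τ (u j)) := by
  induction d with
  | zero => intro P u; simp [skDelta_apply, sk_coeff_zero_A]
  | succ d ih => intro P u; rw [skDelta_succ, skD_A, ih, skDelta_succ]

noncomputable def skEps (N : ℕ) (i : Fin (N+1)) (l : ℕ) : Fin (N+1) × ℕ → ℂ :=
  Pi.single (i, l) (l.factorial : ℂ)

theorem skAv_eps (N : ℕ) (τ : ℂ) (i : Fin (N+1)) (l : ℕ) :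
    skAv N τ (skEps N i l) = τ • skEps N i (l+1) + skEps N i l := by
  funext ⟨i', l'⟩
  simp only [skAv, skEps, Pi.add_apply, Pi.smul_apply, Pi.single_apply, smul_eq_mul, Prod.mk.injEq]
  by_cases hi : i' = i
  · subst hi
    rcases l' with _ | n
    · simp
    · simp only [true_and, Nat.add_sub_cancel]
      by_cases hn : n = l
      · subst hn
        simp [Nat.factorial_succ]
        ring
      · simp [hn]
  · simp [hi]

noncomputable def skLam (N d : ℕ) (P : MvPolynomial (Fin (N+1) × ℕ) ℂ) (w : Fin d → Fin (N+1)) :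
    MvPolynomial (Fin d) ℂ →ₗ[ℂ] ℂ :=
  (MvPolynomial.basisMonomials (Fin d) ℂ).constr ℂ
    (fun l => skDelta _ d P (fun j => skEps N (w j) (l j)))

theorem skLam_monomial (N d : ℕ) (P : MvPolynomial (Fin (N+1) × ℕ) ℂ) (w : Fin d → Fin (N+1))
    (l : Fin d →₀ ℕ) : skLam N d P w (MvPolynomial.monomial l 1)
      = skDelta _ d P (fun j => skEps N (w j) (l j)) := by
  have := (MvPolynomial.basisMonomials (Fin d) ℂ).constr_basis ℂ
    (fun l => skDelta _ d P (fun j => skEps N (w j) (l j))) l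
  rwa [MvPolynomial.coe_basisMonomials] at this

theorem skLam_kill (N d : ℕ) (P : MvPolynomial (Fin (N+1) × ℕ) ℂ) (w : Fin d → Fin (N+1))
    (hP : ∀ τ, skA N τ P = P) (p : MvPolynomial (Fin d) ℂ) (k : ℕ) :
    skLam N d P w (p * MvPolynomial.esymm (Fin d) ℂ (k+1)) = 0 := by
  classical
  suffices h : ∀ l : Fin d →₀ ℕ,
      skLam N d P w (MvPolynomial.monomial l 1 * MvPolynomial.esymm (Fin d) ℂ (k+1)) = 0 by
    rw [p.as_sum, Finset.sum_mul, map_sum]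
    refine Finset.sum_eq_zero fun l _ => ?_
    have : MvPolynomial.monomial l (MvPolynomial.coeff l p)
        = (MvPolynomial.coeff l p) • MvPolynomial.monomial l (1:ℂ) := by
      rw [MvPolynomial.smul_monomial, smul_eq_mul, mul_one]
    rw [this, smul_mul_assoc, map_smul, h, smul_zero]
  intro l
  have key : ∀ τ : ℂ, ∑ k ∈ Finset.range (d+1), skLam N d P w (MvPolynomial.monomial l 1 *
      MvPolynomial.esymm (Fin d) ℂ k) * τ ^ k = skLam N d P w (MvPolynomial.monomial l 1) := by
    intro τ
    rw [skLam_monomial]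
    conv_rhs => rw [← hP τ, skDelta_A]
    have h1 : (fun j => skAv N τ (skEps N (w j) (l j)))
        = (fun j => τ • skEps N (w j) (l j + 1)) + (fun j => skEps N (w j) (l j)) := by
      funext j
      rw [skAv_eps]; rfl
    rw [h1, MultilinearMap.map_add_univ, ← Finset.powerset_univ, Finset.sum_powerset]
    rw [Finset.card_univ, Fintype.card_fin]
    refine Finset.sum_congr rfl fun k _ => ?_
    rw [MvPolynomial.esymm, Finset.mul_sum, map_sum, Finset.sum_mul]
    refine Finset.sum_congr rfl fun s hs => ?_
    have h2 : MvPolynomial.monomial l (1:ℂ) * ∏ i ∈ s, MvPolynomial.X i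
        = MvPolynomial.monomial (l + ∑ i ∈ s, Finsupp.single i 1) 1 := by
      have : ∏ i ∈ s, (MvPolynomial.X i : MvPolynomial (Fin d) ℂ)
          = MvPolynomial.monomial (∑ i ∈ s, Finsupp.single i 1) 1 := by
        rw [MvPolynomial.monomial_sum_one]
        rfl
      rw [this, MvPolynomial.monomial_mul, one_mul]
    have h3 : s.piecewise (fun j => τ • skEps N (w j) (l j + 1)) (fun j => skEps N (w j) (l j))
        = s.piecewise (fun j => τ • (fun j => skEps N (w j)
            ((l + ∑ i ∈ s, Finsupp.single i 1 : Fin d →₀ ℕ) j)) j)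
          (fun j => skEps N (w j) ((l + ∑ i ∈ s, Finsupp.single i 1 : Fin d →₀ ℕ) j)) := by
      funext j
      by_cases hj : j ∈ s
      · simp [hj, Finsupp.single_apply]
      · simp [hj, Finsupp.single_apply]
    rw [h2, skLam_monomial, h3, MultilinearMap.map_piecewise_smul]
    rw [Finset.prod_const, (Finset.mem_powersetCard.1 hs).2, smul_eq_mul, mul_comm]
  by_cases hk : k + 1 < d + 1
  · let f : Polynomial ℂ := ∑ k ∈ Finset.range (d+1), Polynomial.C (skLam N d P w
      (MvPolynomial.monomial l 1 * MvPolynomial.esymm (Fin d) ℂ k)) * Polynomial.X ^ k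
    have hf : f = Polynomial.C (skLam N d P w (MvPolynomial.monomial l 1)) := by
      apply Polynomial.funext
      intro τ
      rw [Polynomial.eval_C, ← key τ]
      simp [f, Polynomial.eval_finsetSum]
    have := congrArg (fun g => Polynomial.coeff g (k+1)) hf
    simp only [f, Polynomial.finsetSum_coeff, Polynomial.coeff_C_mul, Polynomial.coeff_X_pow,
      Polynomial.coeff_C_succ] at this
    rw [Finset.sum_eq_single (k+1)] at this
    · simpa using this
    · intro j _ hj
      simp [Ne.symm hj]
    · intro h
      exact absurd (Finset.mem_range.2 hk) h
  · have : MvPolynomial.esymm (Fin d) ℂ (k+1) = 0 := by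
      rw [MvPolynomial.esymm, Finset.powersetCard_eq_empty.2 (by simp; omega), Finset.sum_empty]
    rw [this, mul_zero, map_zero]

theorem sk_A_of_act (N d : ℕ) (P : MvPolynomial (Fin (N+1) × ℕ) ℂ)
    (h : ∀ Q : Polynomial ℂ, skAct N Q P = MvPolynomial.C (Q ^ d)
          * MvPolynomial.map (Polynomial.C : ℂ →+* Polynomial ℂ) P) (τ : ℂ) : skA N τ P = P := by
  let Q : Polynomial ℂ := 1 + Polynomial.C τ * Polynomial.X
  have h1 := congrArg (MvPolynomial.map (Polynomial.evalRingHom (0:ℂ))) (h Q)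
  have hid : (Polynomial.evalRingHom (0:ℂ)).comp Polynomial.C = RingHom.id ℂ := by
    ext x; simp
  rw [map_mul, MvPolynomial.map_map, hid, MvPolynomial.map_id, MvPolynomial.map_C] at h1
  have h2 : MvPolynomial.C (Polynomial.evalRingHom (0:ℂ) (Q ^ d)) * P = P := by simp [Q]
  rw [h2] at h1
  have key : ∀ P, MvPolynomial.map (Polynomial.evalRingHom (0:ℂ)) (skAct N Q P) = skA N τ P := by
    intro P
    induction P using MvPolynomial.induction_on with
    | C c =>
      rw [← MvPolynomial.algebraMap_eq, AlgHom.commutes, AlgHom.commutes,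
        IsScalarTower.algebraMap_apply ℂ (Polynomial ℂ) (MvPolynomial _ (Polynomial ℂ)),
        MvPolynomial.algebraMap_eq, MvPolynomial.map_C]
      simp
    | add p q hp hq => simp only [map_add, hp, hq]
    | mul_X p v hp =>
      rw [map_mul, map_mul, map_mul, hp]
      refine congrArg (fun x => skA N τ p * x) ?_
      obtain ⟨i, l⟩ := v
      have hQ : ∀ s, Polynomial.derivative^[s+2] Q = 0 := by
        intro s
        apply Polynomial.iterate_derivative_eq_zero
        have : Q.natDegree ≤ 1 := by
          show (1 + Polynomial.C τ * Polynomial.X : Polynomial ℂ).natDegree ≤ 1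
          compute_degree
        omega
      rw [skAct, skA, MvPolynomial.aeval_X, MvPolynomial.aeval_X, map_sum]
      rcases l with _ | n
      · simp [Q]
      · rw [Finset.sum_range_succ', Finset.sum_range_succ']
        rw [Finset.sum_eq_zero]
        · simp [Q]
          ring
        · intro s _
          rw [show s + 1 + 1 = s + 2 from rfl, hQ s]
          simp
  rw [← key, h1]

theorem sk_comp (N d m : ℕ) (P : MvPolynomial (Fin (N+1) × ℕ) ℂ) (hP : P.IsHomogeneous d) :
    (d.factorial : ℂ) • MvPolynomial.weightedHomogeneousComponent
        (fun v : Fin (N+1) × ℕ => v.2) m P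
      = ∑ w : Fin d → Fin (N+1), ∑ l ∈ (Finset.univ : Finset (Fin d)).finsuppAntidiag m,
        MvPolynomial.C (skLam N d P w (MvPolynomial.monomial l 1)) *
        ∏ j, (MvPolynomial.C (1 / ((l j).factorial : ℂ)) * MvPolynomial.X (w j, l j)) := by
  classical
  let L : ℕ := m + 1 + P.vars.sup (fun v => v.2 + 1)
  let B : Finset (Fin (N+1) × ℕ) := Finset.univ ×ˢ Finset.range L
  have hB : P ∈ MvPolynomial.supported ℂ (B : Set (Fin (N+1) × ℕ)) := by
    rw [MvPolynomial.mem_supported]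
    intro v hv
    have h1 : v.2 + 1 ≤ P.vars.sup (fun v => v.2 + 1) :=
      Finset.le_sup (f := fun v : Fin (N+1) × ℕ => v.2 + 1) hv
    simp only [B, L, Finset.coe_product, Finset.coe_univ, Finset.coe_range, Set.mem_prod,
      Set.mem_univ, Set.mem_Iio, true_and]
    omega
  rw [← map_smul, sk_reconstruct _ B d P hP hB, map_sum]
  have hterm : ∀ z : Fin d → Fin (N+1) × ℕ,
      MvPolynomial.weightedHomogeneousComponent (fun v : Fin (N+1) × ℕ => v.2) m
        (MvPolynomial.C (skDelta _ d P (fun j => Pi.single (z j) 1)) *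
          ∏ j, MvPolynomial.X (z j))
      = if m = ∑ j, (z j).2 then
        (MvPolynomial.C (skDelta _ d P (fun j => Pi.single (z j) 1)) *
          ∏ j, MvPolynomial.X (z j)) else 0 := by
    intro z
    apply MvPolynomial.weightedHomogeneousComponent_of_mem
    rw [← MvPolynomial.smul_eq_C_mul]
    apply Submodule.smul_mem
    rw [MvPolynomial.mem_weightedHomogeneousSubmodule]
    exact MvPolynomial.IsWeightedHomogeneous.prod _ _ _
      (fun j _ => MvPolynomial.isWeightedHomogeneous_X ℂ _ (z j))
  simp only [hterm]
  rw [← Finset.sum_filter, ← Finset.sum_product']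
  refine Finset.sum_bij'
    (fun z _ => ((fun j => (z j).1), Finsupp.equivFunOnFinite.symm (fun j => (z j).2)))
    (fun wl _ => fun j => (wl.1 j, wl.2 j)) ?_ ?_ ?_ ?_ ?_
  · intro z hz
    rw [Finset.mem_filter] at hz
    simp [Finset.mem_finsuppAntidiag, hz.2]
  · intro wl hwl
    simp only [Finset.mem_product, Finset.mem_univ, true_and, Finset.mem_finsuppAntidiag] at hwl
    simp only [Finset.mem_filter, Fintype.mem_piFinset]
    refine ⟨fun j => ?_, hwl.1.symm⟩
    have : wl.2 j ≤ m := by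
      rw [← hwl.1]
      exact Finset.single_le_sum (f := fun j => wl.2 j) (fun _ _ => Nat.zero_le _) (Finset.mem_univ j)
    simp only [B, L, Finset.mem_product, Finset.mem_univ, true_and, Finset.mem_range]
    omega
  · intro z _
    funext j
    simp
  · intro wl _
    ext <;> simp
  · intro z _
    rw [skLam_monomial]
    have h1 : (fun j => skEps N (z j).1 (z j).2)
        = fun j => (((z j).2.factorial : ℂ)) • (Pi.single (z j) 1 : Fin (N+1) × ℕ → ℂ) := by
      funext j
      simp [skEps, ← Pi.single_smul]
    simp only [Finsupp.equivFunOnFinite_symm_apply_apply]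
    rw [h1, MultilinearMap.map_smul_univ, Finset.prod_mul_distrib, ← map_prod, ← mul_assoc,
      ← map_mul]
    congr 2
    rw [smul_eq_mul, mul_right_comm, ← Finset.prod_mul_distrib, Finset.prod_eq_one, one_mul]
    intro j _
    have : ((z j).2.factorial : ℂ) ≠ 0 := by exact_mod_cast Nat.factorial_ne_zero _
    field_simp

theorem skG_perm (N d : ℕ) (a : Fin d → ℂ) (w : Fin d → Fin (N+1)) (σ : Equiv.Perm (Fin d)) :
    skG N d a (w ∘ σ.symm) = skG N d (a ∘ σ) w := by
  rw [skG, skG, ← Equiv.prod_comp σ]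
  simp

theorem sk_comp_mem (N d m : ℕ) (a : Fin d → ℂ) (ha : Function.Injective a)
    (P : MvPolynomial (Fin (N+1) × ℕ) ℂ) (hP : P.IsHomogeneous d)
    (h : ∀ Q : Polynomial ℂ, skAct N Q P = MvPolynomial.C (Q ^ d)
          * MvPolynomial.map (Polynomial.C : ℂ →+* Polynomial ℂ) P) :
    ∃ u, (∀ k < m, skPhi N d a k u = 0) ∧
      skPhi N d a m u = (d.factorial : ℂ) • MvPolynomial.weightedHomogeneousComponent
        (fun v : Fin (N+1) × ℕ => v.2) m P := by
  classical
  have hA := sk_A_of_act N d P h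
  choose c hc using fun w => sk_functional d a ha m (skLam N d P w)
    (fun p k => skLam_kill N d P w hA p k)
  let u : (Fin d → Fin (N+1)) → ℂ :=
    ∑ w, ∑ σ : Equiv.Perm (Fin d), c w σ • Pi.single (w ∘ σ.symm) 1
  have hu : ∀ k, skPhi N d a k u = ∑ w, ∑ l ∈ (Finset.univ : Finset (Fin d)).finsuppAntidiag k,
        MvPolynomial.C (∑ σ, c w σ * ∏ j, a (σ j) ^ l j) *
        ∏ j, (MvPolynomial.C (1 / ((l j).factorial : ℂ)) * MvPolynomial.X (w j, l j)) := by
    intro k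
    simp only [u, map_sum, map_smul]
    refine Finset.sum_congr rfl fun w _ => ?_
    have h1 : ∀ σ : Equiv.Perm (Fin d), skPhi N d a k (Pi.single (w ∘ σ.symm) 1)
        = PowerSeries.coeff k (skG N d (a ∘ σ) w) := by
      intro σ
      rw [skPhi, Fintype.linearCombination_apply_single, one_smul, skG_perm]
    simp only [h1, skG_coeff, Finset.smul_sum]
    rw [Finset.sum_comm]
    refine Finset.sum_congr rfl fun l _ => ?_
    rw [Finset.sum_mul]
    refine Finset.sum_congr rfl fun σ _ => ?_
    rw [MvPolynomial.smul_eq_C_mul, map_mul, mul_assoc]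
    rfl
  have hdeg : ∀ k (l : Fin d →₀ ℕ), l ∈ (Finset.univ : Finset (Fin d)).finsuppAntidiag k →
      l.degree = k := by
    intro k l hl
    rw [Finset.mem_finsuppAntidiag] at hl
    rw [Finsupp.degree_eq_sum, ← hl.1]
  refine ⟨u, ?_, ?_⟩
  · intro k hk
    rw [hu]
    refine Finset.sum_eq_zero fun w _ => Finset.sum_eq_zero fun l hl => ?_
    rw [(hc w l).2 (by rw [hdeg k l hl]; exact hk)]
    simp
  · rw [hu, sk_comp N d m P hP]
    refine Finset.sum_congr rfl fun w _ => Finset.sum_congr rfl fun l hl => ?_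
    rw [(hc w l).1 (hdeg m l hl)]

/-- Schmidt–Kolchin–Reinhart, proved by Etesse: the space of
differentially homogeneous polynomials of degree d in the jet variables
X_i^{(l)}, 0 ≤ i ≤ N, l ≥ 0, has dimension (N+1)^d. Differential homogeneity:
for every Q ∈ ℂ[T], substituting X_i^{(l)} ↦ Σ_s binom(l,s) Q^{(s)} X_i^{(l-s)}
(Leibniz) multiplies P by Q^d, as an identity of polynomials with coefficients in
ℂ[T]. The dimension is expressed by a linearly independent family of (N+1)^d
elements of the space spanning it. -/
theorem stmt_17 (N d : ℕ) :
    let S : Set (MvPolynomial (Fin (N + 1) × ℕ) ℂ) :=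
      {P | P.IsHomogeneous d ∧ ∀ Q : Polynomial ℂ,
        (MvPolynomial.aeval fun p : Fin (N + 1) × ℕ =>
          (∑ s ∈ Finset.range (p.2 + 1),
            MvPolynomial.C (Polynomial.C ((p.2.choose s : ℂ))
                * (Polynomial.derivative^[s] Q))
              * MvPolynomial.X (p.1, p.2 - s)
            : MvPolynomial (Fin (N + 1) × ℕ) (Polynomial ℂ))) P
        = MvPolynomial.C (Q ^ d)
          * MvPolynomial.map (Polynomial.C : ℂ →+* Polynomial ℂ) P}
    ∃ g : Fin ((N + 1) ^ d) → MvPolynomial (Fin (N + 1) × ℕ) ℂ,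
      (∀ i, g i ∈ S) ∧ LinearIndependent ℂ g ∧
      ∀ P ∈ S, P ∈ Submodule.span ℂ (Set.range g) := by
  classical
  intro S
  let a : Fin d → ℂ := fun j => ((j : ℕ) : ℂ)
  have ha : Function.Injective a := by
    intro i j hij
    simp only [a, Nat.cast_inj] at hij
    exact Fin.ext hij
  let F : ℕ → Submodule ℂ ((Fin d → Fin (N+1)) → ℂ) := fun m =>
    ⨅ k : Fin m, LinearMap.ker (skPhi N d a k)
  have hF : ∀ m u, u ∈ F m ↔ ∀ k < m, skPhi N d a k u = 0 := by
    intro m u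
    simp only [F, Submodule.mem_iInf, LinearMap.mem_ker]
    exact ⟨fun h k hk => h ⟨k, hk⟩, fun h k => h k k.2⟩
  obtain ⟨hfd, hfr⟩ := sk_linalg (skPhi N d a)
    (fun m => MvPolynomial.weightedHomogeneousComponent (fun v : Fin (N+1) × ℕ => v.2) m)
    (fun m u => by
      rw [MvPolynomial.weightedHomogeneousComponent_of_mem (n := m) (skPhi_weight N d a m u),
        if_pos rfl])
    (fun m k u hk => by
      rw [MvPolynomial.weightedHomogeneousComponent_of_mem (n := k) (skPhi_weight N d a k u),
        if_neg hk.symm])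
    (fun u hu => skPhi_inj N d a ha u hu) F hF
  set W := ⨆ m, (F m).map (skPhi N d a m) with hW
  rw [Module.finrank_fintype_fun_eq_card, Fintype.card_fun, Fintype.card_fin,
    Fintype.card_fin] at hfr
  let S' : Submodule ℂ (MvPolynomial (Fin (N+1) × ℕ) ℂ) :=
    { carrier := {P | P.IsHomogeneous d ∧ ∀ Q : Polynomial ℂ, skAct N Q P = MvPolynomial.C (Q ^ d)
          * MvPolynomial.map (Polynomial.C : ℂ →+* Polynomial ℂ) P}
      add_mem' := by
        rintro p q ⟨hp, hp'⟩ ⟨hq, hq'⟩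
        refine ⟨hp.add hq, fun Q => ?_⟩
        rw [map_add, map_add, hp', hq', mul_add]
      zero_mem' := ⟨MvPolynomial.isHomogeneous_zero _ _ _, fun Q => by simp⟩
      smul_mem' := by
        rintro c p ⟨hp, hp'⟩
        refine ⟨?_, fun Q => ?_⟩
        · rw [MvPolynomial.smul_eq_C_mul]
          exact hp.C_mul c
        · rw [map_smul, hp', MvPolynomial.smul_eq_C_mul, map_mul, MvPolynomial.map_C,
            Algebra.smul_def,
            IsScalarTower.algebraMap_apply ℂ (Polynomial ℂ) (MvPolynomial _ (Polynomial ℂ)),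
            MvPolynomial.algebraMap_eq, Polynomial.algebraMap_eq]
          ring }
  have hWS : W ≤ S' := by
    rw [hW]
    refine iSup_le fun m => ?_
    rintro _ ⟨u, hu, rfl⟩
    exact ⟨skPhi_homog N d a m u, fun Q => skPhi_mem N d a m u ((hF m u).1 hu) Q⟩
  have hSW : S' ≤ W := by
    rintro P ⟨hP, hP'⟩
    rw [← MvPolynomial.sum_weightedHomogeneousComponent (fun v : Fin (N+1) × ℕ => v.2) P]
    rw [finsum_eq_sum _ (MvPolynomial.weightedHomogeneousComponent_finsupp P)]
    refine Submodule.sum_mem _ fun m _ => ?_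
    obtain ⟨u, hu, hu'⟩ := sk_comp_mem N d m a ha P hP hP'
    have hd : (d.factorial : ℂ) ≠ 0 := by exact_mod_cast Nat.factorial_ne_zero _
    rw [← Submodule.smul_mem_iff _ hd, ← hu']
    exact Submodule.mem_iSup_of_mem m ⟨u, (hF m u).2 hu, rfl⟩
  let b := Module.finBasisOfFinrankEq ℂ W hfr
  refine ⟨fun i => (b i : MvPolynomial (Fin (N+1) × ℕ) ℂ), fun i => hWS (b i).2, ?_, ?_⟩
  · exact b.linearIndependent.map' W.subtype W.ker_subtype
  · intro P hP
    have hPW : P ∈ W := hSW hP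
    have h1 : Submodule.span ℂ (Set.range fun i => (b i : MvPolynomial (Fin (N+1) × ℕ) ℂ)) = W := by
      have h2 : (Set.range fun i => (b i : MvPolynomial (Fin (N+1) × ℕ) ℂ))
          = W.subtype '' Set.range b := by
        rw [← Set.range_comp]; rfl
      rw [h2, Submodule.span_image, b.span_eq, Submodule.map_top, Submodule.range_subtype]
    rw [h1]
    exact hPW
end
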